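/- Let Π₂(x) denote the number of primes p ≤ x such that p + 2 is also prime, and let C₂ = 2·∏_{p prime, p > 2} (1 − 1/(p−1)²). Then for every ε > 0 there exists a constant X(ε) > 0 such that for all real x ≥ X(ε) one has Π₂(x) ≤ (4 + ε)·C₂·x/(log x)². -/

import Mathlib

open scoped BigOperators

/-- The number of primes `p ≤ x` such that `p + 2` is also prime. -/
noncomputable def Pi2 (x : ℝ) : ℕ :=
  ((Finset.range (⌊x⌋₊ + 1)).filter (fun p => p.Prime ∧ (p + 2).Prime)).card

/-- The twin-prime constant `C₂ = 2 ∏_{p > 2} (1 - 1/(p-1)²)`, product over odd primes. -/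
noncomputable def twinPrimeConst : ℝ :=
  2 * ∏' p : {p : ℕ // p.Prime ∧ 2 < p}, (1 - 1 / (((p : ℕ) : ℝ) - 1) ^ 2)

namespace TwinSieve

open MeasureTheory Filter Topology Set
open scoped FourierTransform

theorem integrable_mul_exp_neg {R : ℝ → ℂ} {B : ℝ} (hB : ∀ u, ‖R u‖ ≤ B) (hc : Continuous R)
    (h0 : ∀ u ≤ 0, R u = 0) {σ : ℝ} (hσ : 0 < σ) :
    Integrable (fun u : ℝ => R u * Complex.exp (-(σ * u : ℂ))) := by
  have h1 : IntegrableOn (fun u : ℝ => B * Real.exp (-σ * u)) (Ioi 0) :=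
    (exp_neg_integrableOn_Ioi 0 hσ).const_mul B
  have h2 : IntegrableOn (fun u : ℝ => R u * Complex.exp (-(σ * u : ℂ))) (Ioi 0) := by
    refine Integrable.mono' h1 (by fun_prop) ?_
    filter_upwards with u
    rw [norm_mul, Complex.norm_exp]
    have : (-(σ * u : ℂ)).re = -σ * u := by simp
    rw [this]
    gcongr
    exact hB u
  rw [← integrableOn_univ, ← Iic_union_Ioi (a := (0:ℝ))]
  refine IntegrableOn.union ?_ h2
  refine (integrableOn_zero (ε' := ℂ)).congr_fun (fun u hu => ?_) measurableSet_Iic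
  simp [h0 u hu]

theorem integral_mul_exp_mul_fourier {R : ℝ → ℂ} {B : ℝ} (hB : ∀ u, ‖R u‖ ≤ B)
    (hc : Continuous R) (h0 : ∀ u ≤ 0, R u = 0) {k : ℝ → ℂ} (hk : Continuous k)
    (hki : Integrable k) {σ : ℝ} (hσ : 0 < σ) (T : ℝ) :
    ∫ u : ℝ, R u * Complex.exp (-(σ * u : ℂ)) * 𝓕 k (T - u) =
      ∫ t : ℝ, Complex.exp ((-2 * Real.pi * t * T : ℝ) * Complex.I) *
        (k t * ∫ u : ℝ, R u * Complex.exp (-u * (σ - 2 * Real.pi * t * Complex.I))) := by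
  have hint := integrable_mul_exp_neg hB hc h0 hσ
  calc ∫ u : ℝ, R u * Complex.exp (-(σ * u : ℂ)) * 𝓕 k (T - u)
      = ∫ u : ℝ, ∫ t : ℝ, R u * Complex.exp (-(σ * u : ℂ)) *
          (Complex.exp ((-2 * Real.pi * t * (T - u) : ℝ) * Complex.I) * k t) := by
        congr 1; ext u
        rw [Real.fourier_real_eq_integral_exp_smul, ← integral_const_mul]
        simp only [smul_eq_mul]
    _ = ∫ t : ℝ, ∫ u : ℝ, R u * Complex.exp (-(σ * u : ℂ)) *
          (Complex.exp ((-2 * Real.pi * t * (T - u) : ℝ) * Complex.I) * k t) := by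
        apply integral_integral_swap
        have h3 := hint.mul_prod hki
        refine h3.mono (Continuous.aestronglyMeasurable ?_) ?_
        · simp only [Function.uncurry_def]
          fun_prop
        · filter_upwards with p
          simp only [Function.uncurry, norm_mul, Complex.norm_exp_ofReal_mul_I, one_mul]
          exact le_rfl
    _ = _ := by
        congr 1; ext t
        rw [← mul_assoc, ← integral_const_mul]
        congr 1; ext u
        have : Complex.exp (-u * (σ - 2 * Real.pi * t * Complex.I)) *
            Complex.exp ((-2 * Real.pi * t * T : ℝ) * Complex.I) =
            Complex.exp (-(σ * u : ℂ)) *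
              Complex.exp ((-2 * Real.pi * t * (T - u) : ℝ) * Complex.I) := by
          rw [← Complex.exp_add, ← Complex.exp_add]
          congr 1
          push_cast
          ring
        linear_combination (-(R u * k t)) * this

theorem tendsto_integral_mul_fourier {R : ℝ → ℂ} {B : ℝ} (hB : ∀ u, ‖R u‖ ≤ B)
    (hc : Continuous R) (h0 : ∀ u ≤ 0, R u = 0) {G : ℂ → ℂ}
    (hG : ContinuousOn G {z | 0 ≤ z.re})
    (hRG : ∀ z : ℂ, 0 < z.re → ∫ u : ℝ, R u * Complex.exp (-u * z) = G z)
    {k : ℝ → ℂ} (hk : Continuous k) (hks : HasCompactSupport k) (hφ : Integrable (𝓕 k)) :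
    Tendsto (fun T : ℝ => ∫ u : ℝ, R u * 𝓕 k (T - u)) atTop (𝓝 0) := by
  have hki : Integrable k := hk.integrable_of_hasCompactSupport hks
  have key : ∀ T : ℝ, ∫ u : ℝ, R u * 𝓕 k (T - u) =
      𝓕 (fun t : ℝ => k t * G (0 - 2 * Real.pi * t * Complex.I)) T := by
    intro T
    rw [Real.fourier_real_eq_integral_exp_smul]
    simp only [smul_eq_mul]
    have hL : Tendsto (fun σ : ℝ => ∫ u : ℝ, R u * Complex.exp (-(σ * u : ℂ)) * 𝓕 k (T - u))
        (𝓝[>] 0) (𝓝 (∫ u : ℝ, R u * 𝓕 k (T - u))) := by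
      have hint : Integrable (fun u : ℝ => B * ‖𝓕 k (T - u)‖) :=
        ((hφ.comp_sub_left T).norm).const_mul B
      refine tendsto_integral_filter_of_dominated_convergence _ ?_ ?_ hint ?_
      · refine Eventually.of_forall fun σ => ?_
        refine AEStronglyMeasurable.mul (by fun_prop) ?_
        exact (hφ.comp_sub_left T).aestronglyMeasurable
      · filter_upwards [self_mem_nhdsWithin] with σ hσ
        filter_upwards with u
        rw [norm_mul, norm_mul, Complex.norm_exp]
        gcongr
        rcases le_or_gt u 0 with hu | hu
        · rw [h0 u hu, norm_zero, zero_mul]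
          exact (norm_nonneg _).trans (hB 0)
        · calc ‖R u‖ * Real.exp (-(σ * u : ℂ)).re ≤ B * 1 := by
                gcongr
                · exact (norm_nonneg _).trans (hB 0)
                · exact hB u
                · rw [Real.exp_le_one_iff]
                  have : (-(σ * u : ℂ)).re = -(σ * u) := by simp
                  rw [this]
                  have : (0:ℝ) < σ := hσ
                  nlinarith
            _ = B := mul_one B
      · filter_upwards with u
        have : Tendsto (fun σ : ℝ => R u * Complex.exp (-(σ * u : ℂ)) * 𝓕 k (T - u)) (𝓝 0)
            (𝓝 (R u * Complex.exp (-((0:ℝ) * u : ℂ)) * 𝓕 k (T - u))) := by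
          apply Continuous.tendsto (f := fun σ : ℝ =>
            R u * Complex.exp (-(σ * u : ℂ)) * 𝓕 k (T - u))
          fun_prop
        simpa using this.mono_left nhdsWithin_le_nhds
    have hmap : ∀ σ t : ℝ, ((σ : ℂ) - 2 * Real.pi * t * Complex.I).re = σ := by
      intro σ t; simp
    have hRr : Tendsto (fun σ : ℝ => ∫ t : ℝ,
          Complex.exp ((-2 * Real.pi * t * T : ℝ) * Complex.I) *
            (k t * G (σ - 2 * Real.pi * t * Complex.I)))
        (𝓝[>] 0) (𝓝 (∫ t : ℝ, Complex.exp ((-2 * Real.pi * t * T : ℝ) * Complex.I) *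
            (k t * G (0 - 2 * Real.pi * t * Complex.I)))) := by
      have hcomp : IsCompact ((fun p : ℝ × ℝ => ((p.1 : ℂ) - 2 * Real.pi * p.2 * Complex.I)) ''
          (Icc (0:ℝ) 1 ×ˢ tsupport k)) := (isCompact_Icc.prod hks).image (by fun_prop)
      obtain ⟨C, hC⟩ := hcomp.exists_bound_of_continuousOn (f := G) (hG.mono (by
        rintro _ ⟨p, hp, rfl⟩
        simp only [mem_ofPred_eq, hmap]
        exact hp.1.1))
      have hGc : ∀ σ : ℝ, 0 ≤ σ → Continuous (fun t : ℝ => G (σ - 2 * Real.pi * t * Complex.I)) := by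
        intro σ hσ
        exact hG.comp_continuous (by fun_prop) (fun t => by simp [hmap, hσ])
      refine tendsto_integral_filter_of_dominated_convergence (fun t => ‖k t‖ * C) ?_ ?_
        (hki.norm.mul_const C) ?_
      · filter_upwards [self_mem_nhdsWithin] with σ hσ
        have := hGc σ (le_of_lt hσ)
        refine (Continuous.mul (by fun_prop) (hk.mul this)).aestronglyMeasurable
      · have : Ioo (0:ℝ) 1 ∈ 𝓝[>] (0:ℝ) := Ioo_mem_nhdsGT one_pos
        filter_upwards [this] with σ hσ
        filter_upwards with t
        rw [norm_mul, Complex.norm_exp_ofReal_mul_I, one_mul, norm_mul]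
        by_cases ht : t ∈ tsupport k
        · gcongr
          exact hC _ ⟨(σ, t), ⟨⟨hσ.1.le, hσ.2.le⟩, ht⟩, rfl⟩
        · rw [image_eq_zero_of_notMem_tsupport ht]; simp
      · filter_upwards with t
        refine Tendsto.const_mul _ (Tendsto.const_mul _ ?_)
        have h1 : ContinuousWithinAt G {z | 0 ≤ z.re} (0 - 2 * Real.pi * t * Complex.I) :=
          hG _ (by simp)
        refine h1.tendsto.comp (tendsto_nhdsWithin_iff.2 ⟨?_, ?_⟩)
        · have : Tendsto (fun σ : ℝ => ((σ : ℂ) - 2 * Real.pi * t * Complex.I)) (𝓝 0)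
              (𝓝 (((0:ℝ) : ℂ) - 2 * Real.pi * t * Complex.I)) := by
            apply Continuous.tendsto (f := fun σ : ℝ => ((σ : ℂ) - 2 * Real.pi * t * Complex.I))
            fun_prop
          simpa using this.mono_left nhdsWithin_le_nhds
        · filter_upwards [self_mem_nhdsWithin] with σ hσ
          rw [hmap]
          exact le_of_lt hσ
    refine tendsto_nhds_unique hL (hRr.congr' ?_)
    filter_upwards [self_mem_nhdsWithin] with σ hσ
    rw [integral_mul_exp_mul_fourier hB hc h0 hk hki hσ T]
    congr 1; ext t
    rw [hRG _ (by rw [hmap]; exact hσ)]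
  simp_rw [key]
  exact (Real.zero_at_infty_fourier _).mono_left atTop_le_cocompact

theorem exists_fourier_kernel : ∃ k : ℝ → ℂ, Continuous k ∧ HasCompactSupport k ∧
    Integrable (𝓕 k) ∧ ∫ v, 𝓕 k v = 1 := by
  let b : ContDiffBump (0 : ℝ) := ⟨1, 2, one_pos, one_lt_two⟩
  have hbs : HasCompactSupport (fun t : ℝ => ((b t : ℝ) : ℂ)) :=
    b.hasCompactSupport.comp_left (g := fun x : ℝ => (x : ℂ)) Complex.ofReal_zero
  have hbd : ContDiff ℝ (↑(⊤ : ℕ∞)) (fun t : ℝ => ((b t : ℝ) : ℂ)) :=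
    Complex.ofRealCLM.contDiff.comp b.contDiff
  have hint : Integrable (𝓕 (fun t : ℝ => ((b t : ℝ) : ℂ))) := by
    have := (𝓕 (hbs.toSchwartzMap hbd)).integrable (μ := volume)
    rwa [SchwartzMap.fourier_coe] at this
  refine ⟨_, hbd.continuous, hbs, hint, ?_⟩
  have h := Continuous.fourierInv_fourier_eq hbd.continuous
    (hbd.continuous.integrable_of_hasCompactSupport hbs) hint
  have h1 := congrFun h 0
  rw [Real.fourierInv_eq'] at h1
  have hb1 : b 0 = 1 := b.one_of_mem_closedBall (by simp [b])
  simpa [hb1] using h1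

/-- A bounded Lipschitz function on the half line whose Laplace transform extends continuously to
the closed half plane tends to zero. -/
theorem tendsto_zero_of_laplace {R : ℝ → ℂ} {B : ℝ} {L : ℝ} (hB : ∀ u, ‖R u‖ ≤ B)
    (hL : ∀ u v, ‖R u - R v‖ ≤ L * |u - v|) (h0 : ∀ u ≤ 0, R u = 0) {G : ℂ → ℂ}
    (hG : ContinuousOn G {z | 0 ≤ z.re})
    (hRG : ∀ z : ℂ, 0 < z.re → ∫ u : ℝ, R u * Complex.exp (-u * z) = G z) :
    Tendsto R atTop (𝓝 0) := by
  have hL0 : 0 ≤ L := by simpa using (norm_nonneg _).trans (hL 1 0)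
  have hB0 : 0 ≤ B := (norm_nonneg _).trans (hB 0)
  have hc : Continuous R := by
    refine (LipschitzWith.of_dist_le_mul (K := ⟨L, hL0⟩) fun u v => ?_).continuous
    rw [dist_eq_norm, Real.dist_eq]
    exact hL u v
  obtain ⟨k, hk, hks, hφ, hφ1⟩ := exists_fourier_kernel
  have hmain : Tendsto (fun n : ℕ => ∫ v, min (2 * B) (L * |v| / (n + 1)) * ‖𝓕 k v‖) atTop
      (𝓝 0) := by
    have : (0:ℝ) = ∫ v : ℝ, (0:ℝ) * ‖𝓕 k v‖ := by simp
    rw [this]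
    refine tendsto_integral_of_dominated_convergence (fun v => 2 * B * ‖𝓕 k v‖) ?_
      (hφ.norm.const_mul _) ?_ ?_
    · intro n
      exact AEStronglyMeasurable.mul (by fun_prop) hφ.norm.aestronglyMeasurable
    · intro n
      filter_upwards with v
      rw [norm_mul, norm_norm]
      gcongr
      rw [Real.norm_of_nonneg (by positivity)]
      exact min_le_left _ _
    · filter_upwards with v
      refine Tendsto.mul_const _ ?_
      have h1 : Tendsto (fun n : ℕ => L * |v| / ((n : ℝ) + 1)) atTop (𝓝 0) :=
        tendsto_const_nhds.div_atTop (tendsto_natCast_atTop_atTop.atTop_add tendsto_const_nhds)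
      have := (tendsto_const_nhds (x := 2 * B)).min h1
      rwa [min_eq_right (by positivity)] at this
  rw [Metric.tendsto_nhds]
  intro ε hε
  obtain ⟨n, hn⟩ := ((tendsto_order.1 hmain).2 (ε / 2) (by positivity)).exists
  have hn1 : (0:ℝ) < n + 1 := by positivity
  set S : ℝ → ℂ := fun u => R (u / (n + 1)) with hS
  have hSB : ∀ u, ‖S u‖ ≤ B := fun u => hB _
  have hSc : Continuous S := by fun_prop
  have hS0 : ∀ u ≤ 0, S u = 0 := fun u hu => h0 _ (div_nonpos_of_nonpos_of_nonneg hu hn1.le)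
  have hlim := tendsto_integral_mul_fourier hSB hSc hS0
    (G := fun z => ((n:ℂ) + 1) * G ((n + 1) * z)) (by
      refine continuousOn_const.mul (hG.comp (by fun_prop) fun z hz => ?_)
      have : (((n:ℂ) + 1) * z).re = (n + 1) * z.re := by
        simp
      simp only [mem_ofPred_eq, this]
      exact mul_nonneg hn1.le hz) (by
      intro z hz
      have hre : (((n:ℂ) + 1) * z).re = (n + 1) * z.re := by
        simp
      rw [← hRG _ (by rw [hre]; positivity)]
      have := Measure.integral_comp_div (fun u : ℝ => R u * Complex.exp (-u * ((n + 1) * z)))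
        ((n:ℝ) + 1)
      rw [abs_of_pos hn1] at this
      have h2 : (((n:ℝ) + 1 : ℝ) • ∫ y : ℝ, R y * Complex.exp (-y * ((n + 1) * z))) =
          ((n:ℂ) + 1) * ∫ y : ℝ, R y * Complex.exp (-y * ((n + 1) * z)) := by
        rw [Complex.real_smul]; push_cast; ring
      rw [← h2, ← this]
      congr 1; ext u
      simp only [hS]
      congr 2
      have : ((n:ℂ) + 1) ≠ 0 := by exact_mod_cast hn1.ne'
      push_cast
      field_simp) hk hks hφ
  have hlim2 := hlim.comp (tendsto_id.const_mul_atTop hn1)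
  rw [Metric.tendsto_nhds] at hlim2
  filter_upwards [hlim2 (ε / 2) (by positivity)] with T hT
  rw [dist_zero_right] at hT ⊢
  simp only [Function.comp, id] at hT
  have hshift : ∫ u, S u * 𝓕 k ((n + 1) * T - u) = ∫ v, S ((n + 1) * T - v) * 𝓕 k v := by
    rw [← integral_sub_left_eq_self _ _ ((n + 1) * T)]
    simp
  have hi2 : Integrable (fun v => S ((n + 1) * T - v) * 𝓕 k v) := by
    refine hφ.bdd_mul (c := B) (by fun_prop) ?_
    filter_upwards with v using hSB _
  have hRT : R T - ∫ u, S u * 𝓕 k ((n + 1) * T - u) =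
      ∫ v, (R T - S ((n + 1) * T - v)) * 𝓕 k v := by
    rw [hshift]
    simp_rw [sub_mul]
    rw [integral_sub (hφ.const_mul _) hi2, integral_const_mul, hφ1, mul_one]
  have hbound : ‖∫ v, (R T - S ((n + 1) * T - v)) * 𝓕 k v‖ ≤
      ∫ v, min (2 * B) (L * |v| / (n + 1)) * ‖𝓕 k v‖ := by
    refine norm_integral_le_of_norm_le ?_ ?_
    · refine hφ.norm.bdd_mul (c := 2 * B) (by fun_prop) ?_
      filter_upwards with v
      rw [Real.norm_of_nonneg (by positivity)]
      exact min_le_left _ _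
    · filter_upwards with v
      rw [norm_mul]
      gcongr
      refine le_min ?_ ?_
      · calc _ ≤ ‖R T‖ + ‖S ((n + 1) * T - v)‖ := norm_sub_le _ _
          _ ≤ _ := by linarith [hB T, hSB ((n + 1) * T - v)]
      · refine (hL _ _).trans_eq ?_
        have : T - ((n + 1) * T - v) / (n + 1) = v / (n + 1) := by field_simp; ring
        rw [this, abs_div, abs_of_pos hn1, mul_div_assoc]
  calc ‖R T‖ = ‖(R T - ∫ u, S u * 𝓕 k ((n + 1) * T - u)) +
        ∫ u, S u * 𝓕 k ((n + 1) * T - u)‖ := by ring_nf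
    _ ≤ _ := norm_add_le _ _
    _ < ε := by rw [hRT]; linarith

end TwinSieve

namespace TwinSieve

open MeasureTheory Filter Topology Set
open Real (posLog)

section Decoupling

theorem integral_indicator_one_div {x a b : ℝ} (hx : 1 ≤ x) (ha : 1 ≤ a) (hb : 1 ≤ b) :
    IntervalIntegrable (fun t : ℝ => if a ≤ x / t ∧ b ≤ t then t⁻¹ else 0) volume 1 x ∧
    ∫ t in (1:ℝ)..x, (if a ≤ x / t ∧ b ≤ t then t⁻¹ else 0) = posLog (x / (a * b)) := by
  have ha0 : 0 < a := by linarith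
  have hb0 : 0 < b := by linarith
  have hset : EqOn (fun t : ℝ => if a ≤ x / t ∧ b ≤ t then t⁻¹ else 0)
      ((Icc b (x / a)).indicator fun t => t⁻¹) (Ioc 1 x) := by
    intro t ht
    have ht0 : 0 < t := by linarith [ht.1]
    have hiff : (a ≤ x / t ∧ b ≤ t) ↔ t ∈ Icc b (x / a) := by
      rw [mem_Icc, le_div_iff₀ ht0, le_div_iff₀ ha0, mul_comm a t, and_comm]
    simp only [indicator]
    congr 1
    exact propext hiff
  have hii : IntegrableOn (fun t : ℝ => t⁻¹) (Ioc 1 x) := by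
    have : IntervalIntegrable (fun t : ℝ => t⁻¹) volume 1 x :=
      intervalIntegral.intervalIntegrable_inv (f := id) (fun t ht => by
        rw [uIcc_of_le hx] at ht
        have := ht.1
        simp only [id]
        linarith) continuousOn_id
    rwa [intervalIntegrable_iff_integrableOn_Ioc_of_le hx] at this
  constructor
  · rw [intervalIntegrable_iff_integrableOn_Ioc_of_le hx]
    exact (hii.indicator measurableSet_Icc).congr_fun hset.symm measurableSet_Ioc
  · rw [intervalIntegral.integral_of_le hx, setIntegral_congr_fun measurableSet_Ioc hset,
      setIntegral_indicator measurableSet_Icc]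
    rcases le_or_gt b (x / a) with h | h
    · have : (Ioc 1 x ∩ Icc b (x / a) : Set ℝ) =ᵐ[volume] Ioc b (x / a) := by
        have h1 : (Ioc 1 x ∩ Ioc b (x / a) : Set ℝ) = Ioc b (x / a) := by
          apply inter_eq_right.2
          apply Ioc_subset_Ioc hb
          exact div_le_self (by linarith) ha
        have h2 : (Ioc 1 x ∩ Icc b (x / a) : Set ℝ) =ᵐ[volume] (Ioc 1 x ∩ Ioc b (x / a) : Set ℝ) :=
          (ae_eq_refl _).inter Ioc_ae_eq_Icc.symm
        rwa [h1] at h2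
      rw [setIntegral_congr_set this, ← intervalIntegral.integral_of_le h,
        integral_inv_of_pos hb0 (by positivity), div_div, Real.posLog_eq_log]
      rw [abs_of_nonneg (by positivity), one_le_div (by positivity)]
      rwa [le_div_iff₀ ha0, mul_comm] at h
    · rw [Icc_eq_empty (not_le.2 h), inter_empty]
      simp only [Measure.restrict_empty, integral_zero_measure]
      symm
      rw [Real.posLog_eq_zero_iff, abs_of_nonneg (by positivity), div_le_one (by positivity)]
      rw [div_lt_iff₀ ha0, mul_comm] at h
      exact h.le

theorem sum_mul_posLog_eq_integral {ι κ : Type*} (s : Finset ι) (r : Finset κ) (f : ι → ℂ)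
    (g : κ → ℂ) (A : ι → ℝ) (B : κ → ℝ) (hA : ∀ i ∈ s, 1 ≤ A i) (hB : ∀ j ∈ r, 1 ≤ B j)
    {x : ℝ} (hx : 1 ≤ x) :
    IntervalIntegrable (fun t : ℝ => (∑ i ∈ s with A i ≤ x / t, f i) *
        (∑ j ∈ r with B j ≤ t, g j) * ((t⁻¹ : ℝ) : ℂ)) volume 1 x ∧
    ∑ i ∈ s, ∑ j ∈ r, f i * g j * (posLog (x / (A i * B j)) : ℂ) =
      ∫ t in (1:ℝ)..x, (∑ i ∈ s with A i ≤ x / t, f i) *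
        (∑ j ∈ r with B j ≤ t, g j) * ((t⁻¹ : ℝ) : ℂ) := by
  have key : ∀ t : ℝ, (∑ i ∈ s with A i ≤ x / t, f i) *
        (∑ j ∈ r with B j ≤ t, g j) * ((t⁻¹ : ℝ) : ℂ) =
      ∑ i ∈ s, ∑ j ∈ r, f i * g j *
        ((if A i ≤ x / t ∧ B j ≤ t then t⁻¹ else 0 : ℝ) : ℂ) := by
    intro t
    rw [Finset.sum_filter, Finset.sum_filter, Finset.sum_mul_sum, Finset.sum_mul]
    refine Finset.sum_congr rfl fun i _ => ?_
    rw [Finset.sum_mul]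
    refine Finset.sum_congr rfl fun j _ => ?_
    by_cases h1 : A i ≤ x / t <;> by_cases h2 : B j ≤ t <;> simp [h1, h2]
  have hint : ∀ i ∈ s, ∀ j ∈ r, IntervalIntegrable (fun t : ℝ => f i * g j *
        ((if A i ≤ x / t ∧ B j ≤ t then t⁻¹ else 0 : ℝ) : ℂ)) volume 1 x := by
    intro i hi j hj
    have := (integral_indicator_one_div hx (hA i hi) (hB j hj)).1
    exact IntervalIntegrable.const_mul ⟨this.1.ofReal, this.2.ofReal⟩ _
  simp_rw [key]
  constructor
  · have := IntervalIntegrable.sum s (f := fun i t => ∑ j ∈ r, f i * g j *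
        ((if A i ≤ x / t ∧ B j ≤ t then t⁻¹ else 0 : ℝ) : ℂ)) (μ := volume) (a := 1) (b := x) (by
      intro i hi
      have := IntervalIntegrable.sum r (hint i hi)
      rwa [Finset.sum_fn] at this)
    rwa [Finset.sum_fn] at this
  · rw [intervalIntegral.integral_finsetSum]
    · refine Finset.sum_congr rfl fun i hi => ?_
      rw [intervalIntegral.integral_finsetSum (hint i hi)]
      refine Finset.sum_congr rfl fun j hj => ?_
      rw [intervalIntegral.integral_const_mul, intervalIntegral.integral_ofReal,
        (integral_indicator_one_div hx (hA i hi) (hB j hj)).2]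
    · intro i hi
      have := IntervalIntegrable.sum r (hint i hi)
      rwa [Finset.sum_fn] at this

theorem sum_posLog_eq_integral {ι : Type*} (s : Finset ι) (f : ι → ℂ)
    (A : ι → ℝ) (hA : ∀ i ∈ s, 1 ≤ A i) {x : ℝ} (hx : 1 ≤ x) :
    IntervalIntegrable (fun t : ℝ => (∑ i ∈ s with A i ≤ t, f i) * ((t⁻¹ : ℝ) : ℂ))
      volume 1 x ∧
    ∑ i ∈ s, f i * (posLog (x / A i) : ℂ) =
      ∫ t in (1:ℝ)..x, (∑ i ∈ s with A i ≤ t, f i) * ((t⁻¹ : ℝ) : ℂ) := by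
  have h := sum_mul_posLog_eq_integral (Finset.univ : Finset Unit) s (fun _ => 1) f
    (fun _ => 1) A (fun _ _ => le_rfl) hA hx
  have e : EqOn (fun t : ℝ => (∑ i ∈ (Finset.univ : Finset Unit) with (1:ℝ) ≤ x / t, (1:ℂ)) *
        (∑ j ∈ s with A j ≤ t, f j) * ((t⁻¹ : ℝ) : ℂ))
      (fun t : ℝ => (∑ i ∈ s with A i ≤ t, f i) * ((t⁻¹ : ℝ) : ℂ)) (Ioc 1 x) := by
    intro t ht
    have ht0 : 0 < t := by linarith [ht.1]
    have : (1:ℝ) ≤ x / t := by rw [le_div_iff₀ ht0, one_mul]; exact ht.2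
    simp [this]
  refine ⟨?_, ?_⟩
  · have h1 := h.1
    rw [intervalIntegrable_iff_integrableOn_Ioc_of_le hx] at h1 ⊢
    exact h1.congr_fun e measurableSet_Ioc
  · have h2 := h.2
    rw [intervalIntegral.integral_of_le hx, setIntegral_congr_fun measurableSet_Ioc e,
      ← intervalIntegral.integral_of_le hx] at h2
    simpa using h2

end Decoupling

end TwinSieve

namespace TwinSieve

open MeasureTheory Filter Topology Set
open Real (posLog)

/-- The Riesz mean `∑_{n ≤ x} c(n) log (x / n)`. -/
noncomputable def rieszSum (c : ℕ → ℂ) (x : ℝ) : ℂ :=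
  ∑ n ∈ Finset.Ioc 0 ⌊x⌋₊, c n * (posLog (x / n) : ℂ)

theorem posLog_div_eq_zero {x : ℝ} (hx : 0 ≤ x) {n : ℕ} (h : x ≤ n) : posLog (x / n) = 0 := by
  rw [Real.posLog_eq_zero_iff, abs_of_nonneg (by positivity)]
  exact div_le_one_of_le₀ h (by positivity)

theorem rieszSum_eq_sum (c : ℕ → ℂ) {x : ℝ} (hx : 0 ≤ x) {N : ℕ} (hN : ⌊x⌋₊ ≤ N) :
    rieszSum c x = ∑ n ∈ Finset.Ioc 0 N, c n * (posLog (x / n) : ℂ) := by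
  apply Finset.sum_subset (Finset.Ioc_subset_Ioc_right hN)
  intro n hn hn'
  have : x < n := by
    rw [Finset.mem_Ioc] at hn hn'
    by_contra h
    exact hn' ⟨hn.1, Nat.le_floor (not_lt.1 h)⟩
  rw [posLog_div_eq_zero hx this.le]
  simp

theorem rieszSum_of_le_one (c : ℕ → ℂ) {x : ℝ} (hx : 0 ≤ x) (h1 : x ≤ 1) : rieszSum c x = 0 := by
  refine Finset.sum_eq_zero fun n hn => ?_
  have : (1:ℝ) ≤ n := by exact_mod_cast (Finset.mem_Ioc.1 hn).1
  rw [posLog_div_eq_zero hx (h1.trans this)]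
  simp

theorem filter_Ioc_le_eq {N : ℕ} {t : ℝ} (ht : 0 ≤ t) (hN : ⌊t⌋₊ ≤ N) :
    (Finset.Ioc 0 N).filter (fun n : ℕ => (n : ℝ) ≤ t) = Finset.Ioc 0 ⌊t⌋₊ := by
  ext n
  simp only [Finset.mem_filter, Finset.mem_Ioc]
  rw [Nat.le_floor_iff ht]
  refine ⟨fun h => ⟨h.1.1, h.2⟩, fun h => ⟨⟨h.1, ?_⟩, h.2⟩⟩
  exact (Nat.le_floor h.2).trans hN

theorem norm_sum_Ioc_floor_le {c : ℕ → ℂ} {K : ℝ}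
    (hK : ∀ N : ℕ, ∑ n ∈ Finset.Ioc 0 N, ‖c n‖ ≤ K * N) (hK0 : 0 ≤ K) {t : ℝ} (ht : 0 ≤ t) :
    ‖∑ n ∈ Finset.Ioc 0 ⌊t⌋₊, c n‖ ≤ K * t := by
  refine (norm_sum_le _ _).trans ((hK _).trans ?_)
  gcongr
  exact Nat.floor_le ht

theorem rieszSum_sub_le {c : ℕ → ℂ} {K : ℝ}
    (hK : ∀ N : ℕ, ∑ n ∈ Finset.Ioc 0 N, ‖c n‖ ≤ K * N) {x y : ℝ} (hy : 0 ≤ y) (hxy : y ≤ x) :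
    ‖rieszSum c x - rieszSum c y‖ ≤ K * (x - y) := by
  have hK0 : 0 ≤ K := by
    simpa using (Finset.sum_nonneg fun n _ => norm_nonneg (c n)).trans (hK 1)
  have main : ∀ y x : ℝ, 1 ≤ y → y ≤ x → ‖rieszSum c x - rieszSum c y‖ ≤ K * (x - y) := by
    intro y x hy hxy
    have hA : ∀ i ∈ Finset.Ioc 0 ⌊x⌋₊, (1:ℝ) ≤ (i:ℝ) := by
      intro i hi; exact_mod_cast (Finset.mem_Ioc.1 hi).1
    have hx := sum_posLog_eq_integral (Finset.Ioc 0 ⌊x⌋₊) c (fun n => (n:ℝ)) hA (hy.trans hxy)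
    have hy' := sum_posLog_eq_integral (Finset.Ioc 0 ⌊x⌋₊) c (fun n => (n:ℝ)) hA hy
    rw [rieszSum_eq_sum c (by linarith) (le_refl ⌊x⌋₊),
      rieszSum_eq_sum c (x := y) (by linarith) (Nat.floor_le_floor hxy), hx.2, hy'.2,
      intervalIntegral.integral_interval_sub_left hx.1 hy'.1, ← abs_of_nonneg (sub_nonneg.2 hxy)]
    apply intervalIntegral.norm_integral_le_of_norm_le_const
    intro t ht
    rw [uIoc_of_le hxy] at ht
    have ht0 : 0 < t := by linarith [ht.1]
    rw [filter_Ioc_le_eq ht0.le (Nat.floor_le_floor ht.2), norm_mul, Complex.norm_real,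
      Real.norm_of_nonneg (by positivity)]
    calc _ ≤ K * t * t⁻¹ := by
          gcongr
          exact norm_sum_Ioc_floor_le hK hK0 ht0.le
      _ = K := by field_simp
  rcases le_total 1 y with h | h
  · exact main y x h hxy
  rcases le_total x 1 with h' | h'
  · rw [rieszSum_of_le_one c hy h, rieszSum_of_le_one c (hy.trans hxy) h', sub_zero, norm_zero]
    exact mul_nonneg hK0 (sub_nonneg.2 hxy)
  · rw [rieszSum_of_le_one c hy h, ← rieszSum_of_le_one c zero_le_one le_rfl]
    refine (main 1 x le_rfl h').trans ?_
    gcongr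

theorem rieszSum_norm_le {c : ℕ → ℂ} {K : ℝ}
    (hK : ∀ N : ℕ, ∑ n ∈ Finset.Ioc 0 N, ‖c n‖ ≤ K * N) {x : ℝ} (hx : 0 ≤ x) :
    ‖rieszSum c x‖ ≤ K * x := by
  have := rieszSum_sub_le hK le_rfl hx
  rwa [rieszSum_of_le_one c le_rfl zero_le_one, sub_zero, sub_zero] at this

theorem integral_max_mul_exp {s : ℂ} (hs : 0 < s.re) :
    Integrable (fun u : ℝ => ((max u 0 : ℝ) : ℂ) * Complex.exp (-(s * u))) ∧
    ∫ u : ℝ, ((max u 0 : ℝ) : ℂ) * Complex.exp (-(s * u)) = 1 / s ^ 2 := by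
  have hs0 : s ≠ 0 := by rintro rfl; simp at hs
  have hint : IntegrableOn (fun u : ℝ => (u : ℂ) * Complex.exp (-(s * u))) (Ioi 0) := by
    have := integrableOn_rpow_mul_exp_neg_mul_rpow (p := 1) (s := 1) (b := s.re) (by norm_num)
      one_pos hs
    refine Integrable.mono' this (by fun_prop) ?_
    filter_upwards [ae_restrict_mem measurableSet_Ioi] with u hu
    have hu0 : (0:ℝ) < u := hu
    rw [norm_mul, Complex.norm_exp, Complex.norm_real, Real.norm_of_nonneg hu0.le]
    simp
  have hz : ∀ u ∉ Ioi (0:ℝ), ((max u 0 : ℝ) : ℂ) * Complex.exp (-(s * u)) = 0 := by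
    intro u hu
    rw [max_eq_right (not_lt.1 hu)]; simp
  have he : EqOn (fun u : ℝ => ((max u 0 : ℝ) : ℂ) * Complex.exp (-(s * u)))
      (fun u : ℝ => (u : ℂ) * Complex.exp (-(s * u))) (Ioi 0) := by
    intro u hu
    have hu0 : (0:ℝ) < u := hu
    simp [max_eq_left hu0.le]
  constructor
  · rw [← integrableOn_iff_integrable_of_support_subset (s := Ioi (0:ℝ))]
    · exact hint.congr_fun he.symm measurableSet_Ioi
    · intro u hu
      by_contra h
      exact hu (hz u h)
  · rw [← setIntegral_eq_integral_of_forall_compl_eq_zero hz,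
      setIntegral_congr_fun measurableSet_Ioi he]
    have hd : ∀ u ∈ Ici (0:ℝ), HasDerivAt
        (fun u : ℝ => -(u / s + 1 / s ^ 2) * Complex.exp (-(s * u)))
        ((u : ℂ) * Complex.exp (-(s * u))) u := by
      intro u _
      have h1 : HasDerivAt (fun u : ℝ => (u : ℂ)) 1 u := Complex.ofRealCLM.hasDerivAt
      have h2 := (((h1.div_const s).add_const (1 / s ^ 2)).neg).mul ((h1.const_mul s).neg.cexp)
      refine HasDerivAt.congr_deriv (f := fun u : ℝ =>
        -(u / s + 1 / s ^ 2) * Complex.exp (-(s * u))) h2 ?_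
      change -(1 / s) * Complex.exp (-(s * u)) +
        -(u / s + 1 / s ^ 2) * (Complex.exp (-(s * u)) * -(s * 1)) = _
      field_simp
      ring
    have ht : Tendsto (fun u : ℝ => -(u / s + 1 / s ^ 2) * Complex.exp (-(s * u))) atTop
        (𝓝 0) := by
      rw [tendsto_zero_iff_norm_tendsto_zero]
      have h3 : Tendsto (fun u : ℝ => u ^ 1 * Real.exp (-s.re * u)) atTop (𝓝 0) := by
        have := Real.tendsto_pow_mul_exp_neg_atTop_nhds_zero 1
        have h4 := (this.comp (tendsto_id.const_mul_atTop hs)).const_mul (1 / s.re)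
        rw [mul_zero] at h4
        refine h4.congr fun u => ?_
        simp only [Function.comp, id]
        field_simp
      have h5 : Tendsto (fun u : ℝ => Real.exp (-s.re * u)) atTop (𝓝 0) := by
        refine Real.tendsto_exp_atBot.comp ?_
        exact tendsto_id.const_mul_atTop_of_neg (by linarith)
      have h6 := (h3.const_mul (1 / ‖s‖)).add (h5.const_mul (‖1 / s ^ 2‖))
      rw [mul_zero, mul_zero, add_zero] at h6
      refine squeeze_zero' (Eventually.of_forall fun _ => norm_nonneg _) ?_ h6
      filter_upwards [eventually_ge_atTop 0] with u hu
      rw [norm_mul, norm_neg, Complex.norm_exp]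
      have : (-(s * u)).re = -s.re * u := by simp
      rw [this, ← mul_assoc, ← add_mul]
      gcongr
      refine (norm_add_le _ _).trans_eq ?_
      rw [norm_div, Complex.norm_real, Real.norm_of_nonneg hu, pow_one]
      ring
    have := integral_Ioi_of_hasDerivAt_of_tendsto' hd hint ht
    rw [this]
    simp

theorem integral_max_sub_mul_exp {s : ℂ} (hs : 0 < s.re) (l : ℝ) :
    Integrable (fun u : ℝ => ((max (u - l) 0 : ℝ) : ℂ) * Complex.exp (-(s * u))) ∧
    ∫ u : ℝ, ((max (u - l) 0 : ℝ) : ℂ) * Complex.exp (-(s * u)) =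
      Complex.exp (-(s * l)) / s ^ 2 := by
  obtain ⟨h1, h2⟩ := integral_max_mul_exp hs
  have e : (fun u : ℝ => ((max (u - l) 0 : ℝ) : ℂ) * Complex.exp (-(s * u))) =
      fun u : ℝ => Complex.exp (-(s * l)) *
        (((max (u - l) 0 : ℝ) : ℂ) * Complex.exp (-(s * ((u - l : ℝ) : ℂ)))) := by
    ext u
    rw [mul_left_comm, ← Complex.exp_add]
    congr 2
    push_cast
    ring
  rw [e]
  refine ⟨(h1.comp_sub_right l).const_mul _, ?_⟩
  rw [integral_const_mul,
    integral_sub_right_eq_self (fun u : ℝ => ((max u 0 : ℝ) : ℂ) * Complex.exp (-(s * u))) l, h2]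
  ring

end TwinSieve

namespace TwinSieve

open MeasureTheory Filter Topology Set
open Real (posLog)

theorem exp_neg_mul_rieszSum_eq_tsum (c : ℕ → ℂ) (hc : c 0 = 0) (u : ℝ) :
    ((Real.exp (-u) : ℝ) : ℂ) * rieszSum c (Real.exp u) =
      ∑' n : ℕ, c n * (((max (u - Real.log n) 0 : ℝ) : ℂ) * Complex.exp (-u)) := by
  rw [tsum_eq_sum (s := Finset.Ioc 0 ⌊Real.exp u⌋₊)]
  · rw [rieszSum, Finset.mul_sum]
    refine Finset.sum_congr rfl fun n hn => ?_
    have hn0 : (0:ℝ) < n := by exact_mod_cast (Finset.mem_Ioc.1 hn).1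
    have : posLog (Real.exp u / n) = max (u - Real.log n) 0 := by
      change max 0 (Real.log (Real.exp u / n)) = _
      rw [Real.log_div (Real.exp_pos u).ne' hn0.ne', Real.log_exp, max_comm]
    rw [this]
    push_cast
    ring
  · intro n hn
    rcases Nat.eq_zero_or_pos n with rfl | h
    · simp [hc]
    · have : Real.exp u < n := by
        by_contra h'
        exact hn (Finset.mem_Ioc.2 ⟨h, Nat.le_floor (not_lt.1 h')⟩)
      have h2 : u < Real.log n := (Real.lt_log_iff_exp_lt (by exact_mod_cast h)).2 this
      rw [max_eq_right (by linarith)]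
      simp

theorem integral_rieszSum_mul_exp {c : ℕ → ℂ} (hc : c 0 = 0) {K : ℝ}
    (hK : ∀ N : ℕ, ∑ n ∈ Finset.Ioc 0 N, ‖c n‖ ≤ K * N) {z : ℂ} (hz : 0 < z.re) :
    ∫ u : ℝ, ((Real.exp (-u) : ℝ) : ℂ) * rieszSum c (Real.exp u) * Complex.exp (-u * z) =
      LSeries c (1 + z) / (1 + z) ^ 2 := by
  have hK0 : 0 ≤ K := by
    simpa using (Finset.sum_nonneg fun n _ => norm_nonneg (c n)).trans (hK 1)
  have hs : 0 < (1 + z).re := by simp; linarith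
  have hs' : (0:ℝ) < 1 + z.re := by linarith
  have hterm : ∀ (n : ℕ) (s : ℂ), s ≠ 0 →
      c n * Complex.exp (-(s * (Real.log n : ℝ))) = LSeries.term c s n := by
    intro n s hs
    rw [LSeries.term_def]
    split_ifs with h
    · simp [h, hc]
    · rw [Complex.cpow_def_of_ne_zero (by exact_mod_cast h), div_eq_mul_inv, ← Complex.exp_neg,
        ← Complex.ofReal_natCast, ← Complex.ofReal_log (by positivity), mul_comm s]
  set F : ℕ → ℝ → ℂ := fun n u =>
    c n * (((max (u - Real.log n) 0 : ℝ) : ℂ) * Complex.exp (-((1 + z) * u))) with hF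
  have hFi : ∀ n, Integrable (F n) := fun n =>
    (integral_max_sub_mul_exp hs (Real.log n)).1.const_mul _
  have hFn : ∀ n, ∫ u, ‖F n u‖ = ‖LSeries.term c ((1 + z.re : ℝ) : ℂ) n‖ / (1 + z.re) ^ 2 := by
    intro n
    have h1 := (integral_max_sub_mul_exp (s := ((1 + z.re : ℝ) : ℂ)) (by simpa using hs')
      (Real.log n)).2
    have h2 : ∀ u : ℝ, ((max (u - Real.log n) 0 : ℝ) : ℂ) *
        Complex.exp (-(((1 + z.re : ℝ) : ℂ) * u)) =
        ((max (u - Real.log n) 0 * Real.exp (-((1 + z.re) * u)) : ℝ) : ℂ) := by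
      intro u; push_cast; rfl
    simp_rw [h2] at h1
    rw [integral_complex_ofReal] at h1
    have h3 : Complex.exp (-(((1 + z.re : ℝ) : ℂ) * (Real.log n : ℝ))) / ((1 + z.re : ℝ) : ℂ) ^ 2 =
        ((Real.exp (-((1 + z.re) * Real.log n)) / (1 + z.re) ^ 2 : ℝ) : ℂ) := by
      push_cast; rfl
    rw [h3] at h1
    have h4 := Complex.ofReal_injective h1
    have h5 : ∀ u, ‖F n u‖ = ‖c n‖ * (max (u - Real.log n) 0 * Real.exp (-((1 + z.re) * u))) := by
      intro u
      rw [hF]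
      simp only [norm_mul, Complex.norm_real, Complex.norm_exp]
      rw [Real.norm_of_nonneg (le_max_right _ _)]
      simp
    simp_rw [h5]
    rw [integral_const_mul, h4, ← hterm n _ (by exact_mod_cast hs'.ne'), norm_mul,
      Complex.norm_exp, mul_div_assoc]
    congr 3
    rw [Complex.neg_re, Complex.re_ofReal_mul, Complex.ofReal_re]
  have hsum : LSeriesSummable c ((1 + z.re : ℝ) : ℂ) := by
    refine LSeriesSummable_of_sum_norm_bigO (r := 1) ?_ zero_le_one (by simpa using hz)
    refine Asymptotics.IsBigO.of_bound K (Eventually.of_forall fun N => ?_)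
    rw [Real.rpow_one, Real.norm_of_nonneg (Finset.sum_nonneg fun _ _ => norm_nonneg _),
      Real.norm_of_nonneg (by positivity)]
    exact hK N
  have hsumm : Summable fun n => ∫ u, ‖F n u‖ := by
    simp_rw [hFn]
    exact (hsum.norm).div_const _
  have := (hasSum_integral_of_summable_integral_norm hFi hsumm).tsum_eq
  calc _ = ∫ u : ℝ, ∑' n, F n u := by
        congr 1; ext u
        rw [exp_neg_mul_rieszSum_eq_tsum c hc, ← tsum_mul_right]
        congr 1; ext n
        rw [hF]
        simp only
        rw [mul_assoc, mul_assoc, ← Complex.exp_add]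
        congr 3
        ring_nf
    _ = ∑' n, ∫ u, F n u := this.symm
    _ = ∑' n, LSeries.term c (1 + z) n / (1 + z) ^ 2 := by
        congr 1; ext n
        rw [hF]
        simp only
        rw [integral_const_mul, (integral_max_sub_mul_exp hs (Real.log n)).2, ← mul_div_assoc,
          hterm n _ (by rintro h; rw [h] at hs; simp at hs)]
    _ = _ := by rw [tsum_div_const]; rfl

/-- If the Dirichlet series of `c` (with linearly bounded absolute partial sums) extends
continuously to `1 ≤ re s`, then the Riesz mean of `c` is `o(x)`. -/
theorem tendsto_rieszSum_div {c : ℕ → ℂ} (hc : c 0 = 0) {K : ℝ}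
    (hK : ∀ N : ℕ, ∑ n ∈ Finset.Ioc 0 N, ‖c n‖ ≤ K * N) {H : ℂ → ℂ}
    (hH : ContinuousOn H {s | 1 ≤ s.re}) (hHc : ∀ s : ℂ, 1 < s.re → LSeries c s = H s) :
    Tendsto (fun x : ℝ => ‖rieszSum c x‖ / x) atTop (𝓝 0) := by
  have hK0 : 0 ≤ K := by
    simpa using (Finset.sum_nonneg fun n _ => norm_nonneg (c n)).trans (hK 1)
  set R : ℝ → ℂ := fun u => ((Real.exp (-u) : ℝ) : ℂ) * rieszSum c (Real.exp u) with hR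
  have hRn : ∀ u, ‖R u‖ ≤ K := by
    intro u
    rw [hR]
    simp only [norm_mul, Complex.norm_real]
    rw [Real.norm_of_nonneg (Real.exp_pos _).le]
    calc _ ≤ Real.exp (-u) * (K * Real.exp u) := by
          gcongr; exact rieszSum_norm_le hK (Real.exp_pos _).le
      _ = K := by rw [mul_left_comm, ← Real.exp_add]; simp
  have hRL' : ∀ u v, v ≤ u → ‖R u - R v‖ ≤ 2 * K * |u - v| := by
    intro u v huv
    have e : R u - R v = ((Real.exp (-u) : ℝ) : ℂ) *
        (rieszSum c (Real.exp u) - rieszSum c (Real.exp v)) -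
        ((Real.exp (-v) - Real.exp (-u) : ℝ) : ℂ) * rieszSum c (Real.exp v) := by
      simp only [hR]; push_cast; ring
    have h1 : Real.exp v ≤ Real.exp u := Real.exp_le_exp.2 huv
    have h2 : Real.exp (-u) ≤ Real.exp (-v) := Real.exp_le_exp.2 (by linarith)
    have h3 : 1 - Real.exp (v - u) ≤ u - v := by
      have := Real.add_one_le_exp (v - u); linarith
    rw [e, abs_of_nonneg (sub_nonneg.2 huv)]
    refine (norm_sub_le _ _).trans ?_
    rw [norm_mul, norm_mul, Complex.norm_real, Complex.norm_real,
      Real.norm_of_nonneg (Real.exp_pos _).le, Real.norm_of_nonneg (sub_nonneg.2 h2)]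
    calc _ ≤ Real.exp (-u) * (K * (Real.exp u - Real.exp v)) +
          (Real.exp (-v) - Real.exp (-u)) * (K * Real.exp v) := by
          gcongr
          · exact rieszSum_sub_le hK (Real.exp_pos _).le h1
          · exact rieszSum_norm_le hK (Real.exp_pos _).le
      _ = 2 * K * (1 - Real.exp (v - u)) := by
          have a1 : Real.exp (-u) * Real.exp u = 1 := by rw [← Real.exp_add]; simp
          have a2 : Real.exp (-v) * Real.exp v = 1 := by rw [← Real.exp_add]; simp
          have a3 : Real.exp (v - u) = Real.exp (-u) * Real.exp v := by
            rw [← Real.exp_add]; ring_nf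
          rw [a3]
          linear_combination K * a1 + K * a2
      _ ≤ _ := by gcongr
  have hRL : ∀ u v, ‖R u - R v‖ ≤ 2 * K * |u - v| := by
    intro u v
    rcases le_total v u with h | h
    · exact hRL' u v h
    · rw [norm_sub_rev, abs_sub_comm]; exact hRL' v u h
  have hR0 : ∀ u ≤ 0, R u = 0 := by
    intro u hu
    simp only [hR]
    rw [rieszSum_of_le_one c (Real.exp_pos u).le (Real.exp_le_one_iff.2 hu), mul_zero]
  have hlim := tendsto_zero_of_laplace hRn hRL hR0 (G := fun z => H (1 + z) / (1 + z) ^ 2) (by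
      refine ContinuousOn.div (hH.comp (by fun_prop) fun z hz => ?_) (by fun_prop) fun z hz => ?_
      · have : 0 ≤ z.re := hz
        change 1 ≤ (1 + z).re
        simpa using this
      · have h0 : 0 ≤ z.re := hz
        apply pow_ne_zero
        intro h
        have : (1 + z).re = 0 := by rw [h]; simp
        simp at this
        linarith) (by
      intro z hz
      simp only [hR]
      rw [integral_rieszSum_mul_exp hc hK hz, hHc]
      simpa using hz)
  have h2 := (hlim.comp Real.tendsto_log_atTop).norm
  rw [norm_zero] at h2
  refine h2.congr' ?_
  filter_upwards [eventually_gt_atTop 0] with x hx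
  simp only [Function.comp, hR]
  rw [norm_mul, Complex.norm_real, Real.norm_of_nonneg (Real.exp_pos _).le, Real.exp_neg,
    Real.exp_log hx]
  ring

end TwinSieve

namespace TwinSieve

open MeasureTheory Filter Topology Set
open Real (posLog)
open ArithmeticFunction (vonMangoldt)

theorem sum_vonMangoldt_le (N : ℕ) :
    ∑ n ∈ Finset.Ioc 0 N, vonMangoldt n ≤ 6 * N := by
  have h := Chebyshev.psi_le_const_mul_self (x := N) (by positivity)
  rw [Chebyshev.psi, Nat.floor_natCast] at h
  refine h.trans ?_
  have : Real.log 4 ≤ 2 := by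
    rw [show (4:ℝ) = 2 ^ 2 by norm_num, Real.log_pow]
    have := Real.log_two_lt_d9
    norm_num at *
    linarith
  gcongr
  linarith

theorem sum_norm_vonMangoldt_mul_char_le {q : ℕ} (χ : DirichletCharacter ℂ q) (N : ℕ) :
    ∑ n ∈ Finset.Ioc 0 N, ‖(vonMangoldt n : ℂ) * χ n‖ ≤ 6 * N := by
  refine (Finset.sum_le_sum fun n _ => ?_).trans (sum_vonMangoldt_le N)
  rw [norm_mul, Complex.norm_real, Real.norm_of_nonneg ArithmeticFunction.vonMangoldt_nonneg]
  exact mul_le_of_le_one_right ArithmeticFunction.vonMangoldt_nonneg (χ.norm_le_one _)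

theorem tendsto_rieszSum_vonMangoldt_char {q : ℕ} [NeZero q] {χ : DirichletCharacter ℂ q}
    (hχ : χ ≠ 1) :
    Tendsto (fun x : ℝ => ‖rieszSum (fun n => (vonMangoldt n : ℂ) * χ n) x‖ / x) atTop (𝓝 0) := by
  refine tendsto_rieszSum_div (by simp) (sum_norm_vonMangoldt_mul_char_le χ)
    (H := fun s => -deriv (DirichletCharacter.LFunction χ) s / DirichletCharacter.LFunction χ s)
    ?_ ?_
  · exact (DirichletCharacter.continuousOn_neg_logDeriv_LFunction_of_nontriv hχ).mono
      fun s hs => DirichletCharacter.LFunction_ne_zero_of_one_le_re χ (.inl hχ) hs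
  · intro s hs
    rw [DirichletCharacter.deriv_LFunction_eq_deriv_LSeries χ hs,
      DirichletCharacter.LFunction_eq_LSeries χ hs,
      ← DirichletCharacter.LSeries_twist_vonMangoldt_eq χ hs]
    congr 1
    ext n
    simp [mul_comm]

theorem tendsto_rieszSum_vonMangoldt_sub_one :
    Tendsto (fun x : ℝ => ‖rieszSum (fun n => if n = 0 then 0 else (vonMangoldt n : ℂ) - 1) x‖ / x)
      atTop (𝓝 0) := by
  set Z : ℂ → ℂ := Function.update (fun s => riemannZeta s - 1 / (s - 1)) 1
    Real.eulerMascheroniConstant with hZ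
  have hZc : Continuous Z := by
    rw [continuous_iff_continuousAt]
    intro s
    rcases eq_or_ne s 1 with rfl | hs
    · exact continuousAt_update_same.2 tendsto_riemannZeta_sub_one_div
    · rw [hZ, continuousAt_update_of_ne hs]
      refine ((differentiableAt_riemannZeta hs).continuousAt).sub ?_
      exact continuousAt_const.div (by fun_prop) (sub_ne_zero.2 hs)
  refine tendsto_rieszSum_div (by simp) (K := 7) ?_
    (H := fun s => ArithmeticFunction.vonMangoldt.LFunctionResidueClassAux (1 : ZMod 1) s - Z s)
    ?_ ?_
  · intro N
    calc _ ≤ ∑ n ∈ Finset.Ioc 0 N, (vonMangoldt n + 1) := by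
          refine Finset.sum_le_sum fun n hn => ?_
          rw [if_neg (Finset.mem_Ioc.1 hn).1.ne']
          refine (norm_sub_le _ _).trans ?_
          rw [Complex.norm_real, Real.norm_of_nonneg ArithmeticFunction.vonMangoldt_nonneg,
            norm_one]
      _ ≤ _ := by
          rw [Finset.sum_add_distrib]
          simp only [Finset.sum_const, Nat.card_Ioc, nsmul_eq_mul]
          have := sum_vonMangoldt_le N
          simp
          linarith
  · exact (ArithmeticFunction.vonMangoldt.continuousOn_LFunctionResidueClassAux (1 : ZMod 1)).sub
      hZc.continuousOn
  · intro s hs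
    have hs1 : s ≠ 1 := by rintro rfl; simp at hs
    have h1 := ArithmeticFunction.vonMangoldt.eqOn_LFunctionResidueClassAux
      (a := (1 : ZMod 1)) isUnit_one hs
    have hfun : (fun n : ℕ => ((ArithmeticFunction.vonMangoldt.residueClass (1 : ZMod 1) n : ℝ) : ℂ))
        = fun n => (vonMangoldt n : ℂ) := by
      ext n
      rw [ArithmeticFunction.vonMangoldt.residueClass, Set.indicator_of_mem]
      exact Subsingleton.elim _ _
    simp only [hfun] at h1
    rw [h1]
    have h2 : LSeriesSummable (fun n => (vonMangoldt n : ℂ)) s :=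
      ArithmeticFunction.LSeriesSummable_vonMangoldt hs
    have h3 : LSeriesSummable (1 : ℕ → ℂ) s := LSeriesSummable_one_iff.2 hs
    have h4 : LSeries (fun n => if n = 0 then 0 else (vonMangoldt n : ℂ) - 1) s =
        LSeries ((fun n => (vonMangoldt n : ℂ)) - (1 : ℕ → ℂ)) s := by
      refine LSeries_congr (fun {n} hn => ?_) s
      simp [hn]
    rw [h4, LSeries_sub h2 h3, LSeries_one_eq_riemannZeta hs, hZ, Function.update_of_ne hs1]
    simp

theorem norm_rieszSum_one_sub_le {x : ℝ} (hx : 1 ≤ x) :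
    ‖rieszSum (fun _ => 1) x - ((x - 1 : ℝ) : ℂ)‖ ≤ Real.log x := by
  have hA : ∀ i ∈ Finset.Ioc 0 ⌊x⌋₊, (1:ℝ) ≤ (i:ℝ) := by
    intro i hi; exact_mod_cast (Finset.mem_Ioc.1 hi).1
  have h := sum_posLog_eq_integral (Finset.Ioc 0 ⌊x⌋₊) (fun _ => 1) (fun n => (n:ℝ)) hA hx
  rw [rieszSum, h.2]
  have h1 : ((x - 1 : ℝ) : ℂ) = ∫ t in (1:ℝ)..x, (1:ℂ) := by simp
  rw [h1, ← intervalIntegral.integral_sub h.1 intervalIntegrable_const]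
  have h2 : Real.log x = ∫ t in (1:ℝ)..x, t⁻¹ := by
    rw [integral_inv_of_pos one_pos (by linarith), div_one]
  rw [h2]
  refine intervalIntegral.norm_integral_le_of_norm_le hx ?_ ?_
  · refine Eventually.of_forall fun t ht => ?_
    have ht0 : 0 < t := by linarith [ht.1]
    rw [filter_Ioc_le_eq ht0.le (Nat.floor_le_floor ht.2)]
    simp only [Finset.sum_const, Nat.card_Ioc, nsmul_eq_mul, mul_one, tsub_zero]
    have e : (⌊t⌋₊ : ℂ) * ((t⁻¹ : ℝ) : ℂ) - 1 = (((⌊t⌋₊ - t) * t⁻¹ : ℝ) : ℂ) := by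
      push_cast
      have : (t : ℂ) ≠ 0 := by exact_mod_cast ht0.ne'
      field_simp
    rw [e, Complex.norm_real, norm_mul, Real.norm_of_nonneg (inv_nonneg.2 ht0.le)]
    apply mul_le_of_le_one_left (inv_nonneg.2 ht0.le)
    rw [Real.norm_eq_abs, abs_le]
    have := Nat.floor_le ht0.le
    have := Nat.lt_floor_add_one t
    constructor <;> linarith
  · exact intervalIntegral.intervalIntegrable_inv (f := id) (fun t ht => by
        rw [uIcc_of_le hx] at ht
        have := ht.1
        simp only [id]
        linarith) continuousOn_id

/-- The prime number theorem, in Riesz mean form. -/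
theorem tendsto_rieszSum_vonMangoldt :
    Tendsto (fun x : ℝ => ‖rieszSum (fun n => (vonMangoldt n : ℂ)) x - (x : ℂ)‖ / x)
      atTop (𝓝 0) := by
  have h1 : Tendsto (fun x : ℝ => (Real.log x + 1) / x) atTop (𝓝 0) := by
    have a := Real.tendsto_pow_log_div_mul_add_atTop 1 0 1 one_ne_zero
    have b : Tendsto (fun x : ℝ => 1 / x) atTop (𝓝 0) := by
      simpa using tendsto_inv_atTop_zero (𝕜 := ℝ)
    have := a.add b
    rw [add_zero] at this
    refine this.congr fun x => ?_
    simp only [pow_one, one_mul, add_zero]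
    ring
  have h2 := tendsto_rieszSum_vonMangoldt_sub_one.add h1
  rw [add_zero] at h2
  refine squeeze_zero' ?_ ?_ h2
  · filter_upwards [eventually_ge_atTop 0] with x hx
    positivity
  · filter_upwards [eventually_ge_atTop 1] with x hx
    have e : rieszSum (fun n => (vonMangoldt n : ℂ)) x =
        rieszSum (fun n => if n = 0 then 0 else (vonMangoldt n : ℂ) - 1) x +
          rieszSum (fun _ => 1) x := by
      simp only [rieszSum]
      rw [← Finset.sum_add_distrib]
      refine Finset.sum_congr rfl fun n hn => ?_
      rw [if_neg (Finset.mem_Ioc.1 hn).1.ne']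
      ring
    rw [← add_div]
    gcongr
    calc _ = ‖rieszSum (fun n => if n = 0 then 0 else (vonMangoldt n : ℂ) - 1) x +
          (rieszSum (fun _ => 1) x - ((x - 1 : ℝ) : ℂ)) - 1‖ := by
          rw [e]; push_cast; ring_nf
      _ ≤ ‖rieszSum (fun n => if n = 0 then 0 else (vonMangoldt n : ℂ) - 1) x‖ +
          ‖rieszSum (fun _ => 1) x - ((x - 1 : ℝ) : ℂ)‖ + ‖(1:ℂ)‖ :=
          (norm_sub_le _ _).trans (by gcongr; exact norm_add_le _ _)
      _ ≤ _ := by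
          have := norm_rieszSum_one_sub_le hx
          rw [norm_one]
          linarith

end TwinSieve

namespace TwinSieve

open Finset
open scoped ComplexConjugate

section Duality

variable {ι κ : Type*}

theorem sum_norm_sq_le_of_dual (s : Finset ι) (r : Finset κ) (c : ι → κ → ℂ) {Δ : ℝ} (hΔ : 0 ≤ Δ)
    (h : ∀ z : ι → ℂ, ∑ n ∈ r, ‖∑ i ∈ s, z i * c i n‖ ^ 2 ≤ Δ * ∑ i ∈ s, ‖z i‖ ^ 2)
    (b : κ → ℂ) :
    ∑ i ∈ s, ‖∑ n ∈ r, b n * c i n‖ ^ 2 ≤ Δ * ∑ n ∈ r, ‖b n‖ ^ 2 := by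
  set S : ι → ℂ := fun i => ∑ n ∈ r, b n * c i n with hS
  set X := ∑ i ∈ s, ‖S i‖ ^ 2 with hX
  have hX0 : 0 ≤ X := by positivity
  have h1 : (X : ℂ) = ∑ n ∈ r, b n * ∑ i ∈ s, conj (S i) * c i n := by
    rw [hX]
    push_cast
    calc ∑ i ∈ s, (‖S i‖ : ℂ) ^ 2 = ∑ i ∈ s, conj (S i) * ∑ n ∈ r, b n * c i n := by
          refine Finset.sum_congr rfl fun i _ => ?_
          rw [← Complex.conj_mul']
      _ = _ := by
          simp_rw [Finset.mul_sum]
          rw [Finset.sum_comm]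
          refine Finset.sum_congr rfl fun n _ => Finset.sum_congr rfl fun i _ => by ring
  have h2 : X ≤ ∑ n ∈ r, ‖b n‖ * ‖∑ i ∈ s, conj (S i) * c i n‖ := by
    calc X = ‖(X : ℂ)‖ := by rw [Complex.norm_real, Real.norm_of_nonneg hX0]
      _ ≤ _ := by
          rw [h1]
          refine (norm_sum_le _ _).trans_eq ?_
          simp_rw [norm_mul]
  have h3 := Finset.sum_mul_sq_le_sq_mul_sq r (fun n => ‖b n‖)
    (fun n => ‖∑ i ∈ s, conj (S i) * c i n‖)
  have h4 := h (fun i => conj (S i))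
  simp only [RCLike.norm_conj] at h4
  have h5 : X ^ 2 ≤ (∑ n ∈ r, ‖b n‖ ^ 2) * (Δ * X) :=
    (pow_le_pow_left₀ hX0 h2 2).trans (h3.trans (by gcongr))
  rcases hX0.eq_or_lt with h0 | h0
  · rw [← h0]; positivity
  · have : X * X ≤ (Δ * ∑ n ∈ r, ‖b n‖ ^ 2) * X := by linarith [sq X]
    exact le_of_mul_le_mul_right this h0

/-- Weighted norm bound from absolute row sums of the Gram matrix. -/
theorem sum_mul_norm_sq_le_of_row_sums (s : Finset ι) (r : Finset κ) (c : ι → κ → ℂ) (w : κ → ℝ)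
    {Δ : ℝ}
    (h : ∀ i ∈ s, ∑ j ∈ s, ‖∑ n ∈ r, (w n : ℂ) * (c i n * conj (c j n))‖ ≤ Δ) (z : ι → ℂ) :
    ∑ n ∈ r, w n * ‖∑ i ∈ s, z i * c i n‖ ^ 2 ≤ Δ * ∑ i ∈ s, ‖z i‖ ^ 2 := by
  set K : ι → ι → ℂ := fun i j => ∑ n ∈ r, (w n : ℂ) * (c i n * conj (c j n)) with hK
  have hsymm : ∀ i j, ‖K i j‖ = ‖K j i‖ := by
    intro i j
    have : K i j = conj (K j i) := by
      simp only [hK, map_sum, map_mul, Complex.conj_ofReal, Complex.conj_conj]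
      refine Finset.sum_congr rfl fun n _ => by ring
    rw [this, RCLike.norm_conj]
  have h1 : ((∑ n ∈ r, w n * ‖∑ i ∈ s, z i * c i n‖ ^ 2 : ℝ) : ℂ) =
      ∑ i ∈ s, ∑ j ∈ s, z i * conj (z j) * K i j := by
    push_cast
    calc _ = ∑ n ∈ r, (w n : ℂ) * ((∑ i ∈ s, z i * c i n) * conj (∑ j ∈ s, z j * c j n)) := by
          refine Finset.sum_congr rfl fun n _ => ?_
          rw [← Complex.mul_conj']
      _ = ∑ n ∈ r, ∑ i ∈ s, ∑ j ∈ s,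
            z i * conj (z j) * ((w n : ℂ) * (c i n * conj (c j n))) := by
          refine Finset.sum_congr rfl fun n _ => ?_
          rw [map_sum, Finset.sum_mul_sum, Finset.mul_sum]
          refine Finset.sum_congr rfl fun i _ => ?_
          rw [Finset.mul_sum]
          refine Finset.sum_congr rfl fun j _ => ?_
          rw [map_mul]; ring
      _ = _ := by
          rw [Finset.sum_comm]
          refine Finset.sum_congr rfl fun i _ => ?_
          rw [Finset.sum_comm]
          refine Finset.sum_congr rfl fun j _ => ?_
          rw [← Finset.mul_sum]
  have hrow : ∑ i ∈ s, ∑ j ∈ s, ‖z i‖ ^ 2 * ‖K i j‖ ≤ Δ * ∑ i ∈ s, ‖z i‖ ^ 2 := by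
    rw [Finset.mul_sum]
    refine Finset.sum_le_sum fun i hi => ?_
    rw [← Finset.mul_sum, mul_comm]
    gcongr
    exact h i hi
  have hcol : ∑ i ∈ s, ∑ j ∈ s, ‖z j‖ ^ 2 * ‖K i j‖ ≤ Δ * ∑ i ∈ s, ‖z i‖ ^ 2 := by
    rw [Finset.sum_comm]
    simp_rw [hsymm _ _]
    refine le_trans (le_of_eq ?_) hrow
    refine Finset.sum_congr rfl fun i _ => Finset.sum_congr rfl fun j _ => by rw [hsymm]
  calc _ ≤ ‖((∑ n ∈ r, w n * ‖∑ i ∈ s, z i * c i n‖ ^ 2 : ℝ) : ℂ)‖ := by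
        rw [Complex.norm_real]; exact le_abs_self _
    _ ≤ ∑ i ∈ s, ∑ j ∈ s, ‖z i‖ * ‖z j‖ * ‖K i j‖ := by
        rw [h1]
        refine (norm_sum_le _ _).trans (Finset.sum_le_sum fun i _ => ?_)
        refine (norm_sum_le _ _).trans (Finset.sum_le_sum fun j _ => ?_)
        rw [norm_mul, norm_mul, RCLike.norm_conj]
    _ ≤ ∑ i ∈ s, ∑ j ∈ s, (1 / 2 * (‖z i‖ ^ 2 * ‖K i j‖) + 1 / 2 * (‖z j‖ ^ 2 * ‖K i j‖)) := by
        refine Finset.sum_le_sum fun i _ => Finset.sum_le_sum fun j _ => ?_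
        have := two_mul_le_add_sq ‖z i‖ ‖z j‖
        nlinarith [norm_nonneg (K i j)]
    _ = 1 / 2 * (∑ i ∈ s, ∑ j ∈ s, ‖z i‖ ^ 2 * ‖K i j‖) +
          1 / 2 * ∑ i ∈ s, ∑ j ∈ s, ‖z j‖ ^ 2 * ‖K i j‖ := by
        simp_rw [Finset.sum_add_distrib, ← Finset.mul_sum]
    _ ≤ _ := by linarith

end Duality

section Additive

/-- `e(x) = exp(2πix)`. -/
noncomputable def expC (x : ℝ) : ℂ := Complex.exp ((2 * Real.pi * x : ℝ) * Complex.I)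

theorem norm_expC (x : ℝ) : ‖expC x‖ = 1 := Complex.norm_exp_ofReal_mul_I _

theorem expC_add (x y : ℝ) : expC (x + y) = expC x * expC y := by
  rw [expC, expC, expC, ← Complex.exp_add]
  congr 1
  push_cast
  ring

theorem conj_expC (x : ℝ) : conj (expC x) = expC (-x) := by
  rw [expC, expC, ← Complex.exp_conj, map_mul, Complex.conj_ofReal, Complex.conj_I]
  congr 1
  push_cast
  ring

theorem expC_intCast (k : ℤ) : expC k = 1 := by
  rw [expC, Complex.exp_eq_one_iff]
  exact ⟨k, by push_cast; ring⟩

theorem expC_natCast_mul (n : ℕ) (x : ℝ) : expC (n * x) = expC x ^ n := by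
  rw [expC, expC, ← Complex.exp_nat_mul]
  congr 1
  push_cast
  ring

theorem norm_one_sub_expC_ge (x : ℝ) : 4 * |x - round x| ≤ ‖1 - expC x‖ := by
  have h0 : expC x = expC (x - round x) := by
    have := expC_add (x - round x) (round x)
    rw [expC_intCast, mul_one] at this
    rw [← this]
    congr 1
    ring
  rw [h0]
  set y := x - round x with hy
  have hy2 : |y| ≤ 1 / 2 := abs_sub_round x
  have h1 : ‖1 - expC y‖ = 2 * |Real.sin (Real.pi * y)| := by
    have := Complex.norm_exp_I_mul_ofReal_sub_one (2 * Real.pi * y)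
    rw [norm_sub_rev, expC, mul_comm, this, norm_mul, Real.norm_eq_abs, Real.norm_eq_abs, abs_two]
    congr 3
    ring
  rw [h1]
  have h2 : |Real.sin (Real.pi * y)| = Real.sin (Real.pi * |y|) := by
    have h3 : 0 ≤ Real.sin (Real.pi * |y|) := by
      apply Real.sin_nonneg_of_nonneg_of_le_pi
      · positivity
      · nlinarith [Real.pi_pos]
    rcases le_total 0 y with h | h
    · rw [abs_of_nonneg h] at h3 ⊢
      exact abs_of_nonneg h3
    · rw [abs_of_nonpos h] at h3 ⊢
      rw [mul_neg, Real.sin_neg] at h3 ⊢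
      exact abs_of_nonpos (by linarith)
  rw [h2]
  have h4 := Real.mul_le_sin (x := Real.pi * |y|) (by positivity) (by nlinarith [Real.pi_pos])
  have h5 : 2 / Real.pi * (Real.pi * |y|) = 2 * |y| := by
    field_simp
  linarith

theorem norm_geom_expC_le (M : ℕ) {x : ℝ} (hx : 0 < |x - round x|) :
    ‖∑ m ∈ range M, expC (m * x)‖ ≤ 1 / (2 * |x - round x|) := by
  have h1 := norm_one_sub_expC_ge x
  have h2 : 0 < ‖1 - expC x‖ := by linarith
  have h3 : (∑ m ∈ range M, expC (m * x)) * (1 - expC x) = 1 - expC x ^ M := by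
    simp_rw [expC_natCast_mul]
    exact geom_sum_mul_neg _ _
  have h4 : ‖∑ m ∈ range M, expC (m * x)‖ * ‖1 - expC x‖ ≤ 2 := by
    rw [← norm_mul, h3]
    refine (norm_sub_le _ _).trans ?_
    rw [norm_pow, norm_expC, one_pow, norm_one]
    norm_num
  rw [le_div_iff₀ (by positivity)]
  nlinarith [norm_nonneg (∑ m ∈ range M, expC (m * x))]

theorem abs_sub_round_le_abs_sub_int (x : ℝ) (k : ℤ) : |x - round x| ≤ |x - k| :=
  round_le x k

/-- The constant `∑_{k ∈ ℤ, k ≠ 0} 1/k²`. -/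
noncomputable def intInvSq : ℝ := ∑' k : ℤ, 1 / (k : ℝ) ^ 2

theorem intInvSq_nonneg : 0 ≤ intInvSq := tsum_nonneg fun _ => by positivity

theorem sum_inv_sq_le {ι : Type*} (s : Finset ι) (v : ι → ℝ) {δ : ℝ} (hδ : 0 < δ)
    (hv : ∀ i ∈ s, δ ≤ |v i|) (hs : ∀ i ∈ s, ∀ j ∈ s, i ≠ j → δ ≤ |v i - v j|) :
    ∑ i ∈ s, 1 / (v i) ^ 2 ≤ 4 * intInvSq / δ ^ 2 := by
  have hle : ∀ i ∈ s, 1 / (v i) ^ 2 ≤ 4 / δ ^ 2 * (1 / ((⌊v i / δ⌋ : ℤ) : ℝ) ^ 2) := by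
    intro i hi
    have h1 := hv i hi
    have hk1 : ((⌊v i / δ⌋ : ℤ) : ℝ) * δ ≤ v i := by
      have := Int.floor_le (v i / δ)
      rwa [le_div_iff₀ hδ] at this
    have hk2 : v i < (((⌊v i / δ⌋ : ℤ) : ℝ) + 1) * δ := by
      have := Int.lt_floor_add_one (v i / δ)
      rwa [div_lt_iff₀ hδ] at this
    set k := ⌊v i / δ⌋ with hk
    have hk0 : (k : ℝ) ≠ 0 := by
      intro h0
      rw [h0] at hk1 hk2
      rcases abs_cases (v i) with h | h <;> nlinarith
    have hv0 : v i ≠ 0 := by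
      intro h0; rw [h0, abs_zero] at h1; linarith
    have h2 : |(k : ℝ)| * δ ≤ 2 * |v i| := by
      rcases le_or_gt 0 k with h | h
      · have h' : (0:ℝ) ≤ k := by exact_mod_cast h
        rw [abs_of_nonneg h']
        have := le_abs_self (v i)
        nlinarith [abs_nonneg (v i)]
      · have h' : (k:ℝ) ≤ -1 := by exact_mod_cast Int.le_sub_one_of_lt h
        rw [abs_of_nonpos (by linarith)]
        have := neg_le_abs (v i)
        nlinarith
    have h3 : ((k : ℝ)) ^ 2 * δ ^ 2 ≤ 4 * (v i) ^ 2 := by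
      have := pow_le_pow_left₀ (by positivity) h2 2
      rw [mul_pow, mul_pow, sq_abs, sq_abs] at this
      linarith
    rw [div_mul_div_comm, mul_one, div_le_div_iff₀ (by positivity) (by positivity)]
    linarith
  refine (Finset.sum_le_sum hle).trans ?_
  rw [← Finset.mul_sum]
  have hinj : Set.InjOn (fun i => ⌊v i / δ⌋) s := by
    intro i hi j hj hij
    by_contra hne
    have h1 := hs i hi j hj hne
    have h2 := Int.abs_sub_lt_one_of_floor_eq_floor hij
    rw [← sub_div, abs_div, abs_of_pos hδ, div_lt_one hδ] at h2
    linarith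
  have : ∑ i ∈ s, 1 / ((⌊v i / δ⌋ : ℤ) : ℝ) ^ 2 ≤ intInvSq := by
    rw [← Finset.sum_image (f := fun k : ℤ => 1 / (k : ℝ) ^ 2) (s := s)
      (g := fun i => ⌊v i / δ⌋) hinj]
    exact (Real.summable_one_div_int_pow.2 one_lt_two).sum_le_tsum _ fun _ _ => by positivity
  calc _ ≤ 4 / δ ^ 2 * intInvSq := by gcongr
    _ = _ := by ring

/-- The large sieve inequality for well spaced points. -/
theorem additive_large_sieve {ι : Type*} (s : Finset ι) (α : ι → ℝ) {δ : ℝ} (hδ : 0 < δ)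
    (hs : ∀ i ∈ s, ∀ j ∈ s, i ≠ j → δ ≤ |α i - α j - round (α i - α j)|)
    {N L : ℕ} (hNL : N ≤ L) (hL : 0 < L) (b : ℕ → ℂ) :
    ∑ i ∈ s, ‖∑ n ∈ range N, b n * expC (n * α i)‖ ^ 2 ≤
      (4 * L + intInvSq / (L * δ ^ 2)) * ∑ n ∈ range N, ‖b n‖ ^ 2 := by
  classical
  have hL' : (0:ℝ) < L := by exact_mod_cast hL
  have hI := intInvSq_nonneg
  refine sum_norm_sq_le_of_dual s (range N) (fun i n => expC (n * α i)) (by positivity) ?_ b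
  intro z
  have hrow := sum_mul_norm_sq_le_of_row_sums s (range (2 * L) ×ˢ range (2 * L))
    (fun i p => expC (((p.1 : ℝ) - p.2) * α i)) (fun _ => (1 / L : ℝ))
    (Δ := 4 * L + intInvSq / (L * δ ^ 2)) ?_ z
  · refine le_trans ?_ hrow
    have h1 : ∀ n ∈ range N, ‖∑ i ∈ s, z i * expC (n * α i)‖ ^ 2 =
        ∑ m ∈ range L, (1 / L : ℝ) *
          ‖∑ i ∈ s, z i * expC ((((m + n : ℕ) : ℝ) - m) * α i)‖ ^ 2 := by
      intro n _
      have : ∀ m : ℕ, ((m + n : ℕ) : ℝ) - m = n := by intro m; push_cast; ring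
      simp_rw [this]
      rw [Finset.sum_const, card_range, nsmul_eq_mul]
      field_simp
    rw [Finset.sum_congr rfl h1, ← Finset.sum_product']
    rw [← Finset.sum_image (s := range N ×ˢ range L)
      (g := fun p : ℕ × ℕ => ((p.2 + p.1, p.2) : ℕ × ℕ))
      (f := fun p : ℕ × ℕ => (1 / L : ℝ) * ‖∑ i ∈ s, z i * expC (((p.1 : ℝ) - p.2) * α i)‖ ^ 2)]
    · refine Finset.sum_le_sum_of_subset_of_nonneg ?_ fun _ _ _ => by positivity
      intro p hp
      simp only [mem_image, mem_product, mem_range] at hp ⊢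
      obtain ⟨a, ha, rfl⟩ := hp
      simp only
      omega
    · intro p _ p' _ h
      simp only [Prod.mk.injEq] at h
      ext <;> omega
  · intro i hi
    have hker : ∀ j, ∑ p ∈ range (2 * L) ×ˢ range (2 * L), (((1 / L : ℝ) : ℝ) : ℂ) *
        (expC (((p.1 : ℝ) - p.2) * α i) * conj (expC (((p.1 : ℝ) - p.2) * α j))) =
        ((1 / L : ℝ) : ℂ) * ((∑ m ∈ range (2 * L), expC (m * (α i - α j))) *
          conj (∑ m ∈ range (2 * L), expC (m * (α i - α j)))) := by
      intro j
      rw [map_sum, Finset.sum_mul_sum, ← Finset.mul_sum, ← Finset.sum_product']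
      congr 1
      refine Finset.sum_congr rfl fun p _ => ?_
      rw [conj_expC, conj_expC, ← expC_add, ← expC_add]
      congr 1
      ring
    have hkn : ∀ j, ‖∑ p ∈ range (2 * L) ×ˢ range (2 * L), (((1 / L : ℝ) : ℝ) : ℂ) *
        (expC (((p.1 : ℝ) - p.2) * α i) * conj (expC (((p.1 : ℝ) - p.2) * α j)))‖ =
        1 / L * ‖∑ m ∈ range (2 * L), expC (m * (α i - α j))‖ ^ 2 := by
      intro j
      rw [hker, norm_mul, norm_mul, RCLike.norm_conj, Complex.norm_real,
        Real.norm_of_nonneg (by positivity), sq]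
    simp_rw [hkn]
    rw [← Finset.add_sum_erase s _ hi]
    have hdiag : 1 / (L:ℝ) * ‖∑ m ∈ range (2 * L), expC (m * (α i - α i))‖ ^ 2 = 4 * L := by
      have : expC 0 = 1 := by simp [expC]
      simp only [sub_self, mul_zero, this, Finset.sum_const, card_range, nsmul_eq_mul, mul_one]
      rw [Complex.norm_natCast]
      push_cast
      field_simp
      ring
    rw [hdiag]
    gcongr
    have hoff : ∀ j ∈ s.erase i, 1 / (L:ℝ) * ‖∑ m ∈ range (2 * L), expC (m * (α i - α j))‖ ^ 2 ≤
        1 / (4 * L) * (1 / (α i - α j - round (α i - α j)) ^ 2) := by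
      intro j hj
      have hd := hs i hi j (Finset.mem_of_mem_erase hj) (Finset.ne_of_mem_erase hj).symm
      have hg := norm_geom_expC_le (2 * L) (x := α i - α j) (by linarith)
      have := pow_le_pow_left₀ (norm_nonneg _) hg 2
      calc _ ≤ 1 / (L:ℝ) * (1 / (2 * |α i - α j - round (α i - α j)|)) ^ 2 := by gcongr
        _ = _ := by
          rw [div_pow, mul_pow, sq_abs, one_pow, div_mul_div_comm, div_mul_div_comm]
          congr 1
          ring
    refine (Finset.sum_le_sum hoff).trans ?_
    rw [← Finset.mul_sum]
    have := sum_inv_sq_le (s.erase i) (fun j => α i - α j - round (α i - α j)) hδ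
      (fun j hj => hs i hi j (Finset.mem_of_mem_erase hj) (Finset.ne_of_mem_erase hj).symm) (by
        intro j hj k hk hjk
        have h1 := hs k (Finset.mem_of_mem_erase hk) j (Finset.mem_of_mem_erase hj) hjk.symm
        refine h1.trans ((abs_sub_round_le_abs_sub_int _
          (round (α i - α j) - round (α i - α k))).trans_eq ?_)
        congr 1
        push_cast
        ring)
    calc _ ≤ 1 / (4 * L) * (4 * intInvSq / δ ^ 2) := by gcongr
      _ = _ := by field_simp

end Additive
end TwinSieve

namespace TwinSieve
open Finset DirichletCharacter
open scoped ComplexConjugate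

theorem conj_char {q : ℕ} (χ : DirichletCharacter ℂ q) (a : ZMod q) : conj (χ a) = χ⁻¹ a :=
  MulChar.star_apply' χ a

theorem isPrimitive_inv {q : ℕ} {χ : DirichletCharacter ℂ q} (hχ : χ.IsPrimitive) :
    χ⁻¹.IsPrimitive := by
  rw [isPrimitive_def, conductor_inv]
  exact hχ

section Modulus
variable {q : ℕ} [NeZero q]

theorem char_mul_conj (χ : DirichletCharacter ℂ q) (a : ZMod q) :
    χ a * conj (χ a) = if IsUnit a then 1 else 0 := by
  split_ifs with h
  · obtain ⟨u, rfl⟩ := h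
    rw [Complex.mul_conj, Complex.normSq_eq_norm_sq, unit_norm_eq_one]
    simp
  · rw [MulChar.map_nonunit χ h, zero_mul]

theorem sum_char_mul_conj (a b : ZMod q) :
    ∑ χ : DirichletCharacter ℂ q, χ a * conj (χ b) =
      if IsUnit b ∧ a = b then (q.totient : ℂ) else 0 := by
  by_cases hb : IsUnit b
  · have h := sum_char_inv_mul_char_eq ℂ hb a
    simp only [hb, true_and, eq_comm (a := a)]
    rw [← h]
    refine Finset.sum_congr rfl fun χ _ => ?_
    obtain ⟨u, rfl⟩ := hb
    rw [conj_char, MulChar.inv_apply, Ring.inverse_unit, mul_comm, ZMod.inv_coe_unit]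
  · simp [hb, MulChar.map_nonunit _ hb]

/-- Parseval for the characters modulo `q`. -/
theorem sum_norm_sq_char_sum (S : ZMod q → ℂ) :
    ∑ χ : DirichletCharacter ℂ q, ‖∑ a, χ a * S a‖ ^ 2 =
      q.totient * ∑ a with IsUnit a, ‖S a‖ ^ 2 := by
  have h : ((∑ χ : DirichletCharacter ℂ q, ‖∑ a, χ a * S a‖ ^ 2 : ℝ) : ℂ) =
      ((q.totient * ∑ a with IsUnit a, ‖S a‖ ^ 2 : ℝ) : ℂ) := by
    push_cast
    simp_rw [← Complex.mul_conj', map_sum, Finset.sum_mul_sum, map_mul]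
    rw [Finset.sum_comm]
    simp_rw [Finset.sum_comm (s := univ (α := DirichletCharacter ℂ q))]
    have : ∀ a b : ZMod q, ∑ χ : DirichletCharacter ℂ q, χ a * S a * (conj (χ b) * conj (S b)) =
        S a * conj (S b) * if IsUnit b ∧ a = b then (q.totient : ℂ) else 0 := by
      intro a b
      rw [← sum_char_mul_conj, Finset.mul_sum]
      exact Finset.sum_congr rfl fun _ _ => by ring
    simp_rw [this]
    rw [Finset.sum_comm, Finset.sum_filter, Finset.mul_sum]
    refine Finset.sum_congr rfl fun b _ => ?_
    by_cases hb : IsUnit b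
    · simp [hb, mul_comm]
    · simp [hb]
  exact_mod_cast h

theorem norm_sq_gaussSum {χ : DirichletCharacter ℂ q} (hχ : χ.IsPrimitive) :
    ‖gaussSum χ ZMod.stdAddChar‖ ^ 2 = q := by
  classical
  have hmul : ∀ n : ZMod q, ∑ a, χ a * ZMod.stdAddChar (n * a) =
      χ⁻¹ n * gaussSum χ ZMod.stdAddChar := by
    intro n
    rw [← gaussSum_mulShift_of_isPrimitive _ hχ]
    simp [gaussSum, AddChar.mulShift_apply]
  have hu : ∑ n : ZMod q, ((if IsUnit n then 1 else 0 : ℂ)) = q.totient := by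
    rw [Finset.sum_boole, ← ZMod.card_units_eq_totient]
    congr 1
    have : (univ.filter fun a : ZMod q => IsUnit a) =
        (univ : Finset (ZMod q)ˣ).map ⟨Units.val, Units.val_injective⟩ := by
      ext a
      rw [mem_filter, Finset.mem_map]
      exact ⟨fun h => ⟨h.2.unit, mem_univ _, rfl⟩, fun ⟨u, _, hu⟩ => ⟨mem_univ _, u, hu⟩⟩
    rw [this, Finset.card_map, Finset.card_univ]
  have h1 : ∑ n : ZMod q, (∑ a, χ a * ZMod.stdAddChar (n * a)) *
      conj (∑ a, χ a * ZMod.stdAddChar (n * a)) =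
      q.totient * (gaussSum χ ZMod.stdAddChar * conj (gaussSum χ ZMod.stdAddChar)) := by
    simp_rw [hmul]
    rw [← hu, Finset.sum_mul]
    refine Finset.sum_congr rfl fun n _ => ?_
    rw [← char_mul_conj χ, map_mul, conj_char, conj_char, inv_inv]
    ring
  have h2 : ∑ n : ZMod q, (∑ a, χ a * ZMod.stdAddChar (n * a)) *
      conj (∑ a, χ a * ZMod.stdAddChar (n * a)) = q * q.totient := by
    simp_rw [map_sum, Finset.sum_mul_sum, map_mul, ← AddChar.map_neg_eq_conj]
    rw [Finset.sum_comm]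
    refine (Finset.sum_congr rfl fun a _ => Finset.sum_comm).trans ?_
    have : ∀ a b : ZMod q, ∑ n : ZMod q, χ a * ZMod.stdAddChar (n * a) *
        (conj (χ b) * ZMod.stdAddChar (-(n * b))) = χ a * conj (χ b) * if a = b then (q:ℂ) else 0 := by
      intro a b
      have h3 := AddChar.sum_mulShift (a - b) (ZMod.isPrimitive_stdAddChar q)
      have h4 : ((if a - b = 0 then Fintype.card (ZMod q) else 0 : ℕ) : ℂ) =
        if a = b then (q:ℂ) else 0 := by
        simp only [ZMod.card, sub_eq_zero]
        split_ifs <;> simp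
      rw [← h4, ← h3, Finset.mul_sum]
      refine Finset.sum_congr rfl fun n _ => ?_
      rw [mul_sub, sub_eq_add_neg, AddChar.map_add_eq_mul]
      ring
    rw [Finset.sum_congr rfl fun a _ => Finset.sum_congr rfl fun b _ => this a b]
    simp_rw [mul_ite, mul_zero, Finset.sum_ite_eq, Finset.mem_univ, if_true, char_mul_conj]
    rw [← Finset.sum_mul, hu, mul_comm]
  have h3 : (q.totient : ℂ) ≠ 0 := by
    have := Nat.totient_pos.2 (NeZero.pos q)
    exact_mod_cast this.ne'
  rw [h1, mul_comm (q:ℂ)] at h2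
  have h4 := mul_left_cancel₀ h3 h2
  rw [Complex.mul_conj'] at h4
  exact_mod_cast h4

open Classical in
theorem sum_primitive_norm_sq_le (r : Finset ℕ) (b : ℕ → ℂ) :
    ∑ χ : DirichletCharacter ℂ q with χ.IsPrimitive, ‖∑ n ∈ r, b n * χ n‖ ^ 2 ≤
      ∑ a : ZMod q with IsUnit a, ‖∑ n ∈ r, b n * ZMod.stdAddChar ((n : ZMod q) * a)‖ ^ 2 := by
  have hq : (0:ℝ) < q := by exact_mod_cast NeZero.pos q
  have key : ∀ χ : DirichletCharacter ℂ q, χ.IsPrimitive →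
      q * ‖∑ n ∈ r, b n * χ n‖ ^ 2 =
      ‖∑ a, χ⁻¹ a * ∑ n ∈ r, b n * ZMod.stdAddChar ((n : ZMod q) * a)‖ ^ 2 := by
    intro χ hχ
    rw [← norm_sq_gaussSum (isPrimitive_inv hχ), ← mul_pow, ← norm_mul]
    congr 2
    simp_rw [Finset.mul_sum]
    rw [Finset.sum_comm]
    refine Finset.sum_congr rfl fun n _ => ?_
    have := gaussSum_mulShift_of_isPrimitive (ZMod.stdAddChar (N := q)) (isPrimitive_inv hχ) n
    rw [inv_inv] at this
    rw [mul_left_comm, mul_comm (gaussSum _ _), ← this, gaussSum, Finset.mul_sum]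
    refine Finset.sum_congr rfl fun a _ => ?_
    rw [AddChar.mulShift_apply]
    ring
  have h1 : q * ∑ χ : DirichletCharacter ℂ q with χ.IsPrimitive, ‖∑ n ∈ r, b n * χ n‖ ^ 2 ≤
      q * ∑ a : ZMod q with IsUnit a, ‖∑ n ∈ r, b n * ZMod.stdAddChar ((n : ZMod q) * a)‖ ^ 2 := by
    rw [Finset.mul_sum, Finset.sum_congr rfl fun χ hχ => key χ (mem_filter.1 hχ).2]
    calc _ ≤ ∑ χ : DirichletCharacter ℂ q,
          ‖∑ a, χ⁻¹ a * ∑ n ∈ r, b n * ZMod.stdAddChar ((n : ZMod q) * a)‖ ^ 2 :=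
          Finset.sum_le_sum_of_subset_of_nonneg (filter_subset _ _) fun _ _ _ => by positivity
      _ = ∑ χ : DirichletCharacter ℂ q,
          ‖∑ a, χ a * ∑ n ∈ r, b n * ZMod.stdAddChar ((n : ZMod q) * a)‖ ^ 2 :=
          Fintype.sum_equiv (Equiv.inv _) _ _ fun _ => rfl
      _ = _ := sum_norm_sq_char_sum _
      _ ≤ _ := by
        gcongr
        exact Nat.totient_le q
  exact le_of_mul_le_mul_left h1 hq

end Modulus

/-- Dirichlet characters of all positive moduli. -/
abbrev CharIdx : Type := Σ q : ℕ, DirichletCharacter ℂ (q + 1)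

open Classical in
/-- Primitive characters of modulus at most `D`. -/
noncomputable def primChars (D : ℕ) : Finset CharIdx :=
  (Finset.range D).sigma fun q => univ.filter fun χ : DirichletCharacter ℂ (q + 1) => χ.IsPrimitive

theorem stdAddChar_natCast_mul {q : ℕ} [NeZero q] (n : ℕ) (a : ZMod q) :
    ZMod.stdAddChar ((n : ZMod q) * a) = expC (n * (a.val / q : ℝ)) := by
  have := ZMod.stdAddChar_coe (N := q) ((n * a.val : ℕ) : ℤ)
  rw [Int.cast_natCast, Nat.cast_mul, ZMod.natCast_zmod_val] at this
  rw [this, expC]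
  congr 1
  push_cast
  ring

theorem farey_spacing {D : ℕ} {q q' : ℕ} (hq : q < D) (hq' : q' < D)
    {a : ZMod (q + 1)} {a' : ZMod (q' + 1)} (ha : IsUnit a) (ha' : IsUnit a')
    (hne : (⟨q, a⟩ : Σ q : ℕ, ZMod (q + 1)) ≠ ⟨q', a'⟩) (k : ℤ) :
    1 / (D:ℝ) ^ 2 ≤ |(a.val / (q + 1 : ℕ) : ℝ) - a'.val / (q' + 1 : ℕ) - k| := by
  have hc : Nat.Coprime a.val (q + 1) := by
    rw [← ZMod.isUnit_iff_coprime, ZMod.natCast_zmod_val]; exact ha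
  have hc' : Nat.Coprime a'.val (q' + 1) := by
    rw [← ZMod.isUnit_iff_coprime, ZMod.natCast_zmod_val]; exact ha'
  have hnum : (a.val * (q' + 1 : ℕ) - a'.val * (q + 1 : ℕ) - k * (q + 1 : ℕ) * (q' + 1 : ℕ) : ℤ) ≠ 0 := by
    intro h0
    have d1 : ((q + 1 : ℕ) : ℤ) ∣ ((q' + 1 : ℕ) : ℤ) := by
      have : ((q + 1 : ℕ) : ℤ) ∣ a.val * (q' + 1 : ℕ) :=
        ⟨a'.val + k * (q' + 1 : ℕ), by linarith⟩
      exact (Nat.isCoprime_iff_coprime.2 hc.symm).dvd_of_dvd_mul_left this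
    have d2 : ((q' + 1 : ℕ) : ℤ) ∣ ((q + 1 : ℕ) : ℤ) := by
      have : ((q' + 1 : ℕ) : ℤ) ∣ a'.val * (q + 1 : ℕ) :=
        ⟨a.val - k * (q + 1 : ℕ), by linarith⟩
      exact (Nat.isCoprime_iff_coprime.2 hc'.symm).dvd_of_dvd_mul_left this
    have hqq : q = q' := by
      have := Nat.dvd_antisymm (Int.natCast_dvd_natCast.1 d1) (Int.natCast_dvd_natCast.1 d2)
      omega
    subst hqq
    have h1 : (((q + 1 : ℕ) : ℤ)) * (a.val - a'.val - k * (q + 1 : ℕ)) = 0 := by linarith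
    have h2 : ((a.val : ℤ) - a'.val - k * (q + 1 : ℕ)) = 0 := by
      rcases mul_eq_zero.1 h1 with h | h
      · exfalso; omega
      · exact h
    have h3 : ((q + 1 : ℕ) : ℤ) ∣ (a.val : ℤ) - a'.val := ⟨k, by linarith⟩
    have h4 : a = a' := by
      have h5 := (ZMod.intCast_eq_intCast_iff_dvd_sub (a'.val : ℤ) (a.val : ℤ) (q + 1)).2 h3
      simp only [Int.cast_natCast, ZMod.natCast_zmod_val] at h5
      exact h5.symm
    exact hne (by rw [h4])
  have hq0 : (0:ℝ) < (q + 1 : ℕ) := by positivity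
  have hq0' : (0:ℝ) < (q' + 1 : ℕ) := by positivity
  have heq : (a.val / (q + 1 : ℕ) : ℝ) - a'.val / (q' + 1 : ℕ) - k =
      ((a.val * (q' + 1 : ℕ) - a'.val * (q + 1 : ℕ) - k * (q + 1 : ℕ) * (q' + 1 : ℕ) : ℤ) : ℝ) /
        ((q + 1 : ℕ) * (q' + 1 : ℕ)) := by
    push_cast
    field_simp
  rw [heq, abs_div, abs_of_pos (mul_pos hq0 hq0')]
  have h1 : (1:ℝ) ≤ |((a.val * (q' + 1 : ℕ) - a'.val * (q + 1 : ℕ) -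
      k * (q + 1 : ℕ) * (q' + 1 : ℕ) : ℤ) : ℝ)| := by
    exact_mod_cast Int.one_le_abs hnum
  have h2 : ((q + 1 : ℕ) * (q' + 1 : ℕ) : ℝ) ≤ (D:ℝ) ^ 2 := by
    rw [sq]
    gcongr <;> omega
  gcongr

/-- The multiplicative large sieve inequality. -/
theorem exists_large_sieve : ∃ C : ℝ, 0 < C ∧ ∀ (D N : ℕ) (b : ℕ → ℂ),
    ∑ χ ∈ primChars D, ‖∑ n ∈ Ioc 0 N, b n * χ.2 n‖ ^ 2 ≤
      C * (N + (D:ℝ) ^ 2) * ∑ n ∈ Ioc 0 N, ‖b n‖ ^ 2 := by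
  classical
  have hI := intInvSq_nonneg
  refine ⟨8 + intInvSq, by positivity, fun D N b => ?_⟩
  rcases Nat.eq_zero_or_pos D with rfl | hD
  · rw [primChars, Finset.sum_sigma, range_zero, sum_empty]
    positivity
  have hD' : (1:ℝ) ≤ D := by exact_mod_cast hD
  set b' : ℕ → ℂ := fun n => if n = 0 then 0 else b n with hb'
  have hr : ∀ g : ℕ → ℂ, ∑ n ∈ Ioc 0 N, b n * g n = ∑ n ∈ range (N + 1), b' n * g n := by
    intro g
    refine Finset.sum_subset_zero_on_sdiff ?_ ?_ ?_
    · intro n hn; simp only [mem_Ioc, mem_range] at hn ⊢; omega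
    · intro n hn
      simp only [mem_sdiff, mem_Ioc, mem_range] at hn
      have : n = 0 := by omega
      simp [hb', this]
    · intro n hn
      simp only [mem_Ioc] at hn
      simp [hb', hn.1.ne']
  have hr2 : ∑ n ∈ range (N + 1), ‖b' n‖ ^ 2 = ∑ n ∈ Ioc 0 N, ‖b n‖ ^ 2 := by
    symm
    refine Finset.sum_subset_zero_on_sdiff ?_ ?_ ?_
    · intro n hn; simp only [mem_Ioc, mem_range] at hn ⊢; omega
    · intro n hn
      simp only [mem_sdiff, mem_Ioc, mem_range] at hn
      have : n = 0 := by omega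
      simp [hb', this]
    · intro n hn
      simp only [mem_Ioc] at hn
      simp [hb', hn.1.ne']
  have h1 := additive_large_sieve
    ((Finset.range D).sigma fun q => univ.filter fun a : ZMod (q + 1) => IsUnit a)
    (fun p => (p.2.val / (p.1 + 1 : ℕ) : ℝ)) (δ := 1 / (D:ℝ) ^ 2) (by positivity) (by
      rintro ⟨q, a⟩ hi ⟨q', a'⟩ hj hij
      simp only [mem_sigma, mem_range, mem_filter, mem_univ, true_and] at hi hj
      exact farey_spacing hi.1 hj.1 hi.2 hj.2 hij _)
    (N := N + 1) (L := N + 1 + D ^ 2) (by omega) (by omega) b'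
  rw [hr2, Finset.sum_sigma] at h1
  rw [primChars, Finset.sum_sigma]
  have h2 : ∑ q ∈ range D, ∑ χ : DirichletCharacter ℂ (q + 1) with χ.IsPrimitive,
      ‖∑ n ∈ Ioc 0 N, b n * χ n‖ ^ 2 ≤
      ∑ q ∈ range D, ∑ a : ZMod (q + 1) with IsUnit a,
        ‖∑ n ∈ range (N + 1), b' n * expC (n * (a.val / (q + 1 : ℕ) : ℝ))‖ ^ 2 := by
    refine Finset.sum_le_sum fun q _ => ?_
    refine (sum_primitive_norm_sq_le (Ioc 0 N) b).trans_eq ?_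
    refine Finset.sum_congr rfl fun a _ => ?_
    rw [hr]
    simp_rw [stdAddChar_natCast_mul]
  refine h2.trans (h1.trans ?_)
  rcases Nat.eq_zero_or_pos N with rfl | hN
  · simp
  have hN' : (1:ℝ) ≤ N := by exact_mod_cast hN
  gcongr
  have h3 : intInvSq / (((N + 1 + D ^ 2 : ℕ) : ℝ) * (1 / (D:ℝ) ^ 2) ^ 2) ≤ intInvSq * (D:ℝ) ^ 2 := by
    rw [div_le_iff₀ (by positivity)]
    push_cast
    have : intInvSq * (D:ℝ) ^ 2 * (((N:ℝ) + 1 + (D:ℝ) ^ 2) * (1 / (D:ℝ) ^ 2) ^ 2) =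
      intInvSq * (((N:ℝ) + 1 + (D:ℝ) ^ 2) / (D:ℝ) ^ 2) := by field_simp
    rw [this]
    refine le_mul_of_one_le_right hI ?_
    rw [one_le_div (by positivity)]
    linarith
  push_cast at h3 ⊢
  nlinarith [mul_nonneg hI (by linarith : (0:ℝ) ≤ N)]

end TwinSieve

namespace TwinSieve
open Finset
open ArithmeticFunction (moebius)

theorem sum_divisors_mul_of_coprime {M : Type*} [AddCommMonoid M] {m n : ℕ} (h : m.Coprime n)
    (g : ℕ → M) :
    ∑ d ∈ (m * n).divisors, g d = ∑ a ∈ m.divisors, ∑ b ∈ n.divisors, g (a * b) := by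
  rw [Nat.divisors_mul, Finset.mul_def, Finset.sum_image h.mul_injOn_divisors,
    Finset.sum_product]

theorem dvd_of_forall_prime_of_squarefree {r q : ℕ} (hr : Squarefree r)
    (h : ∀ p, p.Prime → p ∣ r → p ∣ q) : r ∣ q := by
  rcases eq_or_ne q 0 with rfl | hq
  · exact dvd_zero r
  rw [← Nat.prod_primeFactors_of_squarefree hr]
  refine Finset.prod_primes_dvd q (fun p hp => (Nat.prime_of_mem_primeFactors hp).prime) ?_
  intro p hp
  exact h p (Nat.prime_of_mem_primeFactors hp) (Nat.dvd_of_mem_primeFactors hp)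

/-- The possible values of Möbius sums over divisors with a prescribed greatest common divisor. -/
theorem abs_sum_moebius_filter_le {m k q a : ℕ} (hm : Squarefree m) (hk : k ∣ m)
    (hkq : k.Coprime q) :
    |∑ d ∈ m.divisors with d.gcd q = a ∧ k ∣ d, (moebius d : ℝ)| ≤
      if m = k * m.gcd q ∧ a ∣ m.gcd q then 1 else 0 := by
  by_cases hp : ∃ p, p.Prime ∧ p ∣ m ∧ ¬ p ∣ q ∧ ¬ p ∣ k
  · obtain ⟨p, hp, hpm, hpq, hpk⟩ := hp
    have hcq : p.Coprime q := (Nat.Prime.coprime_iff_not_dvd hp).2 hpq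
    have hck : p.Coprime k := (Nat.Prime.coprime_iff_not_dvd hp).2 hpk
    have h0 : ∑ d ∈ m.divisors with d.gcd q = a ∧ k ∣ d, (moebius d : ℝ) = 0 := by
      refine Finset.sum_involution (fun d _ => if p ∣ d then d / p else p * d) ?_ ?_ ?_ ?_
      · intro d hd
        have hdm := Nat.dvd_of_mem_divisors (mem_filter.1 hd).1
        have hds : Squarefree d := hm.squarefree_of_dvd hdm
        have hmu : ∀ e, Squarefree (p * e) → (moebius (p * e) : ℝ) = -moebius e := by
          intro e he
          have hc := Nat.coprime_of_squarefree_mul he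
          rw [ArithmeticFunction.isMultiplicative_moebius.map_mul_of_coprime hc,
            ArithmeticFunction.moebius_apply_prime hp]
          push_cast; ring
        split_ifs with h
        · obtain ⟨e, rfl⟩ := h
          rw [Nat.mul_div_cancel_left _ hp.pos, hmu e hds]
          ring
        · rw [hmu d]
          · ring
          · rw [Nat.squarefree_mul_iff]
            exact ⟨(Nat.Prime.coprime_iff_not_dvd hp).2 h, hp.prime.squarefree, hds⟩
      · intro d hd _
        have hd0 : 0 < d := Nat.pos_of_mem_divisors (mem_filter.1 hd).1
        split_ifs with h
        · exact (Nat.div_lt_self hd0 hp.one_lt).ne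
        · have := hp.one_lt
          nlinarith
      · intro d hd
        rw [mem_filter, Nat.mem_divisors] at hd ⊢
        obtain ⟨⟨hdm, hm0⟩, hg, hkd⟩ := hd
        split_ifs with h
        · obtain ⟨e, rfl⟩ := h
          rw [Nat.mul_div_cancel_left _ hp.pos]
          rw [Nat.Coprime.gcd_mul_left_cancel _ hcq] at hg
          exact ⟨⟨(Dvd.intro_left _ rfl).trans hdm, hm0⟩, hg, hck.symm.dvd_of_dvd_mul_left hkd⟩
        · refine ⟨⟨?_, hm0⟩, ?_, hkd.mul_left _⟩
          · exact Nat.Coprime.mul_dvd_of_dvd_of_dvd ((Nat.Prime.coprime_iff_not_dvd hp).2 h) hpm hdm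
          · rw [Nat.Coprime.gcd_mul_left_cancel _ hcq, hg]
      · intro d hd
        by_cases h : p ∣ d
        · obtain ⟨e, rfl⟩ := h
          have hdm := Nat.dvd_of_mem_divisors (mem_filter.1 hd).1
          have hds := Nat.coprime_of_squarefree_mul (hm.squarefree_of_dvd hdm)
          have : ¬ p ∣ e := (Nat.Prime.coprime_iff_not_dvd hp).1 hds
          simp [Nat.mul_div_cancel_left _ hp.pos, this]
        · simp [h, Nat.mul_div_cancel_left _ hp.pos]
    rw [h0, abs_zero]
    split_ifs <;> norm_num
  · push Not at hp
    obtain ⟨r, rfl⟩ := hk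
    have hkr := Nat.coprime_of_squarefree_mul hm
    have hrq : r ∣ q := by
      refine dvd_of_forall_prime_of_squarefree (Nat.squarefree_mul_iff.1 hm).2.2 fun p h1 h2 => ?_
      by_contra h3
      have h4 := hp p h1 (h2.mul_left _) h3
      exact h1.one_lt.ne' (Nat.dvd_one.1 (hkr ▸ Nat.dvd_gcd h4 h2))
    have hgr : (k * r).gcd q = r := by
      rw [Nat.Coprime.gcd_mul_left_cancel _ hkq, Nat.gcd_eq_left hrq]
    rw [hgr]
    have hsub : ∀ d ∈ (k * r).divisors.filter (fun d => d.gcd q = a ∧ k ∣ d), a ∣ r ∧ d = k * a := by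
      intro d hd
      rw [mem_filter, Nat.mem_divisors] at hd
      obtain ⟨⟨hdm, hm0⟩, hg, s, rfl⟩ := hd
      have hk0 : 0 < k := Nat.pos_of_ne_zero (left_ne_zero_of_mul hm0)
      have hs := Nat.dvd_of_mul_dvd_mul_left hk0 hdm
      rw [Nat.Coprime.gcd_mul_left_cancel _ hkq, Nat.gcd_eq_left (hs.trans hrq)] at hg
      subst hg
      exact ⟨hs, rfl⟩
    by_cases ha : a ∣ r
    · simp only [ha, and_self, if_true]
      have hss : (k * r).divisors.filter (fun d => d.gcd q = a ∧ k ∣ d) ⊆ {k * a} := fun d hd => by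
        rw [mem_singleton]; exact (hsub d hd).2
      have hmu : |(moebius (k * a) : ℝ)| ≤ 1 := by
        exact_mod_cast ArithmeticFunction.abs_moebius_le_one
      rcases Finset.subset_singleton_iff.1 hss with h | h
      · rw [h]; simp
      · rw [h, sum_singleton]
        exact hmu
    · have : (k * r).divisors.filter (fun d => d.gcd q = a ∧ k ∣ d) = ∅ := by
        rw [Finset.eq_empty_iff_forall_notMem]
        exact fun d hd => ha (hsub d hd).1
      rw [this]
      simp [ha]

/-- A multiplicative sieve density `f` on a divisor closed set `A` of squarefree numbers. -/
structure SieveData (A : Finset ℕ) (f : ℕ → ℝ) : Prop where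
  one_mem : 1 ∈ A
  squarefree : ∀ d ∈ A, Squarefree d
  mem_of_dvd : ∀ d ∈ A, ∀ e, e ∣ d → e ∈ A
  map_one : f 1 = 1
  map_mul : ∀ m n, m.Coprime n → f (m * n) = f m * f n
  one_le : ∀ d ∈ A, 1 ≤ f d

/-- The Selberg sum `∑ 1/f`. -/
noncomputable def selG (A : Finset ℕ) (f : ℕ → ℝ) : ℝ := ∑ k ∈ A, 1 / f k

/-- Normalized Selberg weights. -/
noncomputable def selU (A : Finset ℕ) (f : ℕ → ℝ) (d : ℕ) : ℝ :=
  moebius d / selG A f * ∑ m ∈ A with d ∣ m, 1 / f m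

namespace SieveData
variable {A : Finset ℕ} {f : ℕ → ℝ}

theorem selG_ge_one (h : SieveData A f) : 1 ≤ selG A f := by
  have : 1 / f 1 ≤ selG A f := Finset.single_le_sum (f := fun k => 1 / f k)
    (fun k hk => by have := h.one_le k hk; positivity) h.one_mem
  rwa [h.map_one, div_one] at this

theorem selU_one (h : SieveData A f) : selU A f 1 = 1 := by
  have := h.selG_ge_one
  simp only [selU, one_dvd, filter_true, ArithmeticFunction.moebius_apply_one, Int.cast_one]
  rw [← selG]
  field_simp

theorem ne_zero (h : SieveData A f) {d : ℕ} (hd : d ∈ A) : d ≠ 0 := (h.squarefree d hd).ne_zero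

theorem map_mul_of_mem (h : SieveData A f) {d e : ℕ} (hde : d * e ∈ A) : f (d * e) = f d * f e :=
  h.map_mul _ _ (Nat.coprime_of_squarefree_mul (h.squarefree _ hde))

theorem abs_selU_le (h : SieveData A f) {d : ℕ} (hd : d ∈ A) : |selU A f d| ≤ 1 / f d := by
  have hG := h.selG_ge_one
  have hfd := h.one_le d hd
  have h1 : ∑ m ∈ A with d ∣ m, 1 / f m ≤ 1 / f d * selG A f := by
    rw [selG, Finset.mul_sum]
    calc ∑ m ∈ A with d ∣ m, 1 / f m
        = ∑ m ∈ A with d ∣ m, 1 / f d * (1 / f (m / d)) := by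
          refine Finset.sum_congr rfl fun m hm => ?_
          obtain ⟨hm, e, rfl⟩ := mem_filter.1 hm
          rw [Nat.mul_div_cancel_left _ (Nat.pos_of_ne_zero (h.ne_zero hd)), h.map_mul_of_mem hm]
          field_simp
      _ = ∑ e ∈ (A.filter (d ∣ ·)).image (· / d), 1 / f d * (1 / f e) := by
          rw [Finset.sum_image]
          intro m hm m' hm' hmm
          have h1 := (mem_filter.1 hm).2
          have h2 := (mem_filter.1 hm').2
          have hmm' : m / d = m' / d := hmm
          rw [← Nat.mul_div_cancel' h1, hmm', Nat.mul_div_cancel' h2]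
      _ ≤ _ := by
          refine Finset.sum_le_sum_of_subset_of_nonneg ?_ fun e he _ => ?_
          · intro e he
            obtain ⟨m, hm, rfl⟩ := mem_image.1 he
            exact h.mem_of_dvd m (mem_filter.1 hm).1 _ (Nat.div_dvd_of_dvd (mem_filter.1 hm).2)
          · have := h.one_le e he
            positivity
  have h0 : 0 ≤ ∑ m ∈ A with d ∣ m, 1 / f m := Finset.sum_nonneg fun m hm => by
    have := h.one_le m (mem_filter.1 hm).1
    positivity
  have hmu : |(moebius d : ℝ)| ≤ 1 := by exact_mod_cast ArithmeticFunction.abs_moebius_le_one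
  rw [selU, abs_mul, abs_div, abs_of_nonneg h0, abs_of_pos (by linarith : 0 < selG A f)]
  calc _ ≤ 1 / selG A f * (1 / f d * selG A f) := by gcongr
    _ = _ := by field_simp

/-- Sums of the weights over a prescribed greatest common divisor with `q`. -/
theorem abs_sum_selU_le (h : SieveData A f) {q : ℕ} (hq : Squarefree q) (hfq : ∀ e ∈ q.divisors, 1 ≤ f e)
    {k : ℕ} (hk : k ∈ A) (hkq : k.Coprime q) (a : ℕ) :
    |∑ d ∈ A with d.gcd q = a ∧ k ∣ d, selU A f d| ≤
      1 / (selG A f * f k) * ∑ e ∈ q.divisors with a ∣ e, 1 / f e := by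
  have hG := h.selG_ge_one
  have h1 : ∑ d ∈ A with d.gcd q = a ∧ k ∣ d, selU A f d =
      1 / selG A f * ∑ m ∈ A with k ∣ m, 1 / f m *
        ∑ d ∈ m.divisors with d.gcd q = a ∧ k ∣ d, (moebius d : ℝ) := by
    simp_rw [selU, Finset.mul_sum]
    rw [Finset.sum_comm' (t' := A.filter (k ∣ ·))
      (s' := fun m => m.divisors.filter fun d => d.gcd q = a ∧ k ∣ d)]
    · refine Finset.sum_congr rfl fun m _ => Finset.sum_congr rfl fun d _ => ?_
      ring
    · intro d m
      simp only [mem_filter, Nat.mem_divisors]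
      constructor
      · rintro ⟨⟨hd, h1, h2⟩, hm, hdm⟩
        exact ⟨⟨⟨hdm, h.ne_zero hm⟩, h1, h2⟩, hm, h2.trans hdm⟩
      · rintro ⟨⟨⟨hdm, _⟩, h1, h2⟩, hm, hkm⟩
        exact ⟨⟨h.mem_of_dvd m hm d hdm, h1, h2⟩, hm, hdm⟩
  have hfk := h.one_le k hk
  have h2 : ∀ m ∈ A.filter (k ∣ ·), |1 / f m *
      ∑ d ∈ m.divisors with d.gcd q = a ∧ k ∣ d, (moebius d : ℝ)| ≤
      if m = k * m.gcd q ∧ a ∣ m.gcd q then 1 / (f k * f (m.gcd q)) else 0 := by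
    intro m hm
    obtain ⟨hm, hkm⟩ := mem_filter.1 hm
    have hfm := h.one_le m hm
    have := abs_sum_moebius_filter_le (a := a) (h.squarefree m hm) hkm hkq
    rw [abs_mul, abs_of_pos (by positivity)]
    split_ifs at this ⊢ with hc
    · have h3 : f m = f k * f (m.gcd q) := by
        have := hc.1
        rw [this] at hm
        rw [← h.map_mul_of_mem hm, ← this]
      rw [h3] at hfm ⊢
      exact mul_le_of_le_one_right (by positivity) this
    · have h0 := le_antisymm this (abs_nonneg _)
      rw [h0, mul_zero]
  rw [h1, abs_mul, abs_of_pos (by positivity : 0 < 1 / selG A f)]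
  calc _ ≤ 1 / selG A f * ∑ m ∈ A with k ∣ m,
        if m = k * m.gcd q ∧ a ∣ m.gcd q then 1 / (f k * f (m.gcd q)) else 0 := by
        gcongr
        exact (Finset.abs_sum_le_sum_abs _ _).trans (Finset.sum_le_sum h2)
    _ ≤ 1 / selG A f * ∑ e ∈ q.divisors with a ∣ e, 1 / (f k * f e) := by
        gcongr
        rw [← Finset.sum_filter, ← Finset.sum_image (s := (A.filter (k ∣ ·)).filter
          fun m => m = k * m.gcd q ∧ a ∣ m.gcd q) (g := fun m => m.gcd q)
          (f := fun e => 1 / (f k * f e))]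
        · refine Finset.sum_le_sum_of_subset_of_nonneg ?_ fun e he _ => ?_
          · intro e he
            obtain ⟨m, hm, rfl⟩ := mem_image.1 he
            rw [mem_filter, Nat.mem_divisors]
            exact ⟨⟨Nat.gcd_dvd_right _ _, hq.ne_zero⟩, (mem_filter.1 hm).2.2⟩
          · have := hfq e (mem_filter.1 he).1
            positivity
        · intro m hm m' hm' hmm
          have e1 := (mem_filter.1 hm).2.1
          have e2 := (mem_filter.1 hm').2.1
          have hmm' : m.gcd q = m'.gcd q := hmm
          rw [e1, hmm', ← e2]
    _ = _ := by
        rw [Finset.mul_sum, Finset.mul_sum]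
        refine Finset.sum_congr rfl fun e _ => ?_
        rw [div_mul_div_comm, div_mul_div_comm]
        ring

/-- Splitting a divisor sum over a greatest common divisor at `q`. -/
theorem sum_divisors_gcd (h : SieveData A f) {q d₁ d₂ : ℕ} (hd₁ : d₁ ∈ A) :
    ∑ k ∈ (d₁.gcd d₂).divisors, f k =
      (∑ k ∈ ((d₁.gcd q).gcd (d₂.gcd q)).divisors, f k) *
        ∑ k ∈ A with k.Coprime q ∧ k ∣ d₁ ∧ k ∣ d₂, f k := by
  have hgA : d₁.gcd d₂ ∈ A := h.mem_of_dvd _ hd₁ _ (Nat.gcd_dvd_left _ _)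
  have hgq : (d₁.gcd q).gcd (d₂.gcd q) = (d₁.gcd d₂).gcd q := by
    apply Nat.dvd_antisymm
    · exact Nat.dvd_gcd (Nat.gcd_dvd_gcd_of_dvd_left _ (Nat.gcd_dvd_left _ _) |>.trans
        (Nat.gcd_dvd_gcd_of_dvd_right _ (Nat.gcd_dvd_left _ _)))
        ((Nat.gcd_dvd_left _ _).trans (Nat.gcd_dvd_right _ _))
    · exact Nat.dvd_gcd (Nat.gcd_dvd_gcd_of_dvd_left _ (Nat.gcd_dvd_left _ _))
        (Nat.gcd_dvd_gcd_of_dvd_left _ (Nat.gcd_dvd_right _ _))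
  rw [hgq]
  have hdvd : ∀ k, k ∣ d₁ ∧ k ∣ d₂ ↔ k ∣ d₁.gcd d₂ := fun k => Nat.dvd_gcd_iff.symm
  simp_rw [hdvd]
  generalize d₁.gcd d₂ = g at *
  obtain ⟨r, hr⟩ := Nat.gcd_dvd_left g q
  have hsq := h.squarefree g hgA
  rw [hr] at hsq
  have hc := Nat.coprime_of_squarefree_mul hsq
  have hrq : r.Coprime q := by
    refine Nat.Coprime.symm (Nat.coprime_of_dvd fun p hp h1 h2 => ?_)
    have h3 : p ∣ g := by rw [hr]; exact h2.mul_left _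
    exact hp.one_lt.ne' (Nat.dvd_one.1 (hc ▸ Nat.dvd_gcd (Nat.dvd_gcd h3 h1) h2))
  have hset : A.filter (fun k => k.Coprime q ∧ k ∣ g) = r.divisors := by
    ext k
    rw [mem_filter, Nat.mem_divisors]
    constructor
    · rintro ⟨_, h1, h2⟩
      refine ⟨?_, right_ne_zero_of_mul hsq.ne_zero⟩
      rw [hr] at h2
      exact (Nat.Coprime.coprime_dvd_right (Nat.gcd_dvd_right g q) h1).dvd_of_dvd_mul_left h2
    · rintro ⟨h1, _⟩
      have h2 : k ∣ g := by rw [hr]; exact h1.mul_left _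
      exact ⟨h.mem_of_dvd _ hgA _ h2, hrq.coprime_dvd_left h1, h2⟩
  rw [hset, Finset.sum_mul_sum]
  conv_lhs => rw [hr]
  rw [sum_divisors_mul_of_coprime hc]
  refine Finset.sum_congr rfl fun x hx => Finset.sum_congr rfl fun y hy => ?_
  exact h.map_mul _ _ ((hc.coprime_dvd_left (Nat.dvd_of_mem_divisors hx)).coprime_dvd_right
    (Nat.dvd_of_mem_divisors hy))

theorem dvd_lcm_gcd_iff {q d₁ d₂ : ℕ} (hq : Squarefree q) :
    q ∣ (d₁.gcd q).lcm (d₂.gcd q) ↔ q ∣ d₁.lcm d₂ := by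
  constructor
  · intro h
    exact h.trans (Nat.lcm_dvd ((Nat.gcd_dvd_left _ _).trans (Nat.dvd_lcm_left _ _))
      ((Nat.gcd_dvd_left _ _).trans (Nat.dvd_lcm_right _ _)))
  · intro h
    refine dvd_of_forall_prime_of_squarefree hq fun p hp hpq => ?_
    rcases (hp.dvd_mul).1 ((hpq.trans h).trans (Nat.lcm_dvd_mul _ _)) with h1 | h1
    · exact (Nat.dvd_gcd h1 hpq).trans (Nat.dvd_lcm_left _ _)
    · exact (Nat.dvd_gcd h1 hpq).trans (Nat.dvd_lcm_right _ _)

theorem sum_dvd_inv_le (h : SieveData A f) {q a : ℕ} (hq : Squarefree q) (hfq : ∀ e ∈ q.divisors, 1 ≤ f e)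
    (ha : a ∣ q) : ∑ e ∈ q.divisors with a ∣ e, 1 / f e ≤ q.divisors.card / f a := by
  have hfa := hfq a (Nat.mem_divisors.2 ⟨ha, hq.ne_zero⟩)
  calc _ ≤ ∑ e ∈ q.divisors with a ∣ e, 1 / f a := by
        refine Finset.sum_le_sum fun e he => ?_
        obtain ⟨he, r, rfl⟩ := mem_filter.1 he
        have h1 := Nat.dvd_of_mem_divisors he
        have h2 := hfq r (Nat.mem_divisors.2 ⟨(Dvd.intro_left _ rfl).trans h1, hq.ne_zero⟩)
        rw [h.map_mul _ _ (Nat.coprime_of_squarefree_mul (hq.squarefree_of_dvd h1))]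
        gcongr
        exact le_mul_of_one_le_right (by linarith) h2
    _ ≤ ∑ e ∈ q.divisors, 1 / f a :=
        Finset.sum_le_sum_of_subset_of_nonneg (filter_subset _ _) fun _ _ _ => by positivity
    _ = _ := by rw [Finset.sum_const, nsmul_eq_mul, mul_one_div]

theorem sum_divisors_le (h : SieveData A f) {q g : ℕ} (hq : Squarefree q) (hfq : ∀ e ∈ q.divisors, 1 ≤ f e)
    (hg : g ∣ q) : ∑ e ∈ g.divisors, f e ≤ q.divisors.card * f g := by
  have hfg := hfq g (Nat.mem_divisors.2 ⟨hg, hq.ne_zero⟩)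
  calc _ ≤ ∑ e ∈ g.divisors, f g := by
        refine Finset.sum_le_sum fun e he => ?_
        obtain ⟨r, rfl⟩ := Nat.dvd_of_mem_divisors he
        have h1 : e ∣ q := (Dvd.intro _ rfl).trans hg
        have h2 := hfq r (Nat.mem_divisors.2 ⟨(Dvd.intro_left _ rfl).trans hg, hq.ne_zero⟩)
        have h3 := hfq e (Nat.mem_divisors.2 ⟨h1, hq.ne_zero⟩)
        rw [h.map_mul _ _ (Nat.coprime_of_squarefree_mul (hq.squarefree_of_dvd hg))]
        exact le_mul_of_one_le_right (by linarith) h2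
    _ = g.divisors.card * f g := by rw [Finset.sum_const, nsmul_eq_mul]
    _ ≤ _ := by
        gcongr
        exact hq.ne_zero

theorem map_mul_lcm_gcd (h : SieveData A f) {q a b : ℕ} (hq : Squarefree q) (ha : a ∣ q) (hb : b ∣ q)
    (hab : q ∣ a.lcm b) : f a * f b = f q * f (a.gcd b) := by
  have hl : q = a.lcm b := Nat.dvd_antisymm hab (Nat.lcm_dvd ha hb)
  have hg0 : 0 < a.gcd b := Nat.gcd_pos_of_pos_left _ (Nat.pos_of_dvd_of_pos ha
    (Nat.pos_of_ne_zero hq.ne_zero))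
  obtain ⟨r, hr⟩ := Nat.gcd_dvd_right a b
  have h1 : q = a * r := by
    have h2 := Nat.gcd_mul_lcm a b
    rw [← hl] at h2
    conv_rhs at h2 => rw [hr, mul_left_comm]
    exact Nat.eq_of_mul_eq_mul_left hg0 h2
  have hc1 : a.Coprime r := Nat.coprime_of_squarefree_mul (h1 ▸ hq)
  have hc2 : (a.gcd b).Coprime r := hc1.coprime_dvd_left (Nat.gcd_dvd_left _ _)
  rw [h1, h.map_mul _ _ hc1]
  conv_lhs => rw [hr]
  rw [h.map_mul _ _ hc2]
  ring

/-- The Selberg quadratic form restricted to pairs whose least common multiple is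
divisible by `q`. -/
theorem abs_sum_sum_selU_le (h : SieveData A f) {q : ℕ} (hq : Squarefree q) (hfq : ∀ e ∈ q.divisors, 1 ≤ f e) :
    |∑ d₁ ∈ A, ∑ d₂ ∈ A, if q ∣ d₁.lcm d₂ then
      selU A f d₁ * selU A f d₂ * ∑ k ∈ (d₁.gcd d₂).divisors, f k else 0| ≤
      (q.divisors.card : ℝ) ^ 5 / (f q * selG A f) := by
  have hG := h.selG_ge_one
  set Y : ℕ → ℕ → ℝ := fun a k => ∑ d ∈ A with d.gcd q = a ∧ k ∣ d, selU A f d with hY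
  have hmaps : ∀ d ∈ A, d.gcd q ∈ q.divisors := fun d _ =>
    Nat.mem_divisors.2 ⟨Nat.gcd_dvd_right _ _, hq.ne_zero⟩
  have hexp : ∑ d₁ ∈ A, ∑ d₂ ∈ A, (if q ∣ d₁.lcm d₂ then
      selU A f d₁ * selU A f d₂ * ∑ k ∈ (d₁.gcd d₂).divisors, f k else 0) =
      ∑ a ∈ q.divisors, ∑ b ∈ q.divisors, if q ∣ a.lcm b then
        (∑ k ∈ (a.gcd b).divisors, f k) * ∑ k ∈ A with k.Coprime q, f k * (Y a k * Y b k)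
        else 0 := by
    rw [← Finset.sum_fiberwise_of_maps_to hmaps]
    refine Finset.sum_congr rfl fun a _ => ?_
    rw [Finset.sum_congr rfl fun d₁ _ => (Finset.sum_fiberwise_of_maps_to hmaps _).symm,
      Finset.sum_comm]
    refine Finset.sum_congr rfl fun b _ => ?_
    have hpt : ∀ d₁ ∈ A.filter (fun d => d.gcd q = a), ∀ d₂ ∈ A.filter (fun d => d.gcd q = b),
        (if q ∣ d₁.lcm d₂ then
          selU A f d₁ * selU A f d₂ * ∑ k ∈ (d₁.gcd d₂).divisors, f k else 0) =
        if q ∣ a.lcm b then (∑ k ∈ (a.gcd b).divisors, f k) *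
          ∑ k ∈ A with k.Coprime q, f k * ((if k ∣ d₁ then selU A f d₁ else 0) *
            (if k ∣ d₂ then selU A f d₂ else 0)) else 0 := by
      intro d₁ h₁ d₂ h₂
      obtain ⟨h₁A, rfl⟩ := mem_filter.1 h₁
      obtain ⟨h₂A, rfl⟩ := mem_filter.1 h₂
      simp only [dvd_lcm_gcd_iff hq]
      refine if_congr Iff.rfl ?_ rfl
      rw [h.sum_divisors_gcd (q := q) h₁A, mul_left_comm]
      congr 1
      rw [← Finset.filter_filter, Finset.sum_filter, Finset.mul_sum]
      refine Finset.sum_congr rfl fun k _ => ?_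
      by_cases h3 : k ∣ d₁ <;> by_cases h4 : k ∣ d₂ <;> simp [h3, h4, mul_comm]
    rw [Finset.sum_congr rfl fun d₁ h₁ => Finset.sum_congr rfl fun d₂ h₂ => hpt d₁ h₁ d₂ h₂]
    split_ifs with hc
    · simp_rw [← Finset.mul_sum]
      congr 1
      rw [Finset.sum_congr rfl fun d₁ _ => Finset.sum_comm, Finset.sum_comm]
      refine Finset.sum_congr rfl fun k _ => ?_
      simp_rw [← Finset.mul_sum, ← Finset.sum_mul, hY, ← Finset.filter_filter, Finset.sum_filter]
    · simp
  have hdiv0 : q ≠ 0 := hq.ne_zero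
  have hfq' := hfq q (Nat.mem_divisors_self q hdiv0)
  have hterm : ∀ a ∈ q.divisors, ∀ b ∈ q.divisors, |if q ∣ a.lcm b then
      (∑ k ∈ (a.gcd b).divisors, f k) * ∑ k ∈ A with k.Coprime q, f k * (Y a k * Y b k) else 0| ≤
      (q.divisors.card : ℝ) ^ 3 / (f q * selG A f) := by
    intro a ha b hb
    split_ifs with hc
    swap
    · rw [abs_zero]; positivity
    have haq := Nat.dvd_of_mem_divisors ha
    have hbq := Nat.dvd_of_mem_divisors hb
    have hgq : a.gcd b ∣ q := (Nat.gcd_dvd_left _ _).trans haq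
    have hfa := hfq a ha
    have hfb := hfq b hb
    have hfg := hfq _ (Nat.mem_divisors.2 ⟨hgq, hdiv0⟩)
    have hF0 : 0 ≤ ∑ k ∈ (a.gcd b).divisors, f k := Finset.sum_nonneg fun k hk =>
      zero_le_one.trans (hfq k (Nat.mem_divisors.2 ⟨(Nat.dvd_of_mem_divisors hk).trans hgq, hdiv0⟩))
    have hYb : ∀ c ∈ q.divisors, ∀ k ∈ A.filter (·.Coprime q),
        |Y c k| ≤ 1 / (selG A f * f k) * (q.divisors.card / f c) := by
      intro c hc k hk
      obtain ⟨hk, hkq⟩ := mem_filter.1 hk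
      have := h.one_le k hk
      refine (h.abs_sum_selU_le hq hfq hk hkq c).trans ?_
      gcongr
      exact h.sum_dvd_inv_le hq hfq (Nat.dvd_of_mem_divisors hc)
    have hsum : |∑ k ∈ A with k.Coprime q, f k * (Y a k * Y b k)| ≤
        (q.divisors.card : ℝ) ^ 2 / (f a * f b) / selG A f := by
      calc _ ≤ ∑ k ∈ A with k.Coprime q, |f k * (Y a k * Y b k)| := Finset.abs_sum_le_sum_abs _ _
        _ ≤ ∑ k ∈ A with k.Coprime q, (q.divisors.card : ℝ) ^ 2 / (f a * f b) / selG A f ^ 2 *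
            (1 / f k) := by
          refine Finset.sum_le_sum fun k hk => ?_
          have hfk := h.one_le k (mem_filter.1 hk).1
          rw [abs_mul, abs_mul, abs_of_pos (by linarith : 0 < f k)]
          calc _ ≤ f k * ((1 / (selG A f * f k) * (q.divisors.card / f a)) *
                (1 / (selG A f * f k) * (q.divisors.card / f b))) := by
                gcongr
                · exact hYb a ha k hk
                · exact hYb b hb k hk
            _ = _ := by field_simp
        _ ≤ (q.divisors.card : ℝ) ^ 2 / (f a * f b) / selG A f ^ 2 * selG A f := by
          rw [← Finset.mul_sum]
          gcongr
          exact Finset.sum_le_sum_of_subset_of_nonneg (filter_subset _ _) fun k hk _ => by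
            have := h.one_le k hk
            positivity
        _ = _ := by field_simp
    rw [abs_mul, abs_of_nonneg hF0]
    calc _ ≤ (q.divisors.card * f (a.gcd b)) *
          ((q.divisors.card : ℝ) ^ 2 / (f a * f b) / selG A f) := by
          gcongr
          exact h.sum_divisors_le hq hfq hgq
      _ = _ := by
          rw [h.map_mul_lcm_gcd hq haq hbq hc]
          field_simp
  rw [hexp]
  calc _ ≤ ∑ a ∈ q.divisors, ∑ b ∈ q.divisors, (q.divisors.card : ℝ) ^ 3 / (f q * selG A f) := by
        refine (Finset.abs_sum_le_sum_abs _ _).trans (Finset.sum_le_sum fun a ha => ?_)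
        exact (Finset.abs_sum_le_sum_abs _ _).trans (Finset.sum_le_sum fun b hb => hterm a ha b hb)
    _ = _ := by
        rw [Finset.sum_const, Finset.sum_const, nsmul_eq_mul, nsmul_eq_mul]
        ring

end SieveData
end TwinSieve

namespace TwinSieve
open Finset
open scoped ComplexConjugate

/-- Incomplete sums of a nontrivial character are bounded by its modulus. -/
theorem norm_sum_Ioc_char_le {q : ℕ} [NeZero q] {χ : DirichletCharacter ℂ q} (hχ : χ ≠ 1) (N : ℕ) :
    ‖∑ n ∈ Ioc 0 N, χ n‖ ≤ q := by
  have hper : ∀ k, ∑ n ∈ range q, χ ((k * q + n : ℕ) : ZMod q) = 0 := by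
    intro k
    have h0 : ∑ a : ZMod q, χ a = 0 := MulChar.sum_eq_zero_of_ne_one hχ
    rw [← h0]
    refine Finset.sum_bij' (fun n _ => (n : ZMod q)) (fun a _ => a.val) ?_ ?_ ?_ ?_ ?_
    · simp
    · intro a _; exact mem_range.2 (ZMod.val_lt a)
    · intro n hn; exact ZMod.val_cast_of_lt (mem_range.1 hn)
    · intro a _; simp
    · intro n _; simp
  have hmul : ∀ k, ∑ n ∈ range (k * q), χ (n : ZMod q) = 0 := by
    intro k
    induction k with
    | zero => simp
    | succ k ih =>
      rw [Nat.succ_mul, Finset.sum_range_add, ih, hper k, add_zero]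
  have hq : χ ((0 : ℕ) : ZMod q) = 0 ∨ q = 1 := by
    by_cases h1 : q = 1
    · exact Or.inr h1
    · left
      have : Fact (1 < q) := ⟨by have := NeZero.ne q; omega⟩
      rw [Nat.cast_zero]
      exact χ.map_nonunit not_isUnit_zero
  have hrange : ∀ N, ‖∑ n ∈ range N, χ (n : ZMod q)‖ ≤ ((N % q : ℕ) : ℝ) := by
    intro N
    conv_lhs => rw [← Nat.div_add_mod N q, mul_comm q, Finset.sum_range_add, hmul, zero_add]
    refine (norm_sum_le _ _).trans ?_
    refine (Finset.sum_le_card_nsmul _ _ 1 fun n _ => DirichletCharacter.norm_le_one χ _).trans ?_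
    simp
  rcases hq with h0 | rfl
  · have : ∑ n ∈ Ioc 0 N, χ (n : ZMod q) = ∑ n ∈ range (N + 1), χ (n : ZMod q) := by
      rw [Finset.sum_range_succ', h0, add_zero]
      refine Finset.sum_bij' (fun n _ => n - 1) (fun n _ => n + 1) ?_ ?_ ?_ ?_ ?_ <;>
        simp only [mem_Ioc, mem_range] <;> intros <;> try omega
      rename_i a ha
      rw [show a - 1 + 1 = a by omega]
    rw [this]
    refine (hrange _).trans ?_
    exact_mod_cast (Nat.mod_lt _ (NeZero.pos q)).le
  · exact absurd (Subsingleton.elim χ 1) hχ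

theorem conductor_one_of_eq_one {q : ℕ} [NeZero q] {χ : DirichletCharacter ℂ q}
    (hp : χ.IsPrimitive) (h : χ = 1) : q = 1 := by
  subst h
  have : (1 : DirichletCharacter ℂ q).conductor = q := hp
  rw [DirichletCharacter.conductor_one] at this
  exact this.symm

/-- The product of a primitive character with the conjugate of a different primitive character is
a nontrivial character. -/
theorem exists_char_eq_mul_conj {q₁ q₂ : ℕ} (χ₁ : DirichletCharacter ℂ (q₁ + 1))
    (χ₂ : DirichletCharacter ℂ (q₂ + 1)) (h₁ : χ₁.IsPrimitive) (h₂ : χ₂.IsPrimitive)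
    (hne : (⟨q₁, χ₁⟩ : CharIdx) ≠ ⟨q₂, χ₂⟩) :
    ∃ ψ : DirichletCharacter ℂ ((q₁ + 1) * (q₂ + 1)), ψ ≠ 1 ∧
      ∀ n : ℕ, ψ n = χ₁ n * conj (χ₂ n) := by
  have hd₁ : (q₁ + 1) ∣ (q₁ + 1) * (q₂ + 1) := dvd_mul_right _ _
  have hd₂ : (q₂ + 1) ∣ (q₁ + 1) * (q₂ + 1) := dvd_mul_left _ _
  refine ⟨DirichletCharacter.changeLevel hd₁ χ₁ * (DirichletCharacter.changeLevel hd₂ χ₂)⁻¹,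
    ?_, ?_⟩
  · intro h
    rw [mul_inv_eq_one] at h
    have hc : q₁ + 1 = q₂ + 1 := by
      have e₁ := DirichletCharacter.conductor_changeLevel (χ := χ₁) hd₁
      have e₂ := DirichletCharacter.conductor_changeLevel (χ := χ₂) hd₂
      rw [h, e₂] at e₁
      rw [DirichletCharacter.isPrimitive_def] at h₁ h₂
      omega
    have hq : q₁ = q₂ := by omega
    subst hq
    apply hne
    rw [DirichletCharacter.changeLevel_injective _ h]
  · intro n
    rw [MulChar.mul_apply, ← conj_char]
    by_cases hn : n.Coprime ((q₁ + 1) * (q₂ + 1))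
    · have hi : IsCoprime (n : ℤ) (((q₁ + 1) * (q₂ + 1) : ℕ) : ℤ) := Nat.isCoprime_iff_coprime.2 hn
      have e₁ := DirichletCharacter.changeLevel_eq_cast_of_dvd' χ₁ hd₁ hi
      have e₂ := DirichletCharacter.changeLevel_eq_cast_of_dvd' χ₂ hd₂ hi
      rw [Int.cast_natCast, Int.cast_natCast] at e₁ e₂
      rw [e₁, e₂]
    · have z : ∀ χ : DirichletCharacter ℂ ((q₁ + 1) * (q₂ + 1)), χ n = 0 := fun χ =>
        χ.map_nonunit (by rwa [ZMod.isUnit_iff_coprime])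
      rw [z, zero_mul]
      rw [Nat.coprime_mul_iff_right, not_and_or] at hn
      rcases hn with hn | hn
      · rw [χ₁.map_nonunit (by rwa [ZMod.isUnit_iff_coprime]), zero_mul]
      · rw [χ₂.map_nonunit (by rwa [ZMod.isUnit_iff_coprime]), map_zero, mul_zero]

theorem norm_sum_Ioc_mul_conj_le {i j : CharIdx} (hi : i.2.IsPrimitive) (hj : j.2.IsPrimitive)
    (hne : i ≠ j) (e M : ℕ) :
    ‖∑ n ∈ Ioc 0 M, i.2 ((e * n : ℕ) : ZMod _) * conj (j.2 ((e * n : ℕ) : ZMod _))‖ ≤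
      ((i.1 + 1) * (j.1 + 1) : ℕ) := by
  obtain ⟨ψ, hψ, h⟩ := exists_char_eq_mul_conj i.2 j.2 hi hj hne
  simp_rw [← h, Nat.cast_mul, map_mul]
  rw [← Finset.mul_sum, norm_mul]
  refine (mul_le_of_le_one_left (norm_nonneg _) (DirichletCharacter.norm_le_one _ _)).trans ?_
  exact_mod_cast norm_sum_Ioc_char_le hψ M

theorem card_primChars_le (D : ℕ) : ((primChars D).card : ℝ) ≤ (D : ℝ) ^ 2 := by
  classical
  unfold primChars
  rw [Finset.card_sigma]
  push_cast
  calc _ ≤ ∑ _q ∈ range D, (D : ℝ) := by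
        refine Finset.sum_le_sum fun q hq => ?_
        have h1 : Fintype.card (DirichletCharacter ℂ (q + 1)) ≤ D := by
          rw [← Nat.card_eq_fintype_card,
            DirichletCharacter.card_eq_totient_of_hasEnoughRootsOfUnity]
          have h2 := Nat.totient_le (q + 1)
          have h3 := mem_range.1 hq
          omega
        exact Nat.cast_le.2 ((Finset.card_le_card (Finset.filter_subset _ _)).trans h1)
    _ = _ := by simp [sq]

theorem mem_primChars {D : ℕ} {χ : CharIdx} :
    χ ∈ primChars D ↔ χ.1 + 1 ≤ D ∧ χ.2.IsPrimitive := by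
  simp [primChars]

end TwinSieve

namespace TwinSieve
open Finset
open scoped ComplexConjugate

theorem sum_filter_dvd_Ioc {M : Type*} [AddCommMonoid M] (L N : ℕ) (hL : 0 < L) (g : ℕ → M) :
    ∑ n ∈ Ioc 0 N with L ∣ n, g n = ∑ m ∈ Ioc 0 (N / L), g (L * m) := by
  symm
  refine Finset.sum_bij' (fun m _ => L * m) (fun n _ => n / L) ?_ ?_ ?_ ?_ ?_
  · intro m hm
    rw [mem_Ioc] at hm
    rw [mem_filter, mem_Ioc]
    exact ⟨⟨Nat.mul_pos hL hm.1, (Nat.mul_le_mul_left L hm.2).trans (Nat.mul_div_le N L)⟩,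
      dvd_mul_right _ _⟩
  · intro n hn
    rw [mem_filter, mem_Ioc] at hn
    rw [mem_Ioc]
    exact ⟨Nat.div_pos (Nat.le_of_dvd hn.1.1 hn.2) hL, Nat.div_le_div_right hn.1.2⟩
  · intro m _; exact Nat.mul_div_cancel_left _ hL
  · intro n hn; exact Nat.mul_div_cancel' (mem_filter.1 hn).2
  · intro m _; rfl

/-- Expanding the square of a divisor sum. -/
theorem sum_sq_divisor_sum_mul {R : Type*} [CommSemiring R] (A : Finset ℕ) (hA : ∀ d ∈ A, 0 < d)
    (l g : ℕ → R) (N : ℕ) :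
    ∑ n ∈ Ioc 0 N, (∑ d ∈ A with d ∣ n, l d) ^ 2 * g n =
      ∑ d ∈ A, ∑ e ∈ A, l d * l e * ∑ m ∈ Ioc 0 (N / d.lcm e), g (d.lcm e * m) := by
  have h1 : ∀ n, (∑ d ∈ A with d ∣ n, l d) ^ 2 * g n =
      ∑ d ∈ A, ∑ e ∈ A, if d.lcm e ∣ n then l d * l e * g n else 0 := by
    intro n
    rw [sq, Finset.sum_filter, Finset.sum_mul_sum, Finset.sum_mul]
    refine Finset.sum_congr rfl fun d _ => ?_
    rw [Finset.sum_mul]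
    refine Finset.sum_congr rfl fun e _ => ?_
    by_cases h₁ : d ∣ n <;> by_cases h₂ : e ∣ n <;> simp [Nat.lcm_dvd_iff, h₁, h₂]
  simp_rw [h1]
  rw [Finset.sum_comm]
  refine Finset.sum_congr rfl fun d hd => ?_
  rw [Finset.sum_comm]
  refine Finset.sum_congr rfl fun e he => ?_
  rw [← Finset.sum_filter, ← Finset.mul_sum, sum_filter_dvd_Ioc _ _ (Nat.lcm_pos (hA d hd) (hA e he))]

/-- Squarefree numbers up to `V`. -/
def sqfreeUpTo (V : ℕ) : Finset ℕ := (Ioc 0 V).filter Squarefree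

theorem mem_sqfreeUpTo {V d : ℕ} : d ∈ sqfreeUpTo V ↔ (0 < d ∧ d ≤ V) ∧ Squarefree d := by
  simp [sqfreeUpTo]

theorem sieveData_totient {V : ℕ} (hV : 1 ≤ V) :
    SieveData (sqfreeUpTo V) (fun n => (n.totient : ℝ)) where
  one_mem := mem_sqfreeUpTo.2 ⟨⟨one_pos, hV⟩, squarefree_one⟩
  squarefree d hd := (mem_sqfreeUpTo.1 hd).2
  mem_of_dvd d hd e he := by
    rw [mem_sqfreeUpTo] at hd ⊢
    exact ⟨⟨Nat.pos_of_dvd_of_pos he hd.1.1, (Nat.le_of_dvd hd.1.1 he).trans hd.1.2⟩,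
      hd.2.squarefree_of_dvd he⟩
  map_one := by simp
  map_mul m n h := by rw [Nat.totient_mul h]; push_cast; rfl
  one_le d hd := by
    have := Nat.totient_pos.2 (mem_sqfreeUpTo.1 hd).1.1
    exact_mod_cast this

theorem sum_one_div_le_two_mul (V : ℕ) :
    ∑ n ∈ Ioc 0 V, (1 / n : ℝ) ≤ 2 * ∑ k ∈ sqfreeUpTo V, (1 / k : ℝ) := by
  have h2 : ∑ m ∈ Ioc 0 V, ((m : ℝ) ^ 2)⁻¹ ≤ 2 := by
    have h := sum_Ioo_inv_sq_le (α := ℝ) 0 (V + 1)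
    have he : Ioo 0 (V + 1) = Ioc 0 V := by ext x; simp
    rw [he] at h
    simpa using h
  calc ∑ n ∈ Ioc 0 V, (1 / n : ℝ)
      ≤ ∑ p ∈ Ioc 0 V ×ˢ sqfreeUpTo V, ((p.1 : ℝ) ^ 2)⁻¹ * (1 / p.2) := by
        have hex : ∀ n ∈ Ioc 0 V, ∃ p ∈ Ioc 0 V ×ˢ sqfreeUpTo V, p.1 ^ 2 * p.2 = n := by
          intro n hn
          rw [mem_Ioc] at hn
          obtain ⟨a, b, h, hs⟩ := Nat.sq_mul_squarefree n
          have hb : b ≠ 0 := by rintro rfl; simp at h; omega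
          have ha : a ≠ 0 := by rintro rfl; simp at h; omega
          refine ⟨(b, a), ?_, h⟩
          rw [mem_product, mem_Ioc, mem_sqfreeUpTo]
          have hb' := Nat.pos_of_ne_zero hb
          have ha' := Nat.pos_of_ne_zero ha
          refine ⟨⟨hb', ?_⟩, ⟨ha', ?_⟩, hs⟩
          · have : b ≤ b ^ 2 * a := by nlinarith [Nat.mul_le_mul hb' ha', Nat.mul_le_mul_left (b*b) ha']
            show b ≤ V
            omega
          · have : a ≤ b ^ 2 * a := Nat.le_mul_of_pos_left _ (by positivity)
            show a ≤ V
            omega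
        choose! φ hφ hφ' using hex
        calc _ = ∑ n ∈ Ioc 0 V, (((φ n).1 : ℝ) ^ 2)⁻¹ * (1 / (φ n).2) := by
              refine Finset.sum_congr rfl fun n hn => ?_
              conv_lhs => rw [← hφ' n hn]
              push_cast
              rw [one_div, mul_inv, one_div]
          _ = ∑ p ∈ (Ioc 0 V).image φ, ((p.1 : ℝ) ^ 2)⁻¹ * (1 / p.2) := by
              rw [Finset.sum_image]
              intro a ha b hb hab
              rw [← hφ' a ha, ← hφ' b hb, hab]
          _ ≤ _ := by
              refine Finset.sum_le_sum_of_subset_of_nonneg ?_ fun _ _ _ => by positivity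
              intro p hp
              obtain ⟨n, hn, rfl⟩ := mem_image.1 hp
              exact hφ n hn
    _ = (∑ m ∈ Ioc 0 V, ((m : ℝ) ^ 2)⁻¹) * ∑ k ∈ sqfreeUpTo V, (1 / k : ℝ) := by
        rw [Finset.sum_product, Finset.sum_mul_sum]
    _ ≤ _ := mul_le_mul_of_nonneg_right h2 (Finset.sum_nonneg fun _ _ => by positivity)

theorem log_le_sum_one_div (V : ℕ) : Real.log (V + 1) ≤ ∑ n ∈ Ioc 0 V, (1 / n : ℝ) := by
  have h := log_add_one_le_harmonic V
  rw [Nat.cast_add_one] at h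
  refine h.trans (le_of_eq ?_)
  rw [harmonic_eq_sum_Icc]
  push_cast
  have : Icc 1 V = Ioc 0 V := by ext; simp [Nat.succ_le_iff]
  rw [this]
  simp

theorem log_le_two_mul_selG {V : ℕ} :
    Real.log (V + 1) ≤ 2 * selG (sqfreeUpTo V) (fun n => (n.totient : ℝ)) := by
  refine (log_le_sum_one_div V).trans ((sum_one_div_le_two_mul V).trans ?_)
  refine mul_le_mul_of_nonneg_left (Finset.sum_le_sum fun k hk => ?_) (by norm_num)
  have := Nat.totient_pos.2 (mem_sqfreeUpTo.1 hk).1.1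
  exact one_div_le_one_div_of_le (Nat.cast_pos.2 this) (Nat.cast_le.2 (Nat.totient_le k))

/-- Selberg weights for the classical sieve of level `V`. -/
noncomputable def selWeight (V d : ℕ) : ℝ :=
  d * selU (sqfreeUpTo V) (fun n => (n.totient : ℝ)) d

theorem abs_selWeight_le {V d : ℕ} (hV : 1 ≤ V) (hd : d ∈ sqfreeUpTo V) : |selWeight V d| ≤ V := by
  have h := (sieveData_totient hV).abs_selU_le hd
  have hd' := mem_sqfreeUpTo.1 hd
  have h1 : (1:ℝ) ≤ d.totient := by exact_mod_cast Nat.totient_pos.2 hd'.1.1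
  rw [selWeight, abs_mul, Nat.abs_cast]
  have h2 : |selU (sqfreeUpTo V) (fun n => (n.totient : ℝ)) d| ≤ 1 :=
    h.trans (by rw [div_le_one (by linarith)]; exact h1)
  have h3 : (d : ℝ) ≤ V := by exact_mod_cast hd'.1.2
  calc _ ≤ (V : ℝ) * 1 := mul_le_mul h3 h2 (abs_nonneg _) (by positivity)
    _ = V := mul_one _

theorem card_sqfreeUpTo_le (V : ℕ) : ((sqfreeUpTo V).card : ℝ) ≤ V := by
  have : (sqfreeUpTo V).card ≤ V := (Finset.card_filter_le _ _).trans (by simp)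
  exact_mod_cast this

theorem sum_sum_abs_selWeight_le {V : ℕ} (hV : 1 ≤ V) :
    ∑ d ∈ sqfreeUpTo V, ∑ e ∈ sqfreeUpTo V, |selWeight V d * selWeight V e| ≤ (V : ℝ) ^ 4 := by
  have h1 : ∑ d ∈ sqfreeUpTo V, |selWeight V d| ≤ (V : ℝ) ^ 2 := by
    refine (Finset.sum_le_card_nsmul _ _ _ fun d hd => abs_selWeight_le hV hd).trans ?_
    rw [nsmul_eq_mul, sq]
    exact mul_le_mul_of_nonneg_right (card_sqfreeUpTo_le V) (by positivity)
  simp_rw [abs_mul]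
  rw [← Finset.sum_mul_sum, show (V:ℝ)^4 = V^2 * V^2 by ring]
  exact mul_le_mul h1 h1 (Finset.sum_nonneg fun _ _ => abs_nonneg _) (by positivity)

theorem sum_sq_selWeight_le {V : ℕ} (hV : 1 ≤ V) (N : ℕ) :
    ∑ n ∈ Ioc 0 N, (∑ d ∈ sqfreeUpTo V with d ∣ n, selWeight V d) ^ 2 ≤
      N / selG (sqfreeUpTo V) (fun n => (n.totient : ℝ)) + (V : ℝ) ^ 4 := by
  have hS := sieveData_totient hV
  have h0 := sum_sq_divisor_sum_mul (sqfreeUpTo V) (fun d hd => (mem_sqfreeUpTo.1 hd).1.1)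
    (selWeight V) (fun _ => (1 : ℝ)) N
  simp only [mul_one] at h0
  rw [h0]
  have hq := hS.abs_sum_sum_selU_le (q := 1) squarefree_one (by simp)
  simp only [one_dvd, if_true, Nat.divisors_one, card_singleton, Nat.totient_one,
    Nat.cast_one, one_pow, one_mul] at hq
  have hq' := (le_abs_self _).trans hq
  have hterm : ∀ d ∈ sqfreeUpTo V, ∀ e ∈ sqfreeUpTo V,
      selWeight V d * selWeight V e * ∑ m ∈ Ioc 0 (N / d.lcm e), (1:ℝ) ≤
      N * (selU (sqfreeUpTo V) (fun n => (n.totient : ℝ)) d *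
        selU (sqfreeUpTo V) (fun n => (n.totient : ℝ)) e *
          ∑ k ∈ (d.gcd e).divisors, (k.totient : ℝ)) + |selWeight V d * selWeight V e| := by
    intro d hd e he
    have hd0 := (mem_sqfreeUpTo.1 hd).1.1
    have he0 := (mem_sqfreeUpTo.1 he).1.1
    have hl : 0 < d.lcm e := Nat.lcm_pos hd0 he0
    have hl' : (0:ℝ) < d.lcm e := by exact_mod_cast hl
    have hg : ∑ k ∈ (d.gcd e).divisors, (k.totient : ℝ) = (d.gcd e : ℕ) := by
      rw [← Nat.cast_sum, Nat.sum_totient]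
    have hgl : ((d.gcd e : ℕ) : ℝ) * (d.lcm e : ℕ) = d * e := by
      exact_mod_cast Nat.gcd_mul_lcm d e
    have hs : ∑ m ∈ Ioc 0 (N / d.lcm e), (1:ℝ) = ((N / d.lcm e : ℕ) : ℝ) := by simp
    rw [hs, hg]
    have hfl : |((N / d.lcm e : ℕ) : ℝ) - N / (d.lcm e : ℕ)| ≤ 1 := by
      have h1 : ((N / d.lcm e : ℕ) : ℝ) ≤ N / (d.lcm e : ℕ) := Nat.cast_div_le
      have h2 : (N : ℝ) / (d.lcm e : ℕ) < ((N / d.lcm e : ℕ) : ℝ) + 1 := by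
        rw [div_lt_iff₀ hl']
        have := Nat.lt_mul_div_succ N hl
        rw [mul_comm] at this
        exact_mod_cast this
      rw [abs_le]; constructor <;> linarith
    have hmain : (N : ℝ) * (selU (sqfreeUpTo V) (fun n => (n.totient : ℝ)) d *
        selU (sqfreeUpTo V) (fun n => (n.totient : ℝ)) e * (d.gcd e : ℕ)) =
        selWeight V d * selWeight V e * (N / (d.lcm e : ℕ)) := by
      rw [selWeight, selWeight]
      field_simp
      rw [mul_assoc, mul_assoc, hgl]
      simp only [mul_assoc]
    rw [hmain]
    have h1 := le_abs_self (selWeight V d * selWeight V e *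
      (((N / d.lcm e : ℕ) : ℝ) - N / (d.lcm e : ℕ)))
    rw [abs_mul] at h1
    have h2 := mul_le_of_le_one_right (abs_nonneg (selWeight V d * selWeight V e)) hfl
    linarith
  refine (Finset.sum_le_sum fun d hd => Finset.sum_le_sum fun e he => hterm d hd e he).trans ?_
  simp_rw [Finset.sum_add_distrib, ← Finset.mul_sum]
  refine add_le_add ?_ (sum_sum_abs_selWeight_le hV)
  rw [div_eq_mul_one_div]
  exact mul_le_mul_of_nonneg_left hq' (by positivity)

/-- Large sieve for sequences supported on numbers free of small prime factors. -/
theorem sifted_large_sieve {V : ℕ} (hV : 2 ≤ V) (D N : ℕ) {r : Finset ℕ} (hr : r ⊆ Ioc 0 N)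
    (hsift : ∀ n ∈ r, ∀ d ∈ sqfreeUpTo V, d ∣ n → d = 1) (b : ℕ → ℂ) :
    ∑ χ ∈ primChars D, ‖∑ n ∈ r, b n * χ.2 n‖ ^ 2 ≤
      (2 * N / Real.log V + 2 * (V : ℝ) ^ 4 * (D : ℝ) ^ 4) * ∑ n ∈ r, ‖b n‖ ^ 2 := by
  have hV1 : 1 ≤ V := by omega
  have hlog : 0 < Real.log V := Real.log_pos (by exact_mod_cast hV)
  set G := selG (sqfreeUpTo V) (fun n => (n.totient : ℝ)) with hG
  have hGlog : Real.log V ≤ 2 * G := by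
    refine le_trans (Real.log_le_log (by positivity) (by simp)) log_le_two_mul_selG
  set w : ℕ → ℝ := fun n => (∑ d ∈ sqfreeUpTo V with d ∣ n, selWeight V d) ^ 2 with hw
  have hw1 : ∀ n ∈ r, w n = 1 := by
    intro n hn
    have : (sqfreeUpTo V).filter (fun d => d ∣ n) = {1} := by
      ext d
      rw [mem_filter, mem_singleton]
      constructor
      · intro h; exact hsift n hn d h.1 h.2
      · rintro rfl; exact ⟨(sieveData_totient hV1).one_mem, one_dvd n⟩
    simp only [hw]
    rw [this, sum_singleton, selWeight, (sieveData_totient hV1).selU_one]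
    simp
  have hrow : ∀ i ∈ primChars D, ∑ j ∈ primChars D,
      ‖∑ n ∈ Ioc 0 N, (w n : ℂ) * (i.2 n * conj (j.2 n))‖ ≤
        2 * N / Real.log V + 2 * (V : ℝ) ^ 4 * (D : ℝ) ^ 4 := by
    intro i hi
    have hi' := mem_primChars.1 hi
    have hD1 : (1:ℝ) ≤ D := by
      have := hi'.1
      exact_mod_cast (by omega : 1 ≤ D)
    rw [← Finset.add_sum_erase _ _ hi]
    have hdiag : ‖∑ n ∈ Ioc 0 N, (w n : ℂ) * (i.2 n * conj (i.2 n))‖ ≤ N / G + (V:ℝ) ^ 4 := by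
      refine (norm_sum_le _ _).trans ((Finset.sum_le_sum fun n _ => ?_).trans
        (sum_sq_selWeight_le hV1 N))
      rw [norm_mul, norm_mul, RCLike.norm_conj, Complex.norm_real, Real.norm_of_nonneg (sq_nonneg _)]
      have h1 := DirichletCharacter.norm_le_one i.2 (n : ZMod (i.1 + 1))
      exact mul_le_of_le_one_right (sq_nonneg _) (mul_le_one₀ h1 (norm_nonneg _) h1)
    have hoff : ∀ j ∈ (primChars D).erase i,
        ‖∑ n ∈ Ioc 0 N, (w n : ℂ) * (i.2 n * conj (j.2 n))‖ ≤ (V:ℝ) ^ 4 * (D:ℝ) ^ 2 := by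
      intro j hj
      have hj' := mem_primChars.1 (mem_of_mem_erase hj)
      have hne := ne_of_mem_erase hj
      have h0 := sum_sq_divisor_sum_mul (sqfreeUpTo V) (fun d hd => (mem_sqfreeUpTo.1 hd).1.1)
        (fun d => (selWeight V d : ℂ)) (fun n => i.2 n * conj (j.2 n)) N
      have h1 : ∑ n ∈ Ioc 0 N, (w n : ℂ) * (i.2 n * conj (j.2 n)) =
          ∑ n ∈ Ioc 0 N, (∑ d ∈ sqfreeUpTo V with d ∣ n, (selWeight V d : ℂ)) ^ 2 *
            (i.2 n * conj (j.2 n)) := by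
        refine Finset.sum_congr rfl fun n _ => ?_
        simp [hw]
      rw [h1, h0]
      have hb : ∀ d ∈ sqfreeUpTo V, ∀ e ∈ sqfreeUpTo V,
          ‖(selWeight V d : ℂ) * selWeight V e * ∑ m ∈ Ioc 0 (N / d.lcm e),
            i.2 ((d.lcm e * m : ℕ) : ZMod _) * conj (j.2 ((d.lcm e * m : ℕ) : ZMod _))‖ ≤
          |selWeight V d * selWeight V e| * (D:ℝ) ^ 2 := by
        intro d _ e _
        rw [norm_mul, ← Complex.ofReal_mul, Complex.norm_real, Real.norm_eq_abs]
        refine mul_le_mul_of_nonneg_left ?_ (abs_nonneg _)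
        refine (norm_sum_Ioc_mul_conj_le hi'.2 hj'.2 hne.symm _ _).trans ?_
        rw [sq]
        exact_mod_cast Nat.mul_le_mul hi'.1 hj'.1
      refine (norm_sum_le _ _).trans ((Finset.sum_le_sum fun d hd => (norm_sum_le _ _).trans
        (Finset.sum_le_sum fun e he => hb d hd e he)).trans ?_)
      simp_rw [← Finset.sum_mul]
      exact mul_le_mul_of_nonneg_right (sum_sum_abs_selWeight_le hV1) (by positivity)
    have hoff' := Finset.sum_le_card_nsmul _ _ _ hoff
    rw [nsmul_eq_mul] at hoff'
    have hcard : (((primChars D).erase i).card : ℝ) ≤ (D:ℝ) ^ 2 :=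
      (Nat.cast_le.2 (Finset.card_le_card (Finset.erase_subset _ _))).trans (card_primChars_le D)
    have hoff'' := hoff'.trans (mul_le_mul_of_nonneg_right hcard (by positivity))
    have hNG : (N:ℝ) / G ≤ 2 * N / Real.log V := by
      have : 0 < G := by linarith
      rw [div_le_div_iff₀ this hlog]
      nlinarith [Nat.cast_nonneg (α := ℝ) N]
    have hV4 : (V:ℝ) ^ 4 ≤ V ^ 4 * (D:ℝ) ^ 4 :=
      le_mul_of_one_le_right (by positivity) (one_le_pow₀ hD1)
    nlinarith
  refine sum_norm_sq_le_of_dual _ _ _ (by positivity) (fun z => ?_) b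
  refine le_trans ?_ (sum_mul_norm_sq_le_of_row_sums (primChars D) (Ioc 0 N) (fun χ n => χ.2 n) w
    hrow z)
  calc ∑ n ∈ r, ‖∑ i ∈ primChars D, z i * i.2 n‖ ^ 2
      = ∑ n ∈ r, w n * ‖∑ i ∈ primChars D, z i * i.2 n‖ ^ 2 :=
        Finset.sum_congr rfl fun n hn => by rw [hw1 n hn, one_mul]
    _ ≤ _ := Finset.sum_le_sum_of_subset_of_nonneg hr fun n _ _ =>
        mul_nonneg (sq_nonneg _) (sq_nonneg _)

end TwinSieve

namespace TwinSieve
open Finset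
open ArithmeticFunction (vonMangoldt)

theorem vonMangoldt_le_log_cast {n N : ℕ} (hn : n ≤ N) (h0 : 0 < n) :
    vonMangoldt n ≤ Real.log N :=
  ArithmeticFunction.vonMangoldt_le_log.trans
    (Real.log_le_log (by exact_mod_cast h0) (by exact_mod_cast hn))

theorem sum_vonMangoldt_not_prime_le {N : ℕ} (hN : 1 ≤ N) :
    ∑ n ∈ Ioc 0 N with ¬ n.Prime, vonMangoldt n ≤ 2 * √N * Real.log N := by
  have h := Chebyshev.abs_psi_sub_theta_le_sqrt_mul_log (x := N) (by exact_mod_cast hN)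
  rw [Chebyshev.psi, Chebyshev.theta, Nat.floor_natCast] at h
  have h2 : ∑ n ∈ Ioc 0 N with n.Prime, Real.log n = ∑ n ∈ Ioc 0 N with n.Prime, vonMangoldt n :=
    Finset.sum_congr rfl fun n hn => by
      rw [ArithmeticFunction.vonMangoldt_apply_prime (mem_filter.1 hn).2]
  rw [h2, ← Finset.sum_filter_add_sum_filter_not (Ioc 0 N) Nat.Prime, add_sub_cancel_left] at h
  exact (le_abs_self _).trans h

theorem norm_sum_vonMangoldt_char_le {q : ℕ} (χ : DirichletCharacter ℂ q) (r : Finset ℕ) :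
    ‖∑ n ∈ r, (vonMangoldt n : ℂ) * χ n‖ ≤ ∑ n ∈ r, vonMangoldt n := by
  refine (norm_sum_le _ _).trans (Finset.sum_le_sum fun n _ => ?_)
  rw [norm_mul, Complex.norm_real, Real.norm_of_nonneg ArithmeticFunction.vonMangoldt_nonneg]
  exact mul_le_of_le_one_right ArithmeticFunction.vonMangoldt_nonneg (χ.norm_le_one _)

theorem sum_primChars_norm_sq_le_trivial (D N : ℕ) {r : Finset ℕ} (hr : r ⊆ Ioc 0 N) :
    ∑ χ ∈ primChars D, ‖∑ n ∈ r, (vonMangoldt n : ℂ) * χ.2 n‖ ^ 2 ≤ 36 * (D:ℝ) ^ 2 * (N:ℝ) ^ 2 := by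
  have h : ∀ χ ∈ primChars D, ‖∑ n ∈ r, (vonMangoldt n : ℂ) * χ.2 n‖ ^ 2 ≤ (6 * N) ^ 2 := by
    intro χ _
    refine pow_le_pow_left₀ (norm_nonneg _) ((norm_sum_vonMangoldt_char_le χ.2 r).trans ?_) 2
    exact (Finset.sum_le_sum_of_subset_of_nonneg hr fun _ _ _ =>
      ArithmeticFunction.vonMangoldt_nonneg).trans (sum_vonMangoldt_le N)
  refine (Finset.sum_le_card_nsmul _ _ _ h).trans ?_
  rw [nsmul_eq_mul]
  nlinarith [mul_le_mul_of_nonneg_right (card_primChars_le D) (sq_nonneg (6 * (N:ℝ)))]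

theorem log_free_large_sieve_aux {V N : ℕ} (hV : 2 ≤ V) (hVN : V ^ 20 ≤ N) (hNV : N ≤ V ^ 40)
    {r : Finset ℕ} (hr : r ⊆ Ioc 0 N) :
    ∑ χ ∈ primChars V, ‖∑ n ∈ r, (vonMangoldt n : ℂ) * χ.2 n‖ ^ 2 ≤ 100000 * (N:ℝ) ^ 2 := by
  have hV' : (2:ℝ) ≤ V := by exact_mod_cast hV
  have hVN' : (V:ℝ) ^ 20 ≤ N := by exact_mod_cast hVN
  have hV1 : (1:ℝ) ≤ V := by linarith
  have hN1 : (1:ℝ) ≤ N := (one_le_pow₀ hV1).trans hVN'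
  set ℓ := Real.log V with hℓ
  have hℓ0 : 0 < ℓ := Real.log_pos (by linarith)
  have hlogN : Real.log N ≤ 40 * ℓ := by
    have : Real.log N ≤ Real.log ((V:ℝ) ^ 40) :=
      Real.log_le_log (by linarith) (by exact_mod_cast hNV)
    rwa [Real.log_pow] at this
  have hlogN0 : 0 ≤ Real.log N := Real.log_nonneg hN1
  have hℓV : ℓ ≤ V := (Real.log_le_sub_one_of_pos (by linarith)).trans (by linarith)
  set r₁ := r.filter (fun n => n.Prime ∧ V < n) with hr₁
  set r₂ := r.filter (fun n => ¬ (n.Prime ∧ V < n)) with hr₂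
  have hmain : ∑ χ ∈ primChars V, ‖∑ n ∈ r₁, (vonMangoldt n : ℂ) * χ.2 n‖ ^ 2 ≤ 960 * (N:ℝ) ^ 2 := by
    have hr₁N : r₁ ⊆ Ioc 0 N := (Finset.filter_subset _ _).trans hr
    refine (sifted_large_sieve hV V N hr₁N ?_ _).trans ?_
    · intro n hn d hd hdn
      obtain ⟨-, hp, hVn⟩ := mem_filter.1 hn
      rcases (Nat.dvd_prime hp).1 hdn with h | h
      · exact h
      · have := (mem_sqfreeUpTo.1 hd).1.2
        omega
    · have h2 : ∑ n ∈ r₁, ‖(vonMangoldt n : ℂ)‖ ^ 2 ≤ 40 * ℓ * (6 * N) := by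
        calc _ ≤ ∑ n ∈ r₁, 40 * ℓ * vonMangoldt n := by
              refine Finset.sum_le_sum fun n hn => ?_
              have hn' := mem_Ioc.1 (hr₁N hn)
              rw [Complex.norm_real, Real.norm_of_nonneg ArithmeticFunction.vonMangoldt_nonneg, sq]
              exact mul_le_mul_of_nonneg_right ((vonMangoldt_le_log_cast hn'.2 hn'.1).trans hlogN)
                ArithmeticFunction.vonMangoldt_nonneg
          _ = 40 * ℓ * ∑ n ∈ r₁, vonMangoldt n := by rw [Finset.mul_sum]
          _ ≤ _ := by
              refine mul_le_mul_of_nonneg_left ?_ (by positivity)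
              exact (Finset.sum_le_sum_of_subset_of_nonneg hr₁N fun _ _ _ =>
                ArithmeticFunction.vonMangoldt_nonneg).trans (sum_vonMangoldt_le N)
      refine (mul_le_mul_of_nonneg_left h2 (by positivity)).trans ?_
      have h3 : (V:ℝ) ^ 8 * ℓ ≤ N := by
        calc (V:ℝ) ^ 8 * ℓ ≤ V ^ 8 * V := mul_le_mul_of_nonneg_left hℓV (by positivity)
          _ = V ^ 9 := by ring
          _ ≤ V ^ 20 := pow_le_pow_right₀ hV1 (by norm_num)
          _ ≤ N := hVN'
      have h4 : (2 * N / ℓ + 2 * (V:ℝ) ^ 4 * (V:ℝ) ^ 4) * (40 * ℓ * (6 * N)) =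
          480 * (N:ℝ) ^ 2 + 480 * N * (V ^ 8 * ℓ) := by
        field_simp
        ring
      rw [h4]
      nlinarith [mul_le_mul_of_nonneg_left h3 (by linarith : (0:ℝ) ≤ N)]
  have hrest : ∑ n ∈ r₂, vonMangoldt n ≤ 6 * V + 80 * √N * ℓ := by
    have hsub : r₂ ⊆ Ioc 0 V ∪ (Ioc 0 N).filter (fun n => ¬ n.Prime) := by
      intro n hn
      obtain ⟨hn, h⟩ := mem_filter.1 hn
      have hn' := hr hn
      rw [mem_union, mem_filter]
      by_cases hp : n.Prime
      · left
        rw [mem_Ioc] at hn' ⊢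
        exact ⟨hn'.1, by by_contra! h'; exact h ⟨hp, h'⟩⟩
      · right; exact ⟨hn', hp⟩
    refine (Finset.sum_le_sum_of_subset_of_nonneg hsub fun _ _ _ =>
      ArithmeticFunction.vonMangoldt_nonneg).trans ?_
    refine le_trans (le_of_le_of_eq (le_add_of_nonneg_right ?_) (Finset.sum_union_inter)) ?_
    · exact Finset.sum_nonneg fun _ _ => ArithmeticFunction.vonMangoldt_nonneg
    have h1 := sum_vonMangoldt_le V
    have h2 := sum_vonMangoldt_not_prime_le (N := N) (by exact_mod_cast hN1)
    have h3 := mul_le_mul_of_nonneg_left hlogN (by positivity : 0 ≤ 2 * √(N:ℝ))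
    linarith
  have hrest2 : ∑ χ ∈ primChars V, ‖∑ n ∈ r₂, (vonMangoldt n : ℂ) * χ.2 n‖ ^ 2 ≤ 20000 * (N:ℝ) ^ 2 := by
    have h : ∀ χ ∈ primChars V, ‖∑ n ∈ r₂, (vonMangoldt n : ℂ) * χ.2 n‖ ^ 2 ≤
        (6 * V + 80 * √N * ℓ) ^ 2 := fun χ _ =>
      pow_le_pow_left₀ (norm_nonneg _) ((norm_sum_vonMangoldt_char_le χ.2 r₂).trans hrest) 2
    refine (Finset.sum_le_card_nsmul _ _ _ h).trans ?_
    rw [nsmul_eq_mul]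
    refine (mul_le_mul_of_nonneg_right (card_primChars_le V) (sq_nonneg _)).trans ?_
    have hs : √(N:ℝ) ^ 2 = N := Real.sq_sqrt (by linarith)
    have h1 : (6 * V + 80 * √N * ℓ) ^ 2 ≤ 72 * (V:ℝ) ^ 2 + 12800 * (N * ℓ ^ 2) := by
      have : (80 * √N * ℓ) ^ 2 = 6400 * (N * ℓ ^ 2) := by rw [mul_pow, mul_pow, hs]; ring
      nlinarith [sq_nonneg (6 * V - 80 * √N * ℓ)]
    have h2 : ℓ ^ 2 ≤ (V:ℝ) ^ 2 := pow_le_pow_left₀ hℓ0.le hℓV 2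
    have h3 : (V:ℝ) ^ 4 ≤ N := (pow_le_pow_right₀ hV1 (by norm_num)).trans hVN'
    calc (V:ℝ) ^ 2 * (6 * V + 80 * √N * ℓ) ^ 2
        ≤ (V:ℝ) ^ 2 * (72 * (V:ℝ) ^ 2 + 12800 * (N * V ^ 2)) := by gcongr; exact h1.trans (by gcongr)
      _ = 72 * (V:ℝ) ^ 4 * 1 + 12800 * V ^ 4 * N := by ring
      _ ≤ 72 * N * N + 12800 * N * N := by gcongr
      _ ≤ _ := by nlinarith
  calc ∑ χ ∈ primChars V, ‖∑ n ∈ r, (vonMangoldt n : ℂ) * χ.2 n‖ ^ 2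
      ≤ ∑ χ ∈ primChars V, (2 * ‖∑ n ∈ r₁, (vonMangoldt n : ℂ) * χ.2 n‖ ^ 2 +
          2 * ‖∑ n ∈ r₂, (vonMangoldt n : ℂ) * χ.2 n‖ ^ 2) := by
        refine Finset.sum_le_sum fun χ _ => ?_
        rw [← Finset.sum_filter_add_sum_filter_not r (fun n => n.Prime ∧ V < n)]
        refine (pow_le_pow_left₀ (norm_nonneg _) (norm_add_le _ _) 2).trans ?_
        nlinarith [sq_nonneg (‖∑ n ∈ r₁, (vonMangoldt n : ℂ) * χ.2 n‖ -
          ‖∑ n ∈ r₂, (vonMangoldt n : ℂ) * χ.2 n‖)]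
    _ = 2 * ∑ χ ∈ primChars V, ‖∑ n ∈ r₁, (vonMangoldt n : ℂ) * χ.2 n‖ ^ 2 +
          2 * ∑ χ ∈ primChars V, ‖∑ n ∈ r₂, (vonMangoldt n : ℂ) * χ.2 n‖ ^ 2 := by
        rw [Finset.sum_add_distrib, Finset.mul_sum, Finset.mul_sum]
    _ ≤ _ := by nlinarith [sq_nonneg (N:ℝ)]

theorem primChars_mono {D E : ℕ} (h : D ≤ E) : primChars D ⊆ primChars E := by
  intro χ hχ
  rw [mem_primChars] at hχ ⊢
  exact ⟨hχ.1.trans h, hχ.2⟩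

/-- A large sieve inequality for the von Mangoldt function without logarithmic loss, for
characters of small modulus. -/
theorem log_free_large_sieve {D N : ℕ} (hDN : D ^ 20 ≤ N) {r : Finset ℕ} (hr : r ⊆ Ioc 0 N) :
    ∑ χ ∈ primChars D, ‖∑ n ∈ r, (vonMangoldt n : ℂ) * χ.2 n‖ ^ 2 ≤ 100000 * (N:ℝ) ^ 2 := by
  obtain ⟨V, hVN, hDV, hVN2⟩ : ∃ V, V ^ 20 ≤ N ∧ D ≤ V ∧ N ≤ (V + 1) ^ 20 := by
    refine ⟨Nat.findGreatest (fun v => v ^ 20 ≤ N) N,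
      Nat.findGreatest_spec (P := fun v => v ^ 20 ≤ N) (Nat.zero_le N) (by simp),
      Nat.le_findGreatest ((Nat.le_self_pow (by norm_num) D).trans hDN) hDN, ?_⟩
    by_contra! h
    have := Nat.le_findGreatest (P := fun v => v ^ 20 ≤ N)
      ((Nat.le_self_pow (by norm_num) _).trans h.le) h.le
    omega
  by_cases h2 : 2 ≤ V
  · refine le_trans (Finset.sum_le_sum_of_subset_of_nonneg (primChars_mono hDV) fun _ _ _ =>
      sq_nonneg _) (log_free_large_sieve_aux h2 hVN ?_ hr)
    have h3 : V + 1 ≤ V ^ 2 := by nlinarith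
    calc N ≤ (V + 1) ^ 20 := hVN2
      _ ≤ (V ^ 2) ^ 20 := Nat.pow_le_pow_left h3 20
      _ = V ^ 40 := (pow_mul V 2 20).symm
  · refine (sum_primChars_norm_sq_le_trivial D N hr).trans ?_
    clear hDN hVN hVN2
    have hD1 : D ≤ 1 := Nat.lt_succ_iff.1 (lt_of_le_of_lt hDV (not_le.1 h2))
    have : (D:ℝ) ≤ 1 := by exact_mod_cast hD1
    have h1 : (D:ℝ) ^ 2 ≤ 1 := pow_le_one₀ (Nat.cast_nonneg D) this
    nlinarith [sq_nonneg (N:ℝ)]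

end TwinSieve

namespace TwinSieve
open Finset MeasureTheory
open Real (posLog)

/-- Bilinear sums with a logarithmic weight. -/
noncomputable def bil (s r : Finset ℕ) (F G : ℕ → ℂ) (x : ℝ) : ℂ :=
  ∑ a ∈ s, ∑ b ∈ r, F a * G b * (posLog (x / (a * b)) : ℂ)

theorem bil_split_left (s r : Finset ℕ) (F G : ℕ → ℂ) (x : ℝ) (p : ℕ → Prop) [DecidablePred p] :
    bil s r F G x = bil (s.filter p) r F G x + bil (s.filter fun a => ¬ p a) r F G x :=
  (Finset.sum_filter_add_sum_filter_not s p _).symm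

theorem bil_split_right (s r : Finset ℕ) (F G : ℕ → ℂ) (x : ℝ) (p : ℕ → Prop) [DecidablePred p] :
    bil s r F G x = bil s (r.filter p) F G x + bil s (r.filter fun a => ¬ p a) F G x := by
  unfold bil
  rw [← Finset.sum_add_distrib]
  exact Finset.sum_congr rfl fun a _ => (Finset.sum_filter_add_sum_filter_not r p _).symm

theorem bil_comm (s r : Finset ℕ) (F G : ℕ → ℂ) (x : ℝ) : bil s r F G x = bil r s G F x := by
  unfold bil
  rw [Finset.sum_comm]
  refine Finset.sum_congr rfl fun a _ => Finset.sum_congr rfl fun b _ => ?_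
  rw [mul_comm (F b), mul_comm (a : ℝ)]

theorem bil_eq (s r : Finset ℕ) (F G : ℕ → ℂ) (x : ℝ) :
    bil s r F G x = ∑ a ∈ s, F a * ∑ b ∈ r, G b * (posLog (x / a / b) : ℂ) := by
  unfold bil
  refine Finset.sum_congr rfl fun a _ => ?_
  rw [Finset.mul_sum]
  refine Finset.sum_congr rfl fun b _ => ?_
  rw [div_div]; ring

theorem rieszSum_mul_char (f g : ArithmeticFunction ℝ) {q : ℕ} (χ : DirichletCharacter ℂ q)
    {x : ℝ} (hx : 0 ≤ x) :
    rieszSum (fun n => ((f * g) n : ℂ) * χ n) x =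
      bil (Ioc 0 ⌊x⌋₊) (Ioc 0 ⌊x⌋₊) (fun a => (f a : ℂ) * χ a) (fun b => (g b : ℂ) * χ b) x := by
  set N := ⌊x⌋₊
  have h1 : ∀ n ∈ Ioc 0 N, ((f * g) n : ℂ) * χ n * (posLog (x / n) : ℂ) =
      ∑ p ∈ Ioc 0 N ×ˢ Ioc 0 N with p.1 * p.2 = n,
        (f p.1 : ℂ) * χ p.1 * ((g p.2 : ℂ) * χ p.2) * (posLog (x / (p.1 * p.2)) : ℂ) := by
    intro n hn
    rw [mem_Ioc] at hn
    rw [ArithmeticFunction.mul_apply, Nat.divisorsAntidiagonal_eq_prod_filter_of_le hn.1.ne' hn.2]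
    push_cast
    rw [Finset.sum_mul, Finset.sum_mul]
    refine Finset.sum_congr rfl fun p hp => ?_
    rw [← (mem_filter.1 hp).2]
    push_cast
    rw [map_mul]
    ring
  rw [rieszSum, Finset.sum_congr rfl h1, bil, ← Finset.sum_product']
  rw [Finset.sum_fiberwise_eq_sum_filter]
  refine Finset.sum_filter_of_ne fun p hp hne => ?_
  rw [mem_product, mem_Ioc, mem_Ioc] at hp
  rw [mem_Ioc]
  refine ⟨Nat.mul_pos hp.1.1 hp.2.1, ?_⟩
  by_contra! h
  apply hne
  have : posLog (x / (p.1 * p.2)) = 0 := by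
    have h2 := posLog_div_eq_zero hx (n := p.1 * p.2) (Nat.lt_of_floor_lt h).le
    rwa [Nat.cast_mul] at h2
  rw [this]; simp

section Abel
variable {ι : Type*}

theorem sum_Ioc_mul_sub_succ (c : ℕ → ℂ) (w : ℕ → ℝ) (N : ℕ) :
    (∑ n ∈ Ioc 0 (N + 1), c n * w n) - (∑ n ∈ Ioc 0 (N + 1), c n) * w (N + 1) =
      ((∑ n ∈ Ioc 0 N, c n * w n) - (∑ n ∈ Ioc 0 N, c n) * w N) +
        (∑ n ∈ Ioc 0 N, c n) * ((w N - w (N + 1) : ℝ) : ℂ) := by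
  rw [Finset.sum_Ioc_succ_top (Nat.zero_le N), Finset.sum_Ioc_succ_top (Nat.zero_le N)]
  push_cast
  ring

/-- Partial summation against a nonincreasing weight, averaged over a finite family. -/
theorem sum_norm_sum_mul_antitone_le (s : Finset ι) (c : ι → ℕ → ℂ) (w : ℕ → ℝ) {K : ℝ}
    (hw : ∀ n, 0 < n → w (n + 1) ≤ w n) (hw0 : ∀ n, 0 ≤ w n) (N : ℕ)
    (h : ∀ M ≤ N, ∑ i ∈ s, ‖∑ n ∈ Ioc 0 M, c i n‖ ≤ K * M) :
    ∑ i ∈ s, ‖∑ n ∈ Ioc 0 N, c i n * w n‖ ≤ K * ∑ n ∈ Ioc 0 N, w n := by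
  have key : ∀ M ≤ N, ∑ i ∈ s, ‖(∑ n ∈ Ioc 0 M, c i n * w n) - (∑ n ∈ Ioc 0 M, c i n) * w M‖ ≤
      K * (∑ n ∈ Ioc 0 M, w n - M * w M) := by
    intro M
    induction M with
    | zero => simp
    | succ M ih =>
      intro hM
      have hM' : M ≤ N := by omega
      have hstep : ∑ i ∈ s, ‖(∑ n ∈ Ioc 0 M, c i n) * ((w M - w (M + 1) : ℝ) : ℂ)‖ ≤
          K * (M * (w M - w (M + 1))) := by
        rcases Nat.eq_zero_or_pos M with rfl | h0
        · simp
        · simp_rw [norm_mul]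
          rw [← Finset.sum_mul, ← mul_assoc, Complex.norm_real,
            Real.norm_of_nonneg (sub_nonneg.2 (hw M h0))]
          exact mul_le_mul_of_nonneg_right (h M hM') (sub_nonneg.2 (hw M h0))
      calc _ ≤ ∑ i ∈ s, (‖(∑ n ∈ Ioc 0 M, c i n * w n) - (∑ n ∈ Ioc 0 M, c i n) * w M‖ +
            ‖(∑ n ∈ Ioc 0 M, c i n) * ((w M - w (M + 1) : ℝ) : ℂ)‖) := by
            refine Finset.sum_le_sum fun i _ => ?_
            rw [sum_Ioc_mul_sub_succ]
            exact norm_add_le _ _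
        _ ≤ K * (∑ n ∈ Ioc 0 M, w n - M * w M) + K * (M * (w M - w (M + 1))) := by
            rw [Finset.sum_add_distrib]
            exact add_le_add (ih hM') hstep
        _ = _ := by
            rw [Finset.sum_Ioc_succ_top (Nat.zero_le M)]
            push_cast
            ring
  have h2 : ∑ i ∈ s, ‖(∑ n ∈ Ioc 0 N, c i n) * w N‖ ≤ K * (N * w N) := by
    simp_rw [norm_mul]
    rw [← Finset.sum_mul, ← mul_assoc, Complex.norm_real, Real.norm_of_nonneg (hw0 N)]
    exact mul_le_mul_of_nonneg_right (h N le_rfl) (hw0 N)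
  calc _ ≤ ∑ i ∈ s, (‖(∑ n ∈ Ioc 0 N, c i n * w n) - (∑ n ∈ Ioc 0 N, c i n) * w N‖ +
        ‖(∑ n ∈ Ioc 0 N, c i n) * w N‖) := by
        refine Finset.sum_le_sum fun i _ => ?_
        have := norm_add_le ((∑ n ∈ Ioc 0 N, c i n * w n) - (∑ n ∈ Ioc 0 N, c i n) * w N)
          ((∑ n ∈ Ioc 0 N, c i n) * w N)
        rwa [sub_add_cancel] at this
    _ ≤ _ := by
        rw [Finset.sum_add_distrib]
        refine (add_le_add (key N le_rfl) h2).trans (le_of_eq ?_)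
        ring

theorem norm_sum_mul_antitone_le (c : ℕ → ℂ) (w : ℕ → ℝ) {B W : ℝ} (hB : 0 ≤ B)
    (hw : ∀ n, 0 < n → w (n + 1) ≤ w n) (hw0 : ∀ n, 0 ≤ w n) (hW : ∀ n, 0 < n → w n ≤ W)
    (hW0 : 0 ≤ W) (N : ℕ)
    (h : ∀ M ≤ N, ‖∑ n ∈ Ioc 0 M, c n‖ ≤ B) : ‖∑ n ∈ Ioc 0 N, c n * w n‖ ≤ B * W := by
  have key : ∀ M ≤ N, 0 < M → ‖(∑ n ∈ Ioc 0 M, c n * w n) - (∑ n ∈ Ioc 0 M, c n) * w M‖ ≤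
      B * (W - w M) := by
    intro M hM h0
    induction M, h0 using Nat.le_induction with
    | base =>
      simp only [Nat.Ioc_succ_singleton, zero_add, sum_singleton, sub_self, norm_zero]
      exact mul_nonneg hB (sub_nonneg.2 (hW 1 one_pos))
    | succ M h0 ih =>
      rw [sum_Ioc_mul_sub_succ]
      refine (norm_add_le _ _).trans ((add_le_add (ih (by omega)) (d := B * (w M - w (M + 1))) ?_).trans
        (le_of_eq (by ring)))
      rw [norm_mul, Complex.norm_real, Real.norm_of_nonneg (sub_nonneg.2 (hw M h0))]
      exact mul_le_mul_of_nonneg_right (h M (by omega)) (sub_nonneg.2 (hw M h0))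
  rcases Nat.eq_zero_or_pos N with rfl | h0
  · simpa using mul_nonneg hB hW0
  · have h1 := norm_add_le ((∑ n ∈ Ioc 0 N, c n * w n) - (∑ n ∈ Ioc 0 N, c n) * w N)
      ((∑ n ∈ Ioc 0 N, c n) * w N)
    rw [sub_add_cancel, norm_mul _ (w N : ℂ), Complex.norm_real, Real.norm_of_nonneg (hw0 N)] at h1
    have h2 := key N le_rfl h0
    have h3 := mul_le_mul_of_nonneg_right (h N le_rfl) (hw0 N)
    linarith

theorem norm_sum_mul_monotone_le (c : ℕ → ℂ) (w : ℕ → ℝ) {B : ℝ}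
    (hw : ∀ n, w n ≤ w (n + 1)) (hw0 : ∀ n, 0 ≤ w n) (N : ℕ) (hB : 0 ≤ B)
    (h : ∀ M ≤ N, ‖∑ n ∈ Ioc 0 M, c n‖ ≤ B) : ‖∑ n ∈ Ioc 0 N, c n * w n‖ ≤ 2 * B * w N := by
  have key : ∀ M ≤ N, ‖(∑ n ∈ Ioc 0 M, c n * w n) - (∑ n ∈ Ioc 0 M, c n) * w M‖ ≤ B * w M := by
    intro M
    induction M with
    | zero => intro _; simpa using mul_nonneg hB (hw0 0)
    | succ M ih =>
      intro hM
      rw [sum_Ioc_mul_sub_succ]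
      refine (norm_add_le _ _).trans ((add_le_add (ih (by omega)) (d := B * (w (M + 1) - w M)) ?_).trans
        (le_of_eq (by ring)))
      rw [norm_mul, Complex.norm_real, Real.norm_eq_abs, abs_sub_comm,
        abs_of_nonneg (sub_nonneg.2 (hw M))]
      exact mul_le_mul_of_nonneg_right (h M (by omega)) (sub_nonneg.2 (hw M))
  have h1 := norm_add_le ((∑ n ∈ Ioc 0 N, c n * w n) - (∑ n ∈ Ioc 0 N, c n) * w N)
    ((∑ n ∈ Ioc 0 N, c n) * w N)
  rw [sub_add_cancel, norm_mul _ (w N : ℂ), Complex.norm_real, Real.norm_of_nonneg (hw0 N)] at h1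
  have h2 := key N le_rfl
  have h3 := mul_le_mul_of_nonneg_right (h N le_rfl) (hw0 N)
  linarith

end Abel

theorem posLog_div_succ_le {x : ℝ} (hx : 0 ≤ x) (n : ℕ) (hn : 0 < n) :
    posLog (x / ((n + 1 : ℕ) : ℝ)) ≤ posLog (x / n) := by
  have hn' : (0:ℝ) < n := by exact_mod_cast hn
  refine Real.monotoneOn_posLog (Set.mem_Ici.2 (by positivity)) (Set.mem_Ici.2 (by positivity)) ?_
  exact div_le_div_of_nonneg_left hx hn' (by exact_mod_cast Nat.le_succ n)

theorem posLog_div_le {x : ℝ} (hx : 1 ≤ x) (n : ℕ) : posLog (x / n) ≤ Real.log x := by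
  rcases Nat.eq_zero_or_pos n with rfl | hn
  · simpa using Real.log_nonneg hx
  · rw [← Real.posLog_eq_log (by rw [abs_of_nonneg (by linarith)]; exact hx)]
    have hn' : (1:ℝ) ≤ n := by exact_mod_cast hn
    refine Real.monotoneOn_posLog (Set.mem_Ici.2 (by positivity)) (Set.mem_Ici.2 (by positivity)) ?_
    exact div_le_self (by linarith) hn'

theorem posLog_sq_le {u : ℝ} (hu : 0 ≤ u) : posLog u ^ 2 ≤ 16 * √u := by
  rcases le_total u 1 with h | h
  · rw [Real.posLog_eq_zero_iff u |>.2 (by rwa [abs_of_nonneg hu])]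
    simp
  · rw [Real.posLog_eq_log (by rwa [abs_of_nonneg hu])]
    have h1 : Real.log u = 4 * Real.log (√(√u)) := by
      rw [Real.log_sqrt (by positivity), Real.log_sqrt (by positivity)]; ring
    have h2 : Real.log (√(√u)) ≤ √(√u) := (Real.log_le_sub_one_of_pos (by positivity)).trans (by linarith)
    have h3 : 0 ≤ Real.log (√(√u)) := by
      have := Real.log_nonneg h
      linarith
    rw [h1, mul_pow]
    have h4 := pow_le_pow_left₀ h3 h2 2
    rw [Real.sq_sqrt (by positivity)] at h4
    linarith

theorem posLog_le_sqrt {u : ℝ} (hu : 0 ≤ u) : posLog u ≤ 2 * √u := by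
  rcases le_total u 1 with h | h
  · rw [Real.posLog_eq_zero_iff u |>.2 (by rwa [abs_of_nonneg hu])]
    positivity
  · rw [Real.posLog_eq_log (by rwa [abs_of_nonneg hu])]
    have h1 : Real.log u = 2 * Real.log (√u) := by
      rw [Real.log_sqrt (by positivity)]; ring
    have h2 : Real.log (√u) ≤ √u := (Real.log_le_sub_one_of_pos (by positivity)).trans (by linarith)
    linarith

theorem sum_sqrt_div_le {y : ℝ} (hy : 0 ≤ y) (N : ℕ) (hN : N ≤ ⌊y⌋₊) :
    ∑ n ∈ Ioc 0 N, √(y / n) ≤ 2 * y := by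
  have h : ∀ N : ℕ, ∑ n ∈ Ioc 0 N, 1 / √(n : ℝ) ≤ 2 * √N := by
    intro N
    induction N with
    | zero => simp
    | succ N ih =>
      rw [Finset.sum_Ioc_succ_top (Nat.zero_le N)]
      refine (add_le_add_left ih _).trans ?_
      have h1 : √(N:ℝ) ^ 2 = N := Real.sq_sqrt (by positivity)
      have h2 : √((N + 1 : ℕ):ℝ) ^ 2 = N + 1 := by rw [Real.sq_sqrt (by positivity)]; push_cast; ring
      have h3 : 0 < √((N + 1 : ℕ):ℝ) := Real.sqrt_pos.2 (by positivity)
      rw [← sub_nonneg]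
      have : 2 * √((N + 1 : ℕ):ℝ) - (2 * √N + 1 / √((N + 1 : ℕ):ℝ)) =
          (√((N + 1 : ℕ):ℝ) - √(N:ℝ)) ^ 2 / √((N + 1 : ℕ):ℝ) := by
        field_simp
        nlinarith
      rw [this]
      positivity
  simp_rw [Real.sqrt_div hy]
  have h2 : ∑ n ∈ Ioc 0 N, √y / √(n:ℝ) = √y * ∑ n ∈ Ioc 0 N, 1 / √(n : ℝ) := by
    rw [Finset.mul_sum]
    exact Finset.sum_congr rfl fun n _ => by rw [mul_one_div]
  rw [h2]
  have h3 : √(N:ℝ) ≤ √y := Real.sqrt_le_sqrt ((Nat.cast_le.2 hN).trans (Nat.floor_le hy))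
  calc √y * ∑ n ∈ Ioc 0 N, 1 / √(n : ℝ) ≤ √y * (2 * √y) :=
        mul_le_mul_of_nonneg_left ((h N).trans (by linarith)) (Real.sqrt_nonneg _)
    _ = 2 * (√y * √y) := by ring
    _ = 2 * y := by rw [Real.mul_self_sqrt hy]

theorem sum_posLog_pow_le {y : ℝ} (hy : 0 ≤ y) (N : ℕ) {g : ℝ → ℝ} {C : ℝ} (hC : 0 ≤ C)
    (hg0 : ∀ n : ℕ, y ≤ n → g (y / n) = 0) (hg : ∀ u, 0 ≤ u → g u ≤ C * √u) :
    ∑ n ∈ Ioc 0 N, g (y / n) ≤ 2 * C * y := by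
  have h1 : ∑ n ∈ Ioc 0 N, g (y / n) ≤ ∑ n ∈ Ioc 0 (min N ⌊y⌋₊), g (y / n) := by
    refine le_of_eq (Finset.sum_subset ?_ ?_).symm
    · intro n hn
      rw [mem_Ioc] at hn ⊢
      exact ⟨hn.1, hn.2.trans (min_le_left _ _)⟩
    · intro n hn hn'
      rw [mem_Ioc] at hn hn'
      have : ⌊y⌋₊ < n := by
        by_contra! h
        exact hn' ⟨hn.1, le_min hn.2 h⟩
      exact hg0 n (Nat.lt_of_floor_lt this).le
  refine h1.trans ((Finset.sum_le_sum fun (n : ℕ) _ => hg (y / n) (div_nonneg hy (Nat.cast_nonneg n))).trans ?_)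
  rw [← Finset.mul_sum]
  have := mul_le_mul_of_nonneg_left (sum_sqrt_div_le hy _ (min_le_right N ⌊y⌋₊)) hC
  linarith

theorem sum_posLog_sq_le {y : ℝ} (hy : 0 ≤ y) (N : ℕ) :
    ∑ n ∈ Ioc 0 N, posLog (y / n) ^ 2 ≤ 32 * y :=
  (sum_posLog_pow_le (g := fun u => posLog u ^ 2) hy N (by norm_num : (0:ℝ) ≤ 16)
    (fun n hn => by simp only [posLog_div_eq_zero hy hn]; norm_num)
    (fun u hu => posLog_sq_le hu)).trans (by linarith)

theorem sum_posLog_le {y : ℝ} (hy : 0 ≤ y) (N : ℕ) : ∑ n ∈ Ioc 0 N, posLog (y / n) ≤ 4 * y :=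
  (sum_posLog_pow_le (g := posLog) hy N (by norm_num : (0:ℝ) ≤ 2)
    (fun n hn => posLog_div_eq_zero hy hn) (fun u hu => posLog_le_sqrt hu)).trans (by linarith)

/-- Bilinear sums over a family, by separation of variables and Cauchy–Schwarz. -/
theorem sum_norm_bil_le {ι : Type*} (X : Finset ι) {s r : Finset ℕ} (hs : ∀ a ∈ s, 0 < a)
    (hr : ∀ b ∈ r, 0 < b) (F G : ι → ℕ → ℂ) {x : ℝ} (hx : 1 ≤ x) {M : ℝ} (hM : 0 ≤ M)
    (h : ∀ t, 1 ≤ t → t ≤ x →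
      (∑ i ∈ X, ‖∑ a ∈ s.filter (fun a : ℕ => (a:ℝ) ≤ x / t), F i a‖ ^ 2) *
        (∑ i ∈ X, ‖∑ b ∈ r.filter (fun b : ℕ => (b:ℝ) ≤ t), G i b‖ ^ 2) ≤ M ^ 2) :
    ∑ i ∈ X, ‖bil s r (F i) (G i) x‖ ≤ M * Real.log x := by
  have hI := fun i => sum_mul_posLog_eq_integral s r (F i) (G i) (fun a => (a:ℝ)) (fun b => (b:ℝ))
    (fun a ha => by exact_mod_cast hs a ha) (fun b hb => by exact_mod_cast hr b hb) hx
  set Φ : ι → ℝ → ℂ := fun i t => (∑ a ∈ s.filter (fun a : ℕ => (a:ℝ) ≤ x / t), F i a) *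
        (∑ b ∈ r.filter (fun b : ℕ => (b:ℝ) ≤ t), G i b) * ((t⁻¹ : ℝ) : ℂ) with hΦ
  have h1 : ∀ i, ‖bil s r (F i) (G i) x‖ ≤ ∫ t in (1:ℝ)..x, ‖Φ i t‖ := by
    intro i
    rw [bil, (hI i).2]
    exact intervalIntegral.norm_integral_le_integral_norm hx
  have hint : ∀ i ∈ X, IntervalIntegrable (fun t => ‖Φ i t‖) volume 1 x := fun i _ => (hI i).1.norm
  calc ∑ i ∈ X, ‖bil s r (F i) (G i) x‖ ≤ ∑ i ∈ X, ∫ t in (1:ℝ)..x, ‖Φ i t‖ :=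
        Finset.sum_le_sum fun i _ => h1 i
    _ = ∫ t in (1:ℝ)..x, ∑ i ∈ X, ‖Φ i t‖ := (intervalIntegral.integral_finsetSum hint).symm
    _ ≤ ∫ t in (1:ℝ)..x, M * t⁻¹ := by
        refine intervalIntegral.integral_mono_on hx ?_ ?_ ?_
        · have := IntervalIntegrable.sum X hint
          rwa [Finset.sum_fn] at this
        · refine ContinuousOn.intervalIntegrable ?_
          rw [Set.uIcc_of_le hx]
          refine continuousOn_const.mul (continuousOn_inv₀.mono ?_)
          intro t ht
          exact (by linarith [ht.1] : (0:ℝ) < t).ne'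
        · intro t ht
          have ht0 : 0 < t := by linarith [ht.1]
          simp only [hΦ, norm_mul, Complex.norm_real, Real.norm_of_nonneg (inv_nonneg.2 ht0.le)]
          rw [← Finset.sum_mul]
          refine mul_le_mul_of_nonneg_right ?_ (inv_nonneg.2 ht0.le)
          refine abs_le_of_sq_le_sq' ?_ hM |>.2
          exact (Finset.sum_mul_sq_le_sq_mul_sq X _ _).trans (h t ht.1 ht.2)
    _ = M * Real.log x := by
        rw [intervalIntegral.integral_const_mul, integral_inv_of_pos one_pos (by linarith), div_one]

end TwinSieve

namespace TwinSieve
open Finset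
open Real (posLog)
open scoped ArithmeticFunction.Moebius ArithmeticFunction.vonMangoldt ArithmeticFunction.zeta

theorem pmul_log_mul (f g : ArithmeticFunction ℝ) :
    ArithmeticFunction.pmul ArithmeticFunction.log (f * g) =
      ArithmeticFunction.pmul ArithmeticFunction.log f * g +
        f * ArithmeticFunction.pmul ArithmeticFunction.log g := by
  ext n
  simp only [ArithmeticFunction.pmul_apply, ArithmeticFunction.mul_apply,
    ArithmeticFunction.add_apply, ArithmeticFunction.log_apply]
  rw [Finset.mul_sum, ← Finset.sum_add_distrib]
  refine Finset.sum_congr rfl fun p hp => ?_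
  rw [Nat.mem_divisorsAntidiagonal] at hp
  have h1 : p.1 ≠ 0 := left_ne_zero_of_mul (hp.1 ▸ hp.2)
  have h2 : p.2 ≠ 0 := right_ne_zero_of_mul (hp.1 ▸ hp.2)
  rw [← hp.1, Nat.cast_mul, Real.log_mul (by exact_mod_cast h1) (by exact_mod_cast h2)]
  ring

/-- Selberg's identity. -/
theorem selberg_identity :
    ArithmeticFunction.pmul ArithmeticFunction.log Λ + Λ * Λ =
      (μ : ArithmeticFunction ℝ) *
        ArithmeticFunction.pmul ArithmeticFunction.log ArithmeticFunction.log := by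
  have h0 : ArithmeticFunction.pmul ArithmeticFunction.log (ζ : ArithmeticFunction ℝ) =
      ArithmeticFunction.log := by
    ext n
    simp
  have h1 : ArithmeticFunction.pmul ArithmeticFunction.log ArithmeticFunction.log =
      (ζ : ArithmeticFunction ℝ) *
        (ArithmeticFunction.pmul ArithmeticFunction.log Λ + Λ * Λ) := by
    conv_lhs => rw [← ArithmeticFunction.vonMangoldt_mul_zeta]
    rw [ArithmeticFunction.vonMangoldt_mul_zeta]
    conv_lhs => arg 2; rw [← ArithmeticFunction.vonMangoldt_mul_zeta]
    rw [pmul_log_mul, h0]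
    conv_lhs => arg 2; rw [← ArithmeticFunction.vonMangoldt_mul_zeta]
    ring
  rw [h1, ← mul_assoc, ArithmeticFunction.coe_moebius_mul_coe_zeta, one_mul]

theorem log_mul_rieszSum {q : ℕ} (χ : DirichletCharacter ℂ q) {x : ℝ} (hx : 1 ≤ x) :
    (Real.log x : ℂ) * rieszSum (fun n => (Λ n : ℂ) * χ n) x =
      bil (Ioc 0 ⌊x⌋₊) (Ioc 0 ⌊x⌋₊) (fun a => ((μ a : ℝ) : ℂ) * χ a)
          (fun b => ((Real.log b ^ 2 : ℝ) : ℂ) * χ b) x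
        - bil (Ioc 0 ⌊x⌋₊) (Ioc 0 ⌊x⌋₊) (fun a => (Λ a : ℂ) * χ a) (fun b => (Λ b : ℂ) * χ b) x
        + ∑ n ∈ Ioc 0 ⌊x⌋₊, (Λ n : ℂ) * χ n * ((posLog (x / n) ^ 2 : ℝ) : ℂ) := by
  have hx0 : 0 ≤ x := by linarith
  have h1 := rieszSum_mul_char (μ : ArithmeticFunction ℝ)
    (ArithmeticFunction.pmul ArithmeticFunction.log ArithmeticFunction.log) χ hx0
  have h2 := rieszSum_mul_char Λ Λ χ hx0
  rw [← selberg_identity] at h1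
  have h3 : bil (Ioc 0 ⌊x⌋₊) (Ioc 0 ⌊x⌋₊) (fun a => ((μ a : ℝ) : ℂ) * χ a)
          (fun b => ((Real.log b ^ 2 : ℝ) : ℂ) * χ b) x =
        bil (Ioc 0 ⌊x⌋₊) (Ioc 0 ⌊x⌋₊) (fun a => (((μ : ArithmeticFunction ℝ) a : ℝ) : ℂ) * χ a)
          (fun b => ((ArithmeticFunction.pmul ArithmeticFunction.log ArithmeticFunction.log b
            : ℝ) : ℂ) * χ b) x := by
    simp [ArithmeticFunction.pmul_apply, sq]
  rw [h3, ← h1, ← h2]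
  unfold rieszSum
  rw [Finset.mul_sum, ← Finset.sum_sub_distrib, ← Finset.sum_add_distrib]
  refine Finset.sum_congr rfl fun n hn => ?_
  rw [mem_Ioc] at hn
  have hn0 : (0:ℝ) < n := by exact_mod_cast hn.1
  have hnx : (n:ℝ) ≤ x := (Nat.le_floor_iff hx0).1 hn.2
  have h4 : Real.log x = Real.log n + posLog (x / n) := by
    rw [Real.posLog_eq_log (by rw [abs_of_nonneg (by positivity)]; exact (one_le_div hn0).2 hnx),
      Real.log_div (by linarith) hn0.ne']
    ring
  rw [h4]
  simp only [ArithmeticFunction.add_apply, ArithmeticFunction.pmul_apply,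
    ArithmeticFunction.log_apply]
  push_cast
  ring

section Family
variable {D : ℕ} {X : Finset CharIdx}

theorem sum_norm_le_of_sum_sq_le (hX : X ⊆ primChars D) (v : CharIdx → ℂ) {K : ℝ} (hK : 0 ≤ K)
    (h : ∑ χ ∈ X, ‖v χ‖ ^ 2 ≤ K ^ 2) : ∑ χ ∈ X, ‖v χ‖ ≤ D * K := by
  have h1 : ((X.card : ℕ) : ℝ) ≤ (D:ℝ) ^ 2 :=
    (Nat.cast_le.2 (Finset.card_le_card hX)).trans (card_primChars_le D)
  refine abs_le_of_sq_le_sq' ?_ (by positivity) |>.2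
  calc (∑ χ ∈ X, ‖v χ‖) ^ 2 ≤ X.card * ∑ χ ∈ X, ‖v χ‖ ^ 2 := sq_sum_le_card_mul_sum_sq
    _ ≤ (D:ℝ) ^ 2 * K ^ 2 := mul_le_mul h1 h (Finset.sum_nonneg fun _ _ => by positivity)
        (by positivity)
    _ = (D * K) ^ 2 := by ring

theorem sum_norm_le_of_forall (hX : X ⊆ primChars D) (v : CharIdx → ℂ) {K : ℝ} (hK : 0 ≤ K)
    (h : ∀ χ ∈ X, ‖v χ‖ ≤ K) : ∑ χ ∈ X, ‖v χ‖ ≤ D ^ 2 * K := by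
  have h1 : ((X.card : ℕ) : ℝ) ≤ (D:ℝ) ^ 2 :=
    (Nat.cast_le.2 (Finset.card_le_card hX)).trans (card_primChars_le D)
  calc _ ≤ X.card • K := Finset.sum_le_card_nsmul _ _ _ h
    _ = X.card * K := nsmul_eq_mul _ _
    _ ≤ _ := mul_le_mul_of_nonneg_right h1 hK

theorem sum_norm_sq_vonMangoldt_le (hX : X ⊆ primChars D) {z N : ℕ} (hz : D ^ 20 ≤ z)
    {t : ℝ} (ht : 0 ≤ t) :
    ∑ χ ∈ X, ‖∑ n ∈ (Ioc z N).filter (fun n : ℕ => (n:ℝ) ≤ t), (Λ n : ℂ) * χ.2 n‖ ^ 2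
      ≤ 100000 * t ^ 2 := by
  rcases lt_or_ge t z with h | h
  · have : (Ioc z N).filter (fun n : ℕ => (n:ℝ) ≤ t) = ∅ := by
      rw [Finset.filter_eq_empty_iff]
      intro n hn hnt
      rw [mem_Ioc] at hn
      have : (z:ℝ) < n := by exact_mod_cast hn.1
      linarith
    rw [this]
    simp only [sum_empty, norm_zero]
    simp; positivity
  · have h1 : z ≤ ⌊t⌋₊ := Nat.le_floor h
    refine (Finset.sum_le_sum_of_subset_of_nonneg hX fun _ _ _ => by positivity).trans
      ((log_free_large_sieve (N := ⌊t⌋₊) (hz.trans h1) ?_).trans ?_)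
    · intro n hn
      rw [mem_filter, mem_Ioc] at hn
      rw [mem_Ioc]
      exact ⟨by omega, Nat.le_floor hn.2⟩
    · have := Nat.floor_le ht
      gcongr

theorem sum_norm_vonMangoldt_le (hX : X ⊆ primChars D) {z N M : ℕ} (hz : D ^ 20 ≤ z) (hM : M ≤ N) :
    ∑ χ ∈ X, ‖∑ n ∈ Ioc 0 M, (if z < n then (Λ n : ℂ) * χ.2 n else 0)‖ ≤ 317 * D * M := by
  have h1 : ∀ χ : CharIdx, ∑ n ∈ Ioc 0 M, (if z < n then (Λ n : ℂ) * χ.2 n else 0) =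
      ∑ n ∈ (Ioc z N).filter (fun n : ℕ => (n:ℝ) ≤ M), (Λ n : ℂ) * χ.2 n := by
    intro χ
    rw [← Finset.sum_filter]
    refine Finset.sum_congr ?_ fun _ _ => rfl
    ext n
    simp only [mem_filter, mem_Ioc, Nat.cast_le]
    omega
  simp_rw [h1]
  have h2 := sum_norm_sq_vonMangoldt_le hX (N := N) hz (Nat.cast_nonneg (α := ℝ) M)
  have h3 := sum_norm_le_of_sum_sq_le hX _ (K := 317 * M) (by positivity)
    (h2.trans (by nlinarith [sq_nonneg (M:ℝ)]))
  linarith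

end Family

theorem sum_one_div_Ioc_le (z : ℕ) : ∑ n ∈ Ioc 0 z, 1 / (n:ℝ) ≤ 1 + Real.log z := by
  have := harmonic_le_one_add_log z
  rw [harmonic_eq_sum_Icc] at this
  push_cast at this
  refine le_trans (le_of_eq ?_) this
  exact Finset.sum_congr (by ext; simp [Nat.lt_iff_add_one_le]) fun n _ => one_div _

end TwinSieve

namespace TwinSieve
open Finset
open Real (posLog)
open scoped ArithmeticFunction.Moebius ArithmeticFunction.vonMangoldt ArithmeticFunction.zeta

section Family
variable {D : ℕ} {X : Finset CharIdx}

theorem sum_norm_vonMangoldt_mul_le (hX : X ⊆ primChars D) {z : ℕ} (N : ℕ) (hz : D ^ 20 ≤ z)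
    (w : ℕ → ℝ) (hw : ∀ n, 0 < n → w (n + 1) ≤ w n) (hw0 : ∀ n, 0 ≤ w n) :
    ∑ χ ∈ X, ‖∑ n ∈ Ioc z N, (Λ n : ℂ) * χ.2 n * w n‖ ≤ 317 * D * ∑ n ∈ Ioc 0 N, w n := by
  refine le_trans (le_of_eq (Finset.sum_congr rfl fun χ _ => ?_))
    (sum_norm_sum_mul_antitone_le X (fun χ n => if z < n then (Λ n : ℂ) * χ.2 n else 0) w
      (K := 317 * D) hw hw0 N fun M hM => sum_norm_vonMangoldt_le hX hz hM)
  congr 1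
  simp_rw [ite_mul, zero_mul]
  rw [← Finset.sum_filter]
  refine Finset.sum_congr ?_ fun _ _ => rfl
  ext n
  simp only [mem_filter, mem_Ioc]
  omega

theorem norm_sum_vonMangoldt_mul_le {q : ℕ} (χ : DirichletCharacter ℂ q) (z : ℕ) (w : ℕ → ℝ)
    {W : ℝ} (hw0 : ∀ n, 0 ≤ w n) (hw : ∀ n, w n ≤ W) :
    ‖∑ n ∈ Ioc 0 z, (Λ n : ℂ) * χ n * w n‖ ≤ 6 * z * W := by
  have hW : 0 ≤ W := (hw0 0).trans (hw 0)
  calc _ ≤ ∑ n ∈ Ioc 0 z, Λ n * W := by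
        refine (norm_sum_le _ _).trans (Finset.sum_le_sum fun n _ => ?_)
        rw [norm_mul, norm_mul, Complex.norm_real, Complex.norm_real, Real.norm_of_nonneg (hw0 n),
          Real.norm_of_nonneg ArithmeticFunction.vonMangoldt_nonneg]
        refine mul_le_mul ?_ (hw n) (hw0 n) ArithmeticFunction.vonMangoldt_nonneg
        exact mul_le_of_le_one_right ArithmeticFunction.vonMangoldt_nonneg (χ.norm_le_one _)
    _ = (∑ n ∈ Ioc 0 z, Λ n) * W := (Finset.sum_mul _ _ _).symm
    _ ≤ _ := mul_le_mul_of_nonneg_right (sum_vonMangoldt_le z) hW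

theorem sum_norm_posLog_sq_le (hX : X ⊆ primChars D) {z N : ℕ} (hz : D ^ 20 ≤ z) (hzN : z ≤ N)
    {x : ℝ} (hx : 1 ≤ x) :
    ∑ χ ∈ X, ‖∑ n ∈ Ioc 0 N, (Λ n : ℂ) * χ.2 n * ((posLog (x / n) ^ 2 : ℝ) : ℂ)‖
      ≤ D ^ 2 * (6 * z * Real.log x ^ 2) + 317 * D * (32 * x) := by
  have hx0 : 0 ≤ x := by linarith
  have h1 : ∀ χ : CharIdx, ∑ n ∈ Ioc 0 N, (Λ n : ℂ) * χ.2 n * ((posLog (x / n) ^ 2 : ℝ) : ℂ) =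
      ∑ n ∈ Ioc 0 z, (Λ n : ℂ) * χ.2 n * ((posLog (x / n) ^ 2 : ℝ) : ℂ) +
      ∑ n ∈ Ioc z N, (Λ n : ℂ) * χ.2 n * ((posLog (x / n) ^ 2 : ℝ) : ℂ) := fun χ =>
    (Finset.sum_Ioc_consecutive _ (Nat.zero_le z) hzN).symm
  simp_rw [h1]
  refine (Finset.sum_le_sum fun χ _ => norm_add_le _ _).trans ?_
  rw [Finset.sum_add_distrib]
  refine add_le_add ?_ ?_
  · refine sum_norm_le_of_forall hX _ (by positivity) fun χ _ => ?_
    refine norm_sum_vonMangoldt_mul_le χ.2 z (fun n => posLog (x / n) ^ 2)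
      (fun n => by positivity) fun n => ?_
    exact pow_le_pow_left₀ Real.posLog_nonneg (posLog_div_le hx n) 2
  · refine (sum_norm_vonMangoldt_mul_le hX N hz (fun n => posLog (x / n) ^ 2) ?_ ?_).trans ?_
    · intro n hn
      exact pow_le_pow_left₀ Real.posLog_nonneg (posLog_div_succ_le hx0 n hn) 2
    · intro n; positivity
    · exact mul_le_mul_of_nonneg_left (sum_posLog_sq_le hx0 N) (by positivity)

theorem sum_vonMangoldt_div_le (z : ℕ) :
    ∑ n ∈ Ioc 0 z, Λ n / n ≤ Real.log z * (1 + Real.log z) := by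
  rcases Nat.eq_zero_or_pos z with rfl | hz
  · simp
  refine le_trans ?_ (mul_le_mul_of_nonneg_left (sum_one_div_Ioc_le z)
    (Real.log_nonneg (by exact_mod_cast hz)))
  rw [Finset.mul_sum]
  refine Finset.sum_le_sum fun n hn => ?_
  rw [mem_Ioc] at hn
  rw [mul_one_div]
  refine div_le_div_of_nonneg_right ?_ (by positivity)
  exact ArithmeticFunction.vonMangoldt_le_log.trans
    (Real.log_le_log (by exact_mod_cast hn.1) (by exact_mod_cast hn.2))

theorem sum_norm_bil_vonMangoldt_mixed_le (hX : X ⊆ primChars D) {z : ℕ} (N : ℕ) (hz : D ^ 20 ≤ z)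
    {x : ℝ} (hx : 0 ≤ x) :
    ∑ χ ∈ X, ‖bil (Ioc 0 z) (Ioc z N) (fun a => (Λ a : ℂ) * χ.2 a) (fun b => (Λ b : ℂ) * χ.2 b) x‖
      ≤ 317 * D * (4 * x) * (Real.log z * (1 + Real.log z)) := by
  simp_rw [bil_eq]
  calc _ ≤ ∑ χ ∈ X, ∑ a ∈ Ioc 0 z,
        Λ a * ‖∑ n ∈ Ioc z N, (Λ n : ℂ) * χ.2 n * (posLog (x / a / n) : ℂ)‖ := by
        refine Finset.sum_le_sum fun χ _ => (norm_sum_le _ _).trans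
          (Finset.sum_le_sum fun a _ => ?_)
        rw [norm_mul, norm_mul, Complex.norm_real,
          Real.norm_of_nonneg ArithmeticFunction.vonMangoldt_nonneg]
        refine mul_le_mul_of_nonneg_right ?_ (norm_nonneg _)
        exact mul_le_of_le_one_right ArithmeticFunction.vonMangoldt_nonneg (χ.2.norm_le_one _)
    _ = ∑ a ∈ Ioc 0 z, Λ a * ∑ χ ∈ X,
          ‖∑ n ∈ Ioc z N, (Λ n : ℂ) * χ.2 n * (posLog (x / a / n) : ℂ)‖ := by
        rw [Finset.sum_comm]
        exact Finset.sum_congr rfl fun a _ => (Finset.mul_sum _ _ _).symm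
    _ ≤ ∑ a ∈ Ioc 0 z, Λ a * (317 * D * (4 * (x / a))) := by
        refine Finset.sum_le_sum fun a _ =>
          mul_le_mul_of_nonneg_left ?_ ArithmeticFunction.vonMangoldt_nonneg
        have hxa : 0 ≤ x / a := by positivity
        refine (sum_norm_vonMangoldt_mul_le hX N hz (fun n => posLog (x / a / n))
          (fun n hn => posLog_div_succ_le hxa n hn) (fun n => Real.posLog_nonneg)).trans ?_
        exact mul_le_mul_of_nonneg_left (sum_posLog_le hxa N) (by positivity)
    _ = 317 * D * (4 * x) * ∑ a ∈ Ioc 0 z, Λ a / a := by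
        rw [Finset.mul_sum]
        exact Finset.sum_congr rfl fun a _ => by ring
    _ ≤ _ := mul_le_mul_of_nonneg_left (sum_vonMangoldt_div_le z) (by positivity)

theorem sum_norm_bil_vonMangoldt_large_le (hX : X ⊆ primChars D) {z : ℕ} (N : ℕ) (hz : D ^ 20 ≤ z)
    {x : ℝ} (hx : 1 ≤ x) :
    ∑ χ ∈ X, ‖bil (Ioc z N) (Ioc z N) (fun a => (Λ a : ℂ) * χ.2 a) (fun b => (Λ b : ℂ) * χ.2 b) x‖
      ≤ 100000 * x * Real.log x := by
  refine sum_norm_bil_le X (fun a ha => (Nat.zero_le z).trans_lt (mem_Ioc.1 ha).1)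
    (fun a ha => (Nat.zero_le z).trans_lt (mem_Ioc.1 ha).1) _ _ hx (by positivity) fun t h1 h2 => ?_
  have ht : 0 < t := by linarith
  have hxt : 0 ≤ x / t := by positivity
  refine (mul_le_mul (sum_norm_sq_vonMangoldt_le hX hz hxt) (sum_norm_sq_vonMangoldt_le hX hz ht.le)
    (Finset.sum_nonneg fun _ _ => by positivity) (by positivity)).trans (le_of_eq ?_)
  field_simp

theorem sum_norm_bil_vonMangoldt_small_le (hX : X ⊆ primChars D) (z : ℕ) {x : ℝ} (hx : 1 ≤ x) :
    ∑ χ ∈ X, ‖bil (Ioc 0 z) (Ioc 0 z) (fun a => (Λ a : ℂ) * χ.2 a) (fun b => (Λ b : ℂ) * χ.2 b) x‖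
      ≤ D ^ 2 * (36 * z ^ 2 * Real.log x) := by
  have hL := Real.log_nonneg hx
  refine sum_norm_le_of_forall hX _ (by positivity) fun χ _ => ?_
  rw [bil_eq]
  calc _ ≤ ∑ a ∈ Ioc 0 z, Λ a * (6 * z * Real.log x) := by
        refine (norm_sum_le _ _).trans (Finset.sum_le_sum fun a _ => ?_)
        rw [norm_mul, norm_mul, Complex.norm_real,
          Real.norm_of_nonneg ArithmeticFunction.vonMangoldt_nonneg]
        refine mul_le_mul ?_ ?_ (norm_nonneg _) ArithmeticFunction.vonMangoldt_nonneg
        · exact mul_le_of_le_one_right ArithmeticFunction.vonMangoldt_nonneg (χ.2.norm_le_one _)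
        · refine norm_sum_vonMangoldt_mul_le χ.2 z (fun n => posLog (x / a / n))
            (fun n => Real.posLog_nonneg) fun n => ?_
          have := posLog_div_le hx (a * n)
          rwa [Nat.cast_mul, ← div_div] at this
    _ = (∑ a ∈ Ioc 0 z, Λ a) * (6 * z * Real.log x) := (Finset.sum_mul _ _ _).symm
    _ ≤ (6 * z) * (6 * z * Real.log x) :=
        mul_le_mul_of_nonneg_right (sum_vonMangoldt_le z) (by positivity)
    _ = _ := by ring

end Family

end TwinSieve

namespace TwinSieve
open Finset
open Real (posLog)
open scoped ArithmeticFunction.Moebius ArithmeticFunction.vonMangoldt ArithmeticFunction.zeta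

theorem log_cast_succ_le (n : ℕ) : Real.log n ≤ Real.log ((n + 1 : ℕ) : ℝ) := by
  rcases Nat.eq_zero_or_pos n with rfl | h
  · simp
  · exact Real.log_le_log (by exact_mod_cast h) (by exact_mod_cast Nat.le_succ n)

theorem log_cast_le_log {x : ℝ} (hx : 1 ≤ x) {n : ℕ} (h : n ≤ ⌊x⌋₊) : Real.log n ≤ Real.log x := by
  rcases Nat.eq_zero_or_pos n with rfl | h0
  · simpa using Real.log_nonneg hx
  · exact Real.log_le_log (by exact_mod_cast h0) ((Nat.le_floor_iff (by linarith)).1 h)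

theorem norm_sum_char_log_sq_posLog_le {q : ℕ} [NeZero q] {χ : DirichletCharacter ℂ q}
    (hχ : χ ≠ 1) {x : ℝ} (hx : 1 ≤ x) (d : ℕ) :
    ‖∑ m ∈ Ioc 0 ⌊x⌋₊, ((Real.log m ^ 2 : ℝ) : ℂ) * χ m * (posLog (x / d / m) : ℂ)‖
      ≤ 2 * q * Real.log x ^ 3 := by
  have hL := Real.log_nonneg hx
  have hxd : 0 ≤ x / d := by positivity
  have h1 : ∀ M ≤ ⌊x⌋₊, ‖∑ m ∈ Ioc 0 M, ((Real.log m ^ 2 : ℝ) : ℂ) * χ m‖ ≤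
      2 * q * Real.log x ^ 2 := by
    intro M hM
    have h2 := norm_sum_mul_monotone_le (fun n => χ n) (fun n => Real.log n ^ 2) (B := q)
      (fun n => pow_le_pow_left₀ (Real.log_natCast_nonneg n) (log_cast_succ_le n) 2)
      (fun n => sq_nonneg _) M (Nat.cast_nonneg q) fun K _ => norm_sum_Ioc_char_le hχ K
    refine le_trans (le_of_eq ?_) (h2.trans ?_)
    · congr 1
      exact Finset.sum_congr rfl fun n _ => mul_comm _ _
    · refine mul_le_mul_of_nonneg_left ?_ (by positivity)
      exact pow_le_pow_left₀ (Real.log_natCast_nonneg M) (log_cast_le_log hx hM) 2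
  have h3 := norm_sum_mul_antitone_le (fun m => ((Real.log m ^ 2 : ℝ) : ℂ) * χ m)
    (fun m => posLog (x / d / m)) (B := 2 * q * Real.log x ^ 2) (W := Real.log x) (by positivity)
    (fun n hn => posLog_div_succ_le hxd n hn) (fun n => Real.posLog_nonneg)
    (fun n _ => by
      have := posLog_div_le hx (d * n)
      rwa [Nat.cast_mul, ← div_div] at this) hL ⌊x⌋₊ h1
  exact h3.trans (le_of_eq (by ring))

theorem norm_moebius_mul_char_le {q : ℕ} (χ : DirichletCharacter ℂ q) (n : ℕ) :
    ‖((μ n : ℝ) : ℂ) * χ n‖ ≤ 1 := by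
  rw [norm_mul, Complex.norm_real, Real.norm_eq_abs]
  refine mul_le_one₀ ?_ (norm_nonneg _) (χ.norm_le_one _)
  exact_mod_cast ArithmeticFunction.abs_moebius_le_one

section Family
variable {D : ℕ} {X : Finset CharIdx}

theorem sum_norm_bil_moebius_small_le (hX : X ⊆ primChars D) (hX1 : ∀ χ ∈ X, χ.2 ≠ 1) (Y : ℕ)
    {x : ℝ} (hx : 1 ≤ x) :
    ∑ χ ∈ X, ‖bil ((Ioc 0 ⌊x⌋₊).filter (fun a => a ≤ Y)) (Ioc 0 ⌊x⌋₊)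
      (fun a => ((μ a : ℝ) : ℂ) * χ.2 a) (fun b => ((Real.log b ^ 2 : ℝ) : ℂ) * χ.2 b) x‖
      ≤ 2 * D ^ 3 * Real.log x ^ 3 * Y := by
  have hL := Real.log_nonneg hx
  refine (sum_norm_le_of_forall hX _ (K := Y * (2 * D * Real.log x ^ 3)) (by positivity)
    fun χ hχ => ?_).trans (le_of_eq (by ring))
  rw [bil_eq]
  have hq : ((χ.1 + 1 : ℕ) : ℝ) ≤ D := by exact_mod_cast (mem_primChars.1 (hX hχ)).1
  have hcard : ((((Ioc 0 ⌊x⌋₊).filter (fun a => a ≤ Y)).card : ℕ) : ℝ) ≤ Y := by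
    refine Nat.cast_le.2 ((Finset.card_le_card (t := Ioc 0 Y) fun a ha => ?_).trans (by simp))
    rw [mem_filter, mem_Ioc] at ha
    exact mem_Ioc.2 ⟨ha.1.1, ha.2⟩
  refine (norm_sum_le_of_le _ (f := _) (n := fun _ => 2 * D * Real.log x ^ 3) fun a _ => ?_).trans ?_
  · rw [norm_mul]
    refine (mul_le_of_le_one_left (norm_nonneg _) (norm_moebius_mul_char_le χ.2 a)).trans ?_
    refine (norm_sum_char_log_sq_posLog_le (hX1 χ hχ) hx a).trans ?_
    gcongr
  · rw [Finset.sum_const, nsmul_eq_mul]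
    exact mul_le_mul_of_nonneg_right hcard (by positivity)

theorem sum_norm_moebius_posLog_le {C : ℝ} (hC : 0 ≤ C)
    (hLS : ∀ (D N : ℕ) (b : ℕ → ℂ), ∑ χ ∈ primChars D, ‖∑ n ∈ Ioc 0 N, b n * χ.2 n‖ ^ 2 ≤
      C * (N + (D:ℝ) ^ 2) * ∑ n ∈ Ioc 0 N, ‖b n‖ ^ 2)
    (hX : X ⊆ primChars D) {y : ℝ} (hy : (D:ℝ) ^ 2 ≤ y) (s : Finset ℕ) (hs : ∀ n ∈ s, 0 < n) :
    ∑ χ ∈ X, ‖∑ n ∈ s, ((μ n : ℝ) : ℂ) * χ.2 n * (posLog (y / n) : ℂ)‖ ≤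
      D * ((1 + 64 * C) * y) := by
  have hy0 : 0 ≤ y := (sq_nonneg _).trans hy
  set b : ℕ → ℂ := fun n => if n ∈ s then ((μ n : ℝ) : ℂ) * (posLog (y / n) : ℂ) else 0 with hb
  have h1 : ∀ χ : CharIdx, ∑ n ∈ s, ((μ n : ℝ) : ℂ) * χ.2 n * (posLog (y / n) : ℂ) =
      ∑ n ∈ Ioc 0 ⌊y⌋₊, b n * χ.2 n := by
    intro χ
    simp only [hb, ite_mul, zero_mul]
    rw [← Finset.sum_filter]
    refine (Finset.sum_subset_zero_on_sdiff (fun n hn => (mem_filter.1 hn).2) ?_ ?_).symm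
    · intro n hn
      rw [mem_sdiff, mem_filter, mem_Ioc] at hn
      have h2 : ⌊y⌋₊ < n := by
        by_contra! h
        exact hn.2 ⟨⟨hs n hn.1, h⟩, hn.1⟩
      rw [posLog_div_eq_zero hy0 (Nat.lt_of_floor_lt h2).le]
      simp
    · intro n _; ring
  simp_rw [h1]
  refine sum_norm_le_of_sum_sq_le hX _ (by positivity) ?_
  have hNy : (⌊y⌋₊ : ℝ) ≤ y := Nat.floor_le hy0
  have h3 : ∑ n ∈ Ioc 0 ⌊y⌋₊, ‖b n‖ ^ 2 ≤ 32 * y := by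
    refine (Finset.sum_le_sum fun n _ => ?_).trans (sum_posLog_sq_le hy0 ⌊y⌋₊)
    simp only [hb]
    split_ifs
    · refine pow_le_pow_left₀ (norm_nonneg _) ?_ 2
      rw [norm_mul, Complex.norm_real, Complex.norm_real, Real.norm_of_nonneg Real.posLog_nonneg]
      refine mul_le_of_le_one_left Real.posLog_nonneg ?_
      rw [Real.norm_eq_abs]
      exact_mod_cast ArithmeticFunction.abs_moebius_le_one
    · simp; positivity
  calc _ ≤ ∑ χ ∈ primChars D, ‖∑ n ∈ Ioc 0 ⌊y⌋₊, b n * χ.2 n‖ ^ 2 :=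
        Finset.sum_le_sum_of_subset_of_nonneg hX fun _ _ _ => by positivity
    _ ≤ C * (⌊y⌋₊ + (D:ℝ) ^ 2) * ∑ n ∈ Ioc 0 ⌊y⌋₊, ‖b n‖ ^ 2 := hLS D _ b
    _ ≤ C * (y + y) * (32 * y) := by gcongr
    _ ≤ ((1 + 64 * C) * y) ^ 2 := by
        have : 0 ≤ (1 + 64 * C + 64 ^ 2 * C ^ 2) * y ^ 2 := by positivity
        nlinarith

theorem sum_norm_bil_moebius_large_le {C : ℝ} (hC : 0 ≤ C)
    (hLS : ∀ (D N : ℕ) (b : ℕ → ℂ), ∑ χ ∈ primChars D, ‖∑ n ∈ Ioc 0 N, b n * χ.2 n‖ ^ 2 ≤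
      C * (N + (D:ℝ) ^ 2) * ∑ n ∈ Ioc 0 N, ‖b n‖ ^ 2)
    (hX : X ⊆ primChars D) {z : ℕ} (hz : 0 < z) {x : ℝ} (hx : 0 ≤ x) (hD : (D:ℝ) ^ 2 * z ≤ x) :
    ∑ χ ∈ X, ‖bil ((Ioc 0 ⌊x⌋₊).filter (fun a => ¬ a ≤ ⌊x / z⌋₊)) (Ioc 0 ⌊x⌋₊)
      (fun a => ((μ a : ℝ) : ℂ) * χ.2 a) (fun b => ((Real.log b ^ 2 : ℝ) : ℂ) * χ.2 b) x‖
      ≤ D * ((1 + 64 * C) * x) * (Real.log z ^ 2 * (1 + Real.log z)) := by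
  have hz0 : (0:ℝ) < z := by exact_mod_cast hz
  set s := (Ioc 0 ⌊x⌋₊).filter (fun a => ¬ a ≤ ⌊x / z⌋₊) with hs
  have h1 : ∀ (F G : ℕ → ℂ), bil s (Ioc 0 ⌊x⌋₊) F G x =
      bil ((Ioc 0 ⌊x⌋₊).filter (fun b => b ≤ z)) s G F x := by
    intro F G
    rw [bil_split_right s _ F G x (fun b => b ≤ z), bil_comm s (filter _ _)]
    refine add_eq_left.2 (Finset.sum_eq_zero fun a ha => Finset.sum_eq_zero fun b hb => ?_)
    rw [hs, mem_filter, mem_Ioc, not_le] at ha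
    rw [mem_filter, not_le] at hb
    have h2 : x / z < a := Nat.lt_of_floor_lt ha.2
    rw [div_lt_iff₀ hz0] at h2
    have h3 : (z:ℝ) ≤ b := by exact_mod_cast hb.2.le
    have h4 : x ≤ ((a * b : ℕ) : ℝ) := by
      push_cast
      nlinarith [mul_le_mul_of_nonneg_left h3 (Nat.cast_nonneg (α := ℝ) a)]
    have h5 := posLog_div_eq_zero hx h4
    rw [Nat.cast_mul] at h5
    rw [h5]; simp
  simp_rw [h1, bil_eq]
  calc _ ≤ ∑ χ ∈ X, ∑ m ∈ (Ioc 0 ⌊x⌋₊).filter (fun b => b ≤ z),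
        Real.log z ^ 2 * ‖∑ n ∈ s, ((μ n : ℝ) : ℂ) * χ.2 n * (posLog (x / m / n) : ℂ)‖ := by
        refine Finset.sum_le_sum fun χ _ => (norm_sum_le _ _).trans
          (Finset.sum_le_sum fun a ha => ?_)
        rw [mem_filter, mem_Ioc] at ha
        rw [norm_mul, norm_mul, Complex.norm_real, Real.norm_of_nonneg (sq_nonneg _)]
        refine mul_le_mul_of_nonneg_right ?_ (norm_nonneg _)
        refine (mul_le_of_le_one_right (sq_nonneg _) (χ.2.norm_le_one _)).trans ?_
        exact pow_le_pow_left₀ (Real.log_natCast_nonneg a)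
          (Real.log_le_log (by exact_mod_cast ha.1.1) (by exact_mod_cast ha.2)) 2
    _ = ∑ m ∈ (Ioc 0 ⌊x⌋₊).filter (fun b => b ≤ z), Real.log z ^ 2 * ∑ χ ∈ X,
          ‖∑ n ∈ s, ((μ n : ℝ) : ℂ) * χ.2 n * (posLog (x / m / n) : ℂ)‖ := by
        rw [Finset.sum_comm]
        exact Finset.sum_congr rfl fun a _ => (Finset.mul_sum _ _ _).symm
    _ ≤ ∑ m ∈ (Ioc 0 ⌊x⌋₊).filter (fun b => b ≤ z),
          Real.log z ^ 2 * (D * ((1 + 64 * C) * (x / m))) := by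
        refine Finset.sum_le_sum fun m hm => mul_le_mul_of_nonneg_left ?_ (sq_nonneg _)
        rw [mem_filter, mem_Ioc] at hm
        refine sum_norm_moebius_posLog_le hC hLS hX ?_ s fun n hn => ?_
        · have hm0 : (0:ℝ) < m := by exact_mod_cast hm.1.1
          have hmz : (m:ℝ) ≤ z := by exact_mod_cast hm.2
          rw [le_div_iff₀ hm0]
          exact (mul_le_mul_of_nonneg_left hmz (by positivity)).trans hD
        · rw [hs, mem_filter, mem_Ioc] at hn
          exact hn.1.1
    _ ≤ ∑ m ∈ Ioc 0 z, Real.log z ^ 2 * (D * ((1 + 64 * C) * (x / m))) := by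
        refine Finset.sum_le_sum_of_subset_of_nonneg ?_ fun _ _ _ => by positivity
        intro m hm
        rw [mem_filter, mem_Ioc] at hm
        exact mem_Ioc.2 ⟨hm.1.1, hm.2⟩
    _ = D * ((1 + 64 * C) * x) * Real.log z ^ 2 * ∑ m ∈ Ioc 0 z, 1 / (m:ℝ) := by
        rw [Finset.mul_sum]
        exact Finset.sum_congr rfl fun a _ => by ring
    _ ≤ D * ((1 + 64 * C) * x) * Real.log z ^ 2 * (1 + Real.log z) :=
        mul_le_mul_of_nonneg_left (sum_one_div_Ioc_le z) (by positivity)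
    _ = _ := by ring

end Family

end TwinSieve

namespace TwinSieve
open Finset
open Real (posLog)
open scoped ArithmeticFunction.Moebius ArithmeticFunction.vonMangoldt ArithmeticFunction.zeta

/-- Primitive characters of conductor in `(1, D]`. -/
noncomputable def ntChars (D : ℕ) : Finset CharIdx := (primChars D).filter fun χ => χ.1 ≠ 0

theorem mem_ntChars {D : ℕ} {χ : CharIdx} :
    χ ∈ ntChars D ↔ (χ.1 + 1 ≤ D ∧ χ.2.IsPrimitive) ∧ χ.1 ≠ 0 := by
  rw [ntChars, mem_filter, mem_primChars]

theorem ntChars_subset (D : ℕ) : ntChars D ⊆ primChars D := Finset.filter_subset _ _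

theorem ne_one_of_mem_ntChars {D : ℕ} {χ : CharIdx} (h : χ ∈ ntChars D) : χ.2 ≠ 1 := by
  intro h1
  have h2 := conductor_one_of_eq_one (mem_ntChars.1 h).1.2 h1
  exact (mem_ntChars.1 h).2 (by omega)

/-- Riesz sums of `Λ χ`. -/
noncomputable def rieszPsi (x : ℝ) (χ : CharIdx) : ℂ :=
  rieszSum (fun n => (Λ n : ℂ) * χ.2 n) x

theorem norm_log_mul_rieszPsi_le (χ : CharIdx) {z : ℕ} {x : ℝ} (hx : 1 ≤ x) (hzN : z ≤ ⌊x⌋₊) (Y : ℕ) :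
    Real.log x * ‖rieszPsi x χ‖ ≤
      ‖bil ((Ioc 0 ⌊x⌋₊).filter (fun a => a ≤ Y)) (Ioc 0 ⌊x⌋₊)
        (fun a => ((μ a : ℝ) : ℂ) * χ.2 a) (fun b => ((Real.log b ^ 2 : ℝ) : ℂ) * χ.2 b) x‖ +
      ‖bil ((Ioc 0 ⌊x⌋₊).filter (fun a => ¬ a ≤ Y)) (Ioc 0 ⌊x⌋₊)
        (fun a => ((μ a : ℝ) : ℂ) * χ.2 a) (fun b => ((Real.log b ^ 2 : ℝ) : ℂ) * χ.2 b) x‖ +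
      ‖bil (Ioc 0 z) (Ioc 0 z) (fun a => (Λ a : ℂ) * χ.2 a) (fun b => (Λ b : ℂ) * χ.2 b) x‖ +
      2 * ‖bil (Ioc 0 z) (Ioc z ⌊x⌋₊) (fun a => (Λ a : ℂ) * χ.2 a) (fun b => (Λ b : ℂ) * χ.2 b) x‖ +
      ‖bil (Ioc z ⌊x⌋₊) (Ioc z ⌊x⌋₊) (fun a => (Λ a : ℂ) * χ.2 a) (fun b => (Λ b : ℂ) * χ.2 b) x‖ +
      ‖∑ n ∈ Ioc 0 ⌊x⌋₊, (Λ n : ℂ) * χ.2 n * ((posLog (x / n) ^ 2 : ℝ) : ℂ)‖ := by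
  have h1 := log_mul_rieszSum χ.2 hx
  rw [bil_split_left _ _ _ _ x (fun a => a ≤ Y)] at h1
  have e1 : (Ioc 0 ⌊x⌋₊).filter (fun a => a ≤ z) = Ioc 0 z := by
    ext n; simp only [mem_filter, mem_Ioc]; omega
  have e2 : (Ioc 0 ⌊x⌋₊).filter (fun a => ¬ a ≤ z) = Ioc z ⌊x⌋₊ := by
    ext n; simp only [mem_filter, mem_Ioc]; omega
  rw [bil_split_left _ _ (fun a => (Λ a : ℂ) * χ.2 a) _ x (fun a => a ≤ z), e1, e2,
    bil_split_right (Ioc 0 z) _ _ _ x (fun a => a ≤ z),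
    bil_split_right (Ioc z _) _ _ _ x (fun a => a ≤ z), e1, e2,
    bil_comm (Ioc z _) (Ioc 0 z)] at h1
  have h2 : Real.log x * ‖rieszPsi x χ‖ = ‖(Real.log x : ℂ) * rieszPsi x χ‖ := by
    rw [norm_mul, Complex.norm_real, Real.norm_of_nonneg (Real.log_nonneg hx)]
  rw [h2, rieszPsi, h1]
  generalize bil _ _ _ _ x = a
  generalize bil _ _ _ _ x = b
  generalize bil _ _ _ _ x = c
  generalize bil _ _ _ _ x = d
  generalize bil _ _ _ _ x = e
  generalize (∑ n ∈ Ioc 0 ⌊x⌋₊, (Λ n : ℂ) * χ.2 n * ((posLog (x / n) ^ 2 : ℝ) : ℂ)) = f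
  have k1 := norm_add_le (a + b - (c + d + (d + e))) f
  have k2 := norm_sub_le (a + b) (c + d + (d + e))
  have k3 := norm_add_le a b
  have k4 := norm_add_le (c + d) (d + e)
  have k5 := norm_add_le c d
  have k6 := norm_add_le d e
  linarith

theorem exists_log_mul_sum_rieszPsi_le : ∃ C : ℝ, 0 < C ∧ ∀ (D z : ℕ) (x : ℝ), 1 ≤ D →
    D ^ 20 ≤ z → (D:ℝ) ^ 3 * (1 + Real.log x) ^ 4 ≤ z → (z:ℝ) ^ 4 ≤ x →
    Real.log x * ∑ χ ∈ ntChars D, ‖rieszPsi x χ‖ ≤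
      C * x * (Real.log x + D * (1 + Real.log z) ^ 3) := by
  obtain ⟨C, hC, hLS⟩ := exists_large_sieve
  refine ⟨200000 + 64 * C, by positivity, fun D z x hD hz hDL hzx => ?_⟩
  have hz1 : 1 ≤ z := (Nat.one_le_pow _ _ hD).trans hz
  have hzr : (1:ℝ) ≤ z := by exact_mod_cast hz1
  have hDr : (1:ℝ) ≤ D := by exact_mod_cast hD
  have hx : 1 ≤ x := (one_le_pow₀ hzr).trans hzx
  have hx0 : 0 ≤ x := by linarith
  have hzx' : (z:ℝ) ≤ x := (le_self_pow₀ hzr (by norm_num)).trans hzx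
  have hzN : z ≤ ⌊x⌋₊ := Nat.le_floor hzx'
  have hX := ntChars_subset D
  have hX1 : ∀ χ ∈ ntChars D, χ.2 ≠ 1 := fun χ h => ne_one_of_mem_ntChars h
  have ha := sum_norm_bil_moebius_small_le hX hX1 ⌊x / z⌋₊ hx
  have hc := sum_norm_bil_vonMangoldt_small_le hX z hx
  have hd := sum_norm_bil_vonMangoldt_mixed_le hX ⌊x⌋₊ hz hx0
  have he := sum_norm_bil_vonMangoldt_large_le hX ⌊x⌋₊ hz hx
  have hf := sum_norm_posLog_sq_le hX hz hzN hx
  clear hz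
  set L := Real.log x with hLdef
  set l := Real.log z with hldef
  have hL : 0 ≤ L := Real.log_nonneg hx
  have hl : 0 ≤ l := Real.log_nonneg hzr
  have hDz : (D:ℝ) ^ 3 ≤ z := le_trans (le_mul_of_one_le_right (by positivity)
    (one_le_pow₀ (by linarith))) hDL
  have hD2z : (D:ℝ) ^ 2 * z ≤ x := by
    have h1 : (D:ℝ) ^ 2 ≤ D ^ 3 := pow_le_pow_right₀ hDr (by norm_num)
    calc (D:ℝ) ^ 2 * z ≤ z * z := mul_le_mul_of_nonneg_right (h1.trans hDz) (by positivity)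
      _ = (z:ℝ) ^ 2 := by ring
      _ ≤ (z:ℝ) ^ 4 := pow_le_pow_right₀ hzr (by norm_num)
      _ ≤ x := hzx
  have hb := sum_norm_bil_moebius_large_le hC.le hLS hX (z := z) (by omega) hx0 hD2z
  have hkey : ∀ i j : ℕ, i ≤ 3 → j ≤ 4 → (D:ℝ) ^ i * L ^ j ≤ z := by
    intro i j hi hj
    refine le_trans (mul_le_mul (pow_le_pow_right₀ hDr hi) ?_ (by positivity) (by positivity)) hDL
    exact (pow_le_pow_left₀ hL (by linarith) j).trans (pow_le_pow_right₀ (by linarith) hj)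
  have ba : 2 * (D:ℝ) ^ 3 * L ^ 3 * (⌊x / z⌋₊ : ℝ) ≤ 2 * x := by
    have h1 : (⌊x / z⌋₊ : ℝ) ≤ x / z := Nat.floor_le (by positivity)
    have h2 := mul_le_mul (hkey 3 3 le_rfl (by norm_num)) h1 (by positivity) (by positivity)
    rw [mul_div_cancel₀ _ (by positivity)] at h2
    linarith
  have bc : (D:ℝ) ^ 2 * (36 * z ^ 2 * L) ≤ 36 * x := by
    have h1 := hkey 2 1 (by norm_num) (by norm_num)
    rw [pow_one] at h1
    have h2 := mul_le_mul_of_nonneg_left h1 (by positivity : (0:ℝ) ≤ z ^ 2)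
    have h3 : (z:ℝ) ^ 2 * z ≤ x := le_trans (by
      rw [← pow_succ]; exact pow_le_pow_right₀ hzr (by norm_num)) hzx
    linarith
  have bf : (D:ℝ) ^ 2 * (6 * z * L ^ 2) ≤ 6 * x := by
    have h1 := hkey 2 2 (by norm_num) (by norm_num)
    have h2 := mul_le_mul_of_nonneg_left h1 (by positivity : (0:ℝ) ≤ z)
    have h3 : (z:ℝ) * z ≤ x := le_trans (by
      rw [← sq]; exact pow_le_pow_right₀ hzr (by norm_num)) hzx
    linarith
  set E := D * x * (1 + l) ^ 3 with hE
  have hDx : 0 ≤ D * x := by positivity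
  have bb : D * ((1 + 64 * C) * x) * (l ^ 2 * (1 + l)) ≤ (1 + 64 * C) * E := by
    have : l ^ 2 * (1 + l) ≤ (1 + l) ^ 3 := by nlinarith [sq_nonneg l]
    have h2 := mul_le_mul_of_nonneg_left this (by positivity : 0 ≤ (1 + 64 * C) * (D * x))
    rw [hE]; linarith
  have bd : 317 * D * (4 * x) * (l * (1 + l)) ≤ 1268 * E := by
    have : l * (1 + l) ≤ (1 + l) ^ 3 := by nlinarith [sq_nonneg l, mul_nonneg hl (sq_nonneg l)]
    have h2 := mul_le_mul_of_nonneg_left this hDx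
    rw [hE]; linarith
  have h1l : 1 ≤ (1 + l) ^ 3 := one_le_pow₀ (by linarith)
  have bE : D * x ≤ E := le_mul_of_one_le_right hDx h1l
  have bx : x ≤ D * x := le_mul_of_one_le_left hx0 hDr
  rw [← hldef] at hb
  have hsum := Finset.sum_le_sum fun χ (_ : χ ∈ ntChars D) =>
    norm_log_mul_rieszPsi_le χ hx hzN ⌊x / z⌋₊
  simp only [Finset.sum_add_distrib, ← Finset.mul_sum] at hsum
  rw [← hLdef] at hsum
  have hgoal : (200000 + 64 * C) * x * (L + D * (1 + l) ^ 3) =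
      (200000 + 64 * C) * (x * L) + (200000 + 64 * C) * E := by rw [hE]; ring
  rw [hgoal]
  have hxL : 0 ≤ x * L := by positivity
  have hCx : 0 ≤ C * (x * L) := by positivity
  linarith

end TwinSieve

namespace TwinSieve
open Finset
open Real (posLog)
open scoped ArithmeticFunction.Moebius ArithmeticFunction.vonMangoldt ArithmeticFunction.zeta

theorem sum_zeta_pow_le (k : ℕ) : ∀ N : ℕ,
    ∑ n ∈ Ioc 0 N, (((ζ : ArithmeticFunction ℝ) ^ (k + 1)) n) ≤ N * (1 + Real.log N) ^ k := by
  induction k with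
  | zero =>
    intro N
    rw [zero_add, pow_one, pow_zero, mul_one]
    refine (Finset.sum_le_card_nsmul _ _ 1 fun n hn => ?_).trans (by simp)
    have := (mem_Ioc.1 hn).1
    simp [ArithmeticFunction.natCoe_apply, ArithmeticFunction.zeta_apply, this.ne']
  | succ k ih =>
    intro N
    rw [pow_succ' _ (k + 1), ArithmeticFunction.sum_Ioc_mul_eq_sum_sum]
    calc _ ≤ ∑ n ∈ Ioc 0 N, (N * (1 + Real.log N) ^ k) * (1 / (n:ℝ)) := by
          refine Finset.sum_le_sum fun n hn => ?_
          rw [mem_Ioc] at hn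
          have h0 : ((ζ : ArithmeticFunction ℝ) n) = 1 := by
            simp [ArithmeticFunction.natCoe_apply, ArithmeticFunction.zeta_apply, hn.1.ne']
          rw [h0, one_mul]
          refine (ih (N / n)).trans ?_
          have h1 : ((N / n : ℕ) : ℝ) ≤ N / n := Nat.cast_div_le
          have h2 : Real.log ((N / n : ℕ) : ℝ) ≤ Real.log N := by
            refine Real.log_le_log ?_ (by exact_mod_cast Nat.div_le_self N n)
            exact_mod_cast Nat.div_pos hn.2 hn.1
          have h3 := Real.log_natCast_nonneg (N / n)
          calc _ ≤ (N / n : ℝ) * (1 + Real.log N) ^ k := by gcongr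
            _ = _ := by ring
      _ = (N * (1 + Real.log N) ^ k) * ∑ n ∈ Ioc 0 N, (1 / (n:ℝ)) := by rw [Finset.mul_sum]
      _ ≤ (N * (1 + Real.log N) ^ k) * (1 + Real.log N) := by
          have := Real.log_natCast_nonneg N
          exact mul_le_mul_of_nonneg_left (sum_one_div_Ioc_le N) (by positivity)
      _ = _ := by ring

theorem zeta_sq_apply (n : ℕ) : ((ζ : ArithmeticFunction ℝ) ^ 2) n = n.divisors.card := by
  rw [sq, ArithmeticFunction.coe_mul_zeta_apply]
  rw [Finset.card_eq_sum_ones, Nat.cast_sum]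
  refine Finset.sum_congr rfl fun d hd => ?_
  have := Nat.pos_of_mem_divisors hd
  simp [ArithmeticFunction.natCoe_apply, ArithmeticFunction.zeta_apply, this.ne']

theorem sum_card_divisors_sq_le (N : ℕ) :
    ∑ n ∈ Ioc 0 N, (n.divisors.card : ℝ) ^ 2 ≤ N * (1 + Real.log N) ^ 3 := by
  refine le_trans (Finset.sum_le_sum fun n _ => ?_) (sum_zeta_pow_le 3 N)
  have h1 : ((ζ : ArithmeticFunction ℝ) ^ (3 + 1)) = (ζ : ArithmeticFunction ℝ) ^ 2 *
    (ζ : ArithmeticFunction ℝ) ^ 2 := by ring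
  rw [h1, ArithmeticFunction.mul_apply]
  simp_rw [zeta_sq_apply]
  have h2 : (n.divisors.card : ℝ) ^ 2 =
      ∑ p ∈ n.divisorsAntidiagonal, ((p.1 * p.2).divisors.card : ℝ) := by
    rw [Finset.sum_congr rfl fun p hp => by rw [(Nat.mem_divisorsAntidiagonal.1 hp).1],
      Finset.sum_const, nsmul_eq_mul, sq]
    congr 2
    rw [← Nat.map_div_right_divisors, Finset.card_map]
  rw [h2]
  refine Finset.sum_le_sum fun p _ => ?_
  rw [Nat.divisors_mul]
  exact_mod_cast Finset.card_mul_le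

/-- The restriction of an arithmetic function to `n ≤ V`. -/
noncomputable def lowPart (f : ArithmeticFunction ℝ) (V : ℕ) : ArithmeticFunction ℝ :=
  ⟨fun n => if n ≤ V then f n else 0, by simp⟩

/-- The restriction of an arithmetic function to `n > V`. -/
noncomputable def highPart (f : ArithmeticFunction ℝ) (V : ℕ) : ArithmeticFunction ℝ :=
  ⟨fun n => if V < n then f n else 0, by simp⟩

theorem lowPart_apply (f : ArithmeticFunction ℝ) (V n : ℕ) :
    lowPart f V n = if n ≤ V then f n else 0 := rfl

theorem highPart_apply (f : ArithmeticFunction ℝ) (V n : ℕ) :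
    highPart f V n = if V < n then f n else 0 := rfl

theorem lowPart_add_highPart (f : ArithmeticFunction ℝ) (V : ℕ) :
    lowPart f V + highPart f V = f := by
  ext n
  rw [ArithmeticFunction.add_apply, lowPart_apply, highPart_apply]
  by_cases h : n ≤ V
  · simp [h, not_lt.2 h]
  · simp [h, not_le.1 h]

/-- Vaughan's identity. -/
theorem vaughan_identity (V : ℕ) :
    Λ = lowPart Λ V + lowPart (μ : ArithmeticFunction ℝ) V * ArithmeticFunction.log -
        lowPart Λ V * lowPart (μ : ArithmeticFunction ℝ) V * (ζ : ArithmeticFunction ℝ) +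
        highPart Λ V * ((ζ : ArithmeticFunction ℝ) * highPart (μ : ArithmeticFunction ℝ) V) := by
  have h1 := lowPart_add_highPart Λ V
  have h2 := lowPart_add_highPart (μ : ArithmeticFunction ℝ) V
  have h3 : (μ : ArithmeticFunction ℝ) * (ζ : ArithmeticFunction ℝ) = 1 :=
    ArithmeticFunction.coe_moebius_mul_coe_zeta
  have h4 : (Λ : ArithmeticFunction ℝ) * (ζ : ArithmeticFunction ℝ) = ArithmeticFunction.log :=
    ArithmeticFunction.vonMangoldt_mul_zeta
  rw [← h4]
  set a := lowPart Λ V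
  set b := highPart Λ V
  set c := lowPart (μ : ArithmeticFunction ℝ) V
  set d := highPart (μ : ArithmeticFunction ℝ) V
  rw [← h2] at h3
  rw [← h1]
  linear_combination (-b) * h3

theorem abs_moebius_real_le (n : ℕ) : |((μ : ArithmeticFunction ℝ) n)| ≤ 1 := by
  rw [ArithmeticFunction.intCoe_apply]
  exact_mod_cast ArithmeticFunction.abs_moebius_le_one

theorem abs_lowPart_moebius_le (V n : ℕ) : |lowPart (μ : ArithmeticFunction ℝ) V n| ≤ 1 := by
  rw [lowPart_apply]
  split_ifs
  · exact abs_moebius_real_le n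
  · simp

theorem abs_zeta_mul_highPart_le (V n : ℕ) :
    |((ζ : ArithmeticFunction ℝ) * highPart (μ : ArithmeticFunction ℝ) V) n| ≤ n.divisors.card := by
  rw [ArithmeticFunction.coe_zeta_mul_apply]
  refine (Finset.abs_sum_le_sum_abs _ _).trans ?_
  refine (Finset.sum_le_card_nsmul _ _ 1 fun d _ => ?_).trans (by simp)
  rw [highPart_apply]
  split_ifs
  · exact abs_moebius_real_le d
  · simp

theorem zeta_mul_highPart_eq_zero {V n : ℕ} (h : n ≤ V) :
    ((ζ : ArithmeticFunction ℝ) * highPart (μ : ArithmeticFunction ℝ) V) n = 0 := by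
  rw [ArithmeticFunction.coe_zeta_mul_apply]
  refine Finset.sum_eq_zero fun d hd => ?_
  rw [highPart_apply, if_neg (not_lt.2 ((Nat.divisor_le hd).trans h))]

theorem abs_lowPart_mul_lowPart_le (V n : ℕ) :
    |(lowPart Λ V * lowPart (μ : ArithmeticFunction ℝ) V) n| ≤ Real.log n := by
  rw [ArithmeticFunction.mul_apply]
  refine (Finset.abs_sum_le_sum_abs _ _).trans ?_
  rw [← ArithmeticFunction.vonMangoldt_sum]
  rw [← Nat.sum_divisorsAntidiagonal (fun i _ => Λ i)]
  refine Finset.sum_le_sum fun p _ => ?_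
  rw [abs_mul]
  refine (mul_le_of_le_one_right (abs_nonneg _) (abs_lowPart_moebius_le V p.2)).trans ?_
  rw [lowPart_apply]
  split_ifs
  · rw [abs_of_nonneg ArithmeticFunction.vonMangoldt_nonneg]
  · rw [abs_zero]; exact ArithmeticFunction.vonMangoldt_nonneg

theorem lowPart_mul_lowPart_eq_zero (f g : ArithmeticFunction ℝ) {V n : ℕ} (h : V * V < n) :
    (lowPart f V * lowPart g V) n = 0 := by
  rw [ArithmeticFunction.mul_apply]
  refine Finset.sum_eq_zero fun p hp => ?_
  rw [lowPart_apply, lowPart_apply]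
  by_cases h1 : p.1 ≤ V
  · by_cases h2 : p.2 ≤ V
    · have := Nat.mul_le_mul h1 h2
      rw [(Nat.mem_divisorsAntidiagonal.1 hp).1] at this
      omega
    · simp [h2]
  · simp [h1]

end TwinSieve

namespace TwinSieve
open Finset
open Real (posLog)
open scoped ArithmeticFunction.Moebius ArithmeticFunction.vonMangoldt ArithmeticFunction.zeta

theorem norm_bil_le_of_support {N Y : ℕ} {r : Finset ℕ} {F G : ℕ → ℂ} {x A B : ℝ} (hA : 0 ≤ A)
    (hB : 0 ≤ B) (hF : ∀ a ∈ Ioc 0 N, ‖F a‖ ≤ A) (hF0 : ∀ a, Y < a → F a = 0)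
    (hG : ∀ a : ℕ, ‖∑ b ∈ r, G b * (posLog (x / a / b) : ℂ)‖ ≤ B) :
    ‖bil (Ioc 0 N) r F G x‖ ≤ Y * (A * B) := by
  rw [bil_eq]
  have h1 : ∀ a ∈ Ioc 0 N, ‖F a * ∑ b ∈ r, G b * (posLog (x / a / b) : ℂ)‖ ≤
      if a ≤ Y then A * B else 0 := by
    intro a ha
    split_ifs with h
    · rw [norm_mul]
      exact mul_le_mul (hF a ha) (hG a) (norm_nonneg _) hA
    · rw [hF0 a (not_le.1 h)]; simp
  refine (norm_sum_le_of_le _ h1).trans ?_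
  rw [← Finset.sum_filter, Finset.sum_const, nsmul_eq_mul]
  refine mul_le_mul_of_nonneg_right ?_ (by positivity)
  refine Nat.cast_le.2 ((Finset.card_le_card (t := Ioc 0 Y) fun a ha => ?_).trans (by simp))
  rw [mem_filter, mem_Ioc] at ha
  exact mem_Ioc.2 ⟨ha.1.1, ha.2⟩

theorem posLog_div_div_le {x : ℝ} (hx : 1 ≤ x) (d n : ℕ) : posLog (x / d / n) ≤ Real.log x := by
  have := posLog_div_le hx (d * n)
  rwa [Nat.cast_mul, ← div_div] at this

theorem norm_sum_char_posLog_le {q : ℕ} [NeZero q] {χ : DirichletCharacter ℂ q}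
    (hχ : χ ≠ 1) {x : ℝ} (hx : 1 ≤ x) (N d : ℕ) :
    ‖∑ m ∈ Ioc 0 N, χ m * (posLog (x / d / m) : ℂ)‖ ≤ q * Real.log x :=
  norm_sum_mul_antitone_le (fun m => χ m) (fun m => posLog (x / d / m)) (Nat.cast_nonneg q)
    (fun n hn => posLog_div_succ_le (by positivity) n hn) (fun n => Real.posLog_nonneg)
    (fun n _ => posLog_div_div_le hx d n) (Real.log_nonneg hx) N
    fun M _ => norm_sum_Ioc_char_le hχ M

theorem norm_sum_char_log_posLog_le {q : ℕ} [NeZero q] {χ : DirichletCharacter ℂ q}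
    (hχ : χ ≠ 1) {x : ℝ} (hx : 1 ≤ x) (d : ℕ) :
    ‖∑ m ∈ Ioc 0 ⌊x⌋₊, (Real.log m : ℂ) * χ m * (posLog (x / d / m) : ℂ)‖
      ≤ 2 * q * Real.log x ^ 2 := by
  have hL := Real.log_nonneg hx
  have h1 : ∀ M ≤ ⌊x⌋₊, ‖∑ m ∈ Ioc 0 M, (Real.log m : ℂ) * χ m‖ ≤ 2 * q * Real.log x := by
    intro M hM
    have h2 := norm_sum_mul_monotone_le (fun n => χ n) (fun n => Real.log n) (B := q)
      log_cast_succ_le Real.log_natCast_nonneg M (Nat.cast_nonneg q)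
      fun K _ => norm_sum_Ioc_char_le hχ K
    refine le_trans (le_of_eq ?_) (h2.trans ?_)
    · congr 1
      exact Finset.sum_congr rfl fun n _ => mul_comm _ _
    · exact mul_le_mul_of_nonneg_left (log_cast_le_log hx hM) (by positivity)
  have h3 := norm_sum_mul_antitone_le (fun m => (Real.log m : ℂ) * χ m)
    (fun m => posLog (x / d / m)) (B := 2 * q * Real.log x) (W := Real.log x) (by positivity)
    (fun n hn => posLog_div_succ_le (by positivity) n hn) (fun n => Real.posLog_nonneg)
    (fun n _ => posLog_div_div_le hx d n) hL ⌊x⌋₊ h1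
  exact h3.trans (le_of_eq (by ring))

theorem rieszPsi_eq_vaughan (χ : CharIdx) (V : ℕ) {x : ℝ} (hx : 0 ≤ x) :
    rieszPsi x χ = rieszSum (fun n => (lowPart Λ V n : ℂ) * χ.2 n) x +
      bil (Ioc 0 ⌊x⌋₊) (Ioc 0 ⌊x⌋₊) (fun a => (lowPart (μ : ArithmeticFunction ℝ) V a : ℂ) * χ.2 a)
        (fun b => (Real.log b : ℂ) * χ.2 b) x -
      bil (Ioc 0 ⌊x⌋₊) (Ioc 0 ⌊x⌋₊)
        (fun a => ((lowPart Λ V * lowPart (μ : ArithmeticFunction ℝ) V) a : ℂ) * χ.2 a)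
        (fun b => ((ζ : ArithmeticFunction ℝ) b : ℂ) * χ.2 b) x +
      bil (Ioc 0 ⌊x⌋₊) (Ioc 0 ⌊x⌋₊) (fun a => (highPart Λ V a : ℂ) * χ.2 a)
        (fun b => (((ζ : ArithmeticFunction ℝ) * highPart (μ : ArithmeticFunction ℝ) V) b : ℂ) *
          χ.2 b) x := by
  have h2 := rieszSum_mul_char (lowPart (μ : ArithmeticFunction ℝ) V) ArithmeticFunction.log χ.2 hx
  simp only [ArithmeticFunction.log_apply] at h2
  rw [← h2, ← rieszSum_mul_char _ _ χ.2 hx, ← rieszSum_mul_char _ _ χ.2 hx, rieszPsi]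
  simp only [rieszSum]
  rw [← Finset.sum_add_distrib, ← Finset.sum_sub_distrib, ← Finset.sum_add_distrib]
  refine Finset.sum_congr rfl fun n _ => ?_
  have h3 := congrArg (fun f : ArithmeticFunction ℝ => f n)
    (eq_sub_iff_add_eq.1 ((vaughan_identity V).trans (sub_add_eq_add_sub _ _ _)))
  simp only [ArithmeticFunction.add_apply] at h3
  rw [eq_sub_of_add_eq h3]
  push_cast
  ring

theorem norm_rieszPsi_le_vaughan {D : ℕ} {χ : CharIdx} (hχ : χ ∈ ntChars D) {V : ℕ} (hV : 1 ≤ V)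
    {x : ℝ} (hx : 1 ≤ x) :
    ‖rieszPsi x χ‖ ≤ 9 * D * V ^ 2 * (1 + Real.log x) ^ 2 +
      ‖bil (Ioc V ⌊x⌋₊) (Ioc V ⌊x⌋₊) (fun a => (Λ a : ℂ) * χ.2 a)
        (fun b => (((ζ : ArithmeticFunction ℝ) * highPart (μ : ArithmeticFunction ℝ) V) b : ℂ) *
          χ.2 b) x‖ := by
  have hL := Real.log_nonneg hx
  have hχ1 := ne_one_of_mem_ntChars hχ
  have hq : ((χ.1 + 1 : ℕ) : ℝ) ≤ D := by exact_mod_cast (mem_ntChars.1 hχ).1.1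
  have hD : (1:ℝ) ≤ D := le_trans (by push_cast; linarith [Nat.cast_nonneg (α := ℝ) χ.1]) hq
  have hVr : (1:ℝ) ≤ V := by exact_mod_cast hV
  have hone : ∀ n : ℕ, ‖χ.2 n‖ ≤ 1 := fun n => χ.2.norm_le_one _
  have h1 : ‖rieszSum (fun n => (lowPart Λ V n : ℂ) * χ.2 n) x‖ ≤ 6 * V * Real.log x := by
    rw [rieszSum]
    have h2 : ∀ n ∈ Ioc 0 ⌊x⌋₊, ‖(lowPart Λ V n : ℂ) * χ.2 n * (posLog (x / n) : ℂ)‖ ≤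
        if n ≤ V then Λ n * Real.log x else 0 := by
      intro n _
      rw [lowPart_apply]
      split_ifs
      · rw [norm_mul, norm_mul, Complex.norm_real, Complex.norm_real,
          Real.norm_of_nonneg Real.posLog_nonneg,
          Real.norm_of_nonneg ArithmeticFunction.vonMangoldt_nonneg]
        exact mul_le_mul (mul_le_of_le_one_right ArithmeticFunction.vonMangoldt_nonneg (hone n))
          (posLog_div_le hx n) Real.posLog_nonneg ArithmeticFunction.vonMangoldt_nonneg
      · simp
    refine (norm_sum_le_of_le _ h2).trans ?_
    rw [← Finset.sum_filter, ← Finset.sum_mul]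
    refine mul_le_mul_of_nonneg_right ?_ hL
    refine le_trans (Finset.sum_le_sum_of_subset_of_nonneg (t := Ioc 0 V) ?_ fun _ _ _ =>
      ArithmeticFunction.vonMangoldt_nonneg) (sum_vonMangoldt_le V)
    intro a ha
    rw [mem_filter, mem_Ioc] at ha
    exact mem_Ioc.2 ⟨ha.1.1, ha.2⟩
  have h2 : ‖bil (Ioc 0 ⌊x⌋₊) (Ioc 0 ⌊x⌋₊)
      (fun a => (lowPart (μ : ArithmeticFunction ℝ) V a : ℂ) * χ.2 a)
      (fun b => (Real.log b : ℂ) * χ.2 b) x‖ ≤ V * (1 * (2 * D * Real.log x ^ 2)) := by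
    refine norm_bil_le_of_support zero_le_one (by positivity) (fun a _ => ?_) (fun a ha => ?_)
      fun a => (norm_sum_char_log_posLog_le hχ1 hx a).trans (by gcongr)
    · rw [norm_mul, Complex.norm_real]
      exact mul_le_one₀ (abs_lowPart_moebius_le V a) (norm_nonneg _) (hone a)
    · rw [lowPart_apply, if_neg (not_le.2 ha)]; simp
  have h3 : ‖bil (Ioc 0 ⌊x⌋₊) (Ioc 0 ⌊x⌋₊)
        (fun a => ((lowPart Λ V * lowPart (μ : ArithmeticFunction ℝ) V) a : ℂ) * χ.2 a)
        (fun b => ((ζ : ArithmeticFunction ℝ) b : ℂ) * χ.2 b) x‖ ≤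
      ((V * V : ℕ) : ℝ) * (Real.log x * (D * Real.log x)) := by
    refine norm_bil_le_of_support hL (by positivity) (fun a ha => ?_) (fun a ha => ?_) fun a => ?_
    · rw [norm_mul, Complex.norm_real]
      refine (mul_le_of_le_one_right (norm_nonneg _) (hone a)).trans ?_
      exact (abs_lowPart_mul_lowPart_le V a).trans (log_cast_le_log hx (mem_Ioc.1 ha).2)
    · rw [lowPart_mul_lowPart_eq_zero _ _ ha]; simp
    · refine le_trans (le_of_eq ?_)
        ((norm_sum_char_posLog_le hχ1 hx ⌊x⌋₊ a).trans (mul_le_mul_of_nonneg_right hq hL))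
      congr 1
      refine Finset.sum_congr rfl fun b hb => ?_
      have := (mem_Ioc.1 hb).1
      simp [ArithmeticFunction.natCoe_apply, ArithmeticFunction.zeta_apply, this.ne']
  have h4 : bil (Ioc 0 ⌊x⌋₊) (Ioc 0 ⌊x⌋₊) (fun a => (highPart Λ V a : ℂ) * χ.2 a)
        (fun b => (((ζ : ArithmeticFunction ℝ) * highPart (μ : ArithmeticFunction ℝ) V) b : ℂ) *
          χ.2 b) x = bil (Ioc V ⌊x⌋₊) (Ioc V ⌊x⌋₊) (fun a => (Λ a : ℂ) * χ.2 a)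
        (fun b => (((ζ : ArithmeticFunction ℝ) * highPart (μ : ArithmeticFunction ℝ) V) b : ℂ) *
          χ.2 b) x := by
    have hsub : Ioc V ⌊x⌋₊ ⊆ Ioc 0 ⌊x⌋₊ := Finset.Ioc_subset_Ioc_left (Nat.zero_le V)
    have hnot : ∀ a ∈ Ioc 0 ⌊x⌋₊, a ∉ Ioc V ⌊x⌋₊ → a ≤ V := by
      intro a ha ha'
      rw [mem_Ioc] at ha ha'
      omega
    unfold bil
    symm
    refine Finset.sum_subset_zero_on_sdiff hsub (fun a ha => ?_) fun a ha => ?_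
    · rw [mem_sdiff] at ha
      have := hnot a ha.1 ha.2
      refine Finset.sum_eq_zero fun b _ => ?_
      dsimp only
      rw [highPart_apply, if_neg (not_lt.2 this)]; simp
    · refine Finset.sum_subset_zero_on_sdiff hsub (fun b hb => ?_) fun b hb => ?_
      · rw [mem_sdiff] at hb
        dsimp only
        rw [zeta_mul_highPart_eq_zero (hnot b hb.1 hb.2)]; simp
      · dsimp only
        rw [highPart_apply, if_pos (mem_Ioc.1 ha).1]
  rw [rieszPsi_eq_vaughan χ V (by linarith), h4]
  refine (norm_add_le _ _).trans (add_le_add_left ?_ _)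
  refine (norm_sub_le _ _).trans ((add_le_add ((norm_add_le _ _).trans (add_le_add h1 h2)) h3).trans ?_)
  set L := Real.log x
  push_cast
  have a1 : 6 * V * L ≤ 6 * D * V ^ 2 * (1 + L) ^ 2 := by
    have : (V:ℝ) ≤ D * V ^ 2 := by nlinarith
    have h5 : L ≤ (1 + L) ^ 2 := by nlinarith
    calc 6 * V * L ≤ 6 * (D * V ^ 2) * (1 + L) ^ 2 := by gcongr
      _ = _ := by ring
  have a2 : V * (1 * (2 * D * L ^ 2)) ≤ 2 * D * V ^ 2 * (1 + L) ^ 2 := by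
    have : (V:ℝ) ≤ V ^ 2 := by nlinarith
    calc V * (1 * (2 * D * L ^ 2)) ≤ V ^ 2 * (1 * (2 * D * (1 + L) ^ 2)) := by gcongr; linarith
      _ = _ := by ring
  have a3 : V * V * (L * (D * L)) ≤ 1 * D * V ^ 2 * (1 + L) ^ 2 := by
    calc V * V * (L * (D * L)) = V ^ 2 * D * L ^ 2 := by ring
      _ ≤ V ^ 2 * D * (1 + L) ^ 2 := by gcongr; linarith
      _ = _ := by ring
  linarith

theorem exists_sum_rieszPsi_le : ∃ C : ℝ, 0 < C ∧ ∀ (D V : ℕ) (x : ℝ), 1 ≤ D → 1 ≤ V → 1 ≤ x →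
    ∑ χ ∈ ntChars D, ‖rieszPsi x χ‖ ≤
      C * (1 + Real.log x) ^ 3 * (D ^ 3 * V ^ 2 + x + D * x / √V + √x * D ^ 2) := by
  obtain ⟨C, hC, hLS⟩ := exists_large_sieve
  refine ⟨9 + 6 * C, by positivity, fun D V x hD hV hx => ?_⟩
  have hX := ntChars_subset D
  have hx0 : 0 < x := by linarith
  have hVr : (1:ℝ) ≤ V := by exact_mod_cast hV
  have hDr : (1:ℝ) ≤ D := by exact_mod_cast hD
  have hL := Real.log_nonneg hx
  set L := Real.log x with hLdef
  have hLS' : ∀ (b : ℕ → ℂ) (t B : ℝ), 0 ≤ t → 0 ≤ B →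
      ∑ n ∈ Ioc 0 ⌊t⌋₊, ‖b n‖ ^ 2 ≤ B →
      ∑ χ ∈ ntChars D, ‖∑ n ∈ (Ioc V ⌊x⌋₊).filter (fun n : ℕ => (n:ℝ) ≤ t), b n * χ.2 n‖ ^ 2 ≤
        C * (t + D ^ 2) * B := by
    intro b t B ht hB0 hB
    have h1 : ∀ χ : CharIdx, ∑ n ∈ (Ioc V ⌊x⌋₊).filter (fun n : ℕ => (n:ℝ) ≤ t), b n * χ.2 n =
        ∑ n ∈ Ioc 0 ⌊t⌋₊, (if V < n ∧ n ≤ ⌊x⌋₊ then b n else 0) * χ.2 n := by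
      intro χ
      simp_rw [ite_mul, zero_mul]
      rw [← Finset.sum_filter]
      refine Finset.sum_congr ?_ fun _ _ => rfl
      ext n
      simp only [mem_filter, mem_Ioc, Nat.le_floor_iff ht]
      constructor
      · rintro ⟨⟨h1, h2⟩, h3⟩; exact ⟨⟨by omega, h3⟩, h1, h2⟩
      · rintro ⟨⟨h1, h2⟩, h3⟩; exact ⟨h3, h2⟩
    simp_rw [h1]
    have hNt : (⌊t⌋₊ : ℝ) ≤ t := Nat.floor_le ht
    have h2 : ∑ n ∈ Ioc 0 ⌊t⌋₊, ‖if V < n ∧ n ≤ ⌊x⌋₊ then b n else 0‖ ^ 2 ≤ B := by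
      refine le_trans (Finset.sum_le_sum fun n _ => ?_) hB
      split_ifs
      · exact le_rfl
      · simp
    calc _ ≤ ∑ χ ∈ primChars D,
          ‖∑ n ∈ Ioc 0 ⌊t⌋₊, (if V < n ∧ n ≤ ⌊x⌋₊ then b n else 0) * χ.2 n‖ ^ 2 :=
          Finset.sum_le_sum_of_subset_of_nonneg hX fun _ _ _ => by positivity
      _ ≤ _ := hLS D _ _
      _ ≤ C * (t + D ^ 2) * B := by gcongr
  have hempty : ∀ t : ℝ, t < V → (Ioc V ⌊x⌋₊).filter (fun n : ℕ => (n:ℝ) ≤ t) = ∅ := by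
    intro t ht
    rw [Finset.filter_eq_empty_iff]
    intro n hn hnt
    have : (V:ℝ) < n := by exact_mod_cast (mem_Ioc.1 hn).1
    linarith
  set M := 3 * C * (1 + L) ^ 2 * (x + 2 * (D * x / √V) + √x * D ^ 2) with hM
  have hM0 : 0 ≤ M := by positivity
  have hbil := sum_norm_bil_le (ntChars D) (s := Ioc V ⌊x⌋₊) (r := Ioc V ⌊x⌋₊)
    (fun a ha => (Nat.zero_le V).trans_lt (mem_Ioc.1 ha).1)
    (fun a ha => (Nat.zero_le V).trans_lt (mem_Ioc.1 ha).1)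
    (fun χ a => (Λ a : ℂ) * χ.2 a)
    (fun χ b => (((ζ : ArithmeticFunction ℝ) * highPart (μ : ArithmeticFunction ℝ) V) b : ℂ) * χ.2 b)
    hx hM0 (fun t ht1 htx => by
      have ht0 : 0 < t := by linarith
      rcases lt_or_ge t V with h | h
      · rw [hempty t h]; simp; positivity
      rcases lt_or_ge (x / t) V with h' | h'
      · rw [hempty _ h']; simp; positivity
      have hxt : 1 ≤ x / t := hVr.trans h'
      have hxtx : x / t ≤ x := div_le_self hx0.le ht1
      have hlog : ∀ u : ℝ, 1 ≤ u → u ≤ x → Real.log ⌊u⌋₊ ≤ L := fun u h1 h2 =>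
        log_cast_le_log hx (Nat.floor_le_floor h2)
      have e1 := hLS' (fun a => (Λ a : ℂ)) (x / t) (L * (6 * (x / t))) (by positivity)
        (by positivity) (by
          refine le_trans (Finset.sum_le_sum (g := fun n => L * Λ n) fun n hn => ?_) ?_
          · rw [Complex.norm_real, Real.norm_of_nonneg ArithmeticFunction.vonMangoldt_nonneg, sq]
            refine mul_le_mul_of_nonneg_right ?_ ArithmeticFunction.vonMangoldt_nonneg
            refine ArithmeticFunction.vonMangoldt_le_log.trans (log_cast_le_log hx ?_)
            exact (mem_Ioc.1 hn).2.trans (Nat.floor_le_floor hxtx)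
          · rw [← Finset.mul_sum]
            have h1 := Nat.floor_le (by positivity : 0 ≤ x / t)
            have h2 := sum_vonMangoldt_le ⌊x / t⌋₊
            gcongr
            linarith)
      have e2 := hLS' (fun b => (((ζ : ArithmeticFunction ℝ) *
          highPart (μ : ArithmeticFunction ℝ) V) b : ℂ)) t (t * (1 + L) ^ 3) (by positivity)
        (by positivity) (by
          refine le_trans (Finset.sum_le_sum (g := fun n => (n.divisors.card : ℝ) ^ 2)
            fun n hn => ?_) ?_
          · refine pow_le_pow_left₀ (norm_nonneg _) ?_ 2
            rw [Complex.norm_real]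
            exact abs_zeta_mul_highPart_le V n
          · refine (sum_card_divisors_sq_le _).trans ?_
            have h1 := Nat.floor_le ht0.le
            have h2 := hlog t ht1 htx
            have h3 := Real.log_natCast_nonneg ⌊t⌋₊
            gcongr)
      refine (mul_le_mul e1 e2 (Finset.sum_nonneg fun _ _ => by positivity)
        (by positivity)).trans ?_
      have hsV : √(V:ℝ) ^ 2 = V := Real.sq_sqrt (by positivity)
      have hsx : √x ^ 2 = x := Real.sq_sqrt hx0.le
      have hsV0 : 0 < √(V:ℝ) := Real.sqrt_pos.2 (by positivity)
      have htV : t ≤ x / V := by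
        rw [le_div_iff₀ (by positivity)]
        rw [le_div_iff₀ ht0] at h'
        linarith
      have hxtV : x / t ≤ x / V := div_le_div_of_nonneg_left hx0.le (by positivity) h
      have k1 : (x / t + D ^ 2) * (t + D ^ 2) * x ≤ (x + 2 * (D * x / √V) + √x * D ^ 2) ^ 2 := by
        have i1 : (x / t + D ^ 2) * (t + D ^ 2) = x + D ^ 2 * (t + x / t) + (D:ℝ) ^ 4 := by
          field_simp; ring
        have i2 : (x + D ^ 2 * (t + x / t) + (D:ℝ) ^ 4) * x ≤
            (x + D ^ 2 * (x / V + x / V) + (D:ℝ) ^ 4) * x := by gcongr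
        have i3 : (D * x / √V) ^ 2 = D ^ 2 * (x / V) * x := by
          rw [div_pow, hsV]; ring
        have i4 : (√x * D ^ 2) ^ 2 = x * (D:ℝ) ^ 4 := by rw [mul_pow, hsx]; ring
        have j1 : 0 ≤ D * x / √V := by positivity
        have j2 : 0 ≤ √x * D ^ 2 := by positivity
        rw [i1]
        refine i2.trans ?_
        have i5 : (x + D ^ 2 * (x / V + x / V) + (D:ℝ) ^ 4) * x =
          x ^ 2 + 2 * (D * x / √V) ^ 2 + (√x * D ^ 2) ^ 2 := by rw [i3, i4]; ring
        rw [i5]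
        nlinarith [mul_nonneg hx0.le j1, mul_nonneg hx0.le j2, mul_nonneg j1 j2, sq_nonneg (D * x / √V)]
      have k2 : L * (1 + L) ^ 3 ≤ (1 + L) ^ 4 := by
        have : 0 ≤ (1 + L) ^ 3 := by positivity
        nlinarith
      calc _ = 6 * C ^ 2 * (L * (1 + L) ^ 3) * ((x / t + D ^ 2) * (t + D ^ 2) * x) := by
            field_simp
        _ ≤ 9 * C ^ 2 * (1 + L) ^ 4 * (x + 2 * (D * x / √V) + √x * D ^ 2) ^ 2 := by
            gcongr; norm_num
        _ = M ^ 2 := by rw [hM]; ring)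
  have h1 := Finset.sum_le_sum fun χ (h : χ ∈ ntChars D) => norm_rieszPsi_le_vaughan h hV hx
  rw [Finset.sum_add_distrib, Finset.sum_const, nsmul_eq_mul] at h1
  have hcard : ((ntChars D).card : ℝ) ≤ (D:ℝ) ^ 2 :=
    (Nat.cast_le.2 (Finset.card_le_card hX)).trans (card_primChars_le D)
  rw [← hLdef] at h1 hbil
  have h2 : ((ntChars D).card : ℝ) * (9 * D * V ^ 2 * (1 + L) ^ 2) ≤
      9 * (1 + L) ^ 3 * (D ^ 3 * V ^ 2) := by
    calc _ ≤ (D:ℝ) ^ 2 * (9 * D * V ^ 2 * (1 + L) ^ 3) := by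
          gcongr
          · linarith
          · norm_num
      _ = _ := by ring
  have h3 : M * L ≤ 6 * C * (1 + L) ^ 3 * (x + D * x / √V + √x * D ^ 2) := by
    have p1 : 0 ≤ D * x / √V := by positivity
    have p2 : 0 ≤ √x * D ^ 2 := by positivity
    calc M * L ≤ (3 * C * (1 + L) ^ 2 * (2 * (x + D * x / √V + √x * D ^ 2))) * (1 + L) := by
          rw [hM]; gcongr <;> linarith
      _ = _ := by ring
  have p3 : 0 ≤ (1 + L) ^ 3 * (x + D * x / √V + √x * D ^ 2) := by positivity
  have p4 : 0 ≤ C * ((1 + L) ^ 3 * (D ^ 3 * V ^ 2)) := by positivity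
  nlinarith

end TwinSieve

namespace TwinSieve
open Finset
open Filter Topology

theorem exists_sum_rieszPsi_le_of_le_log_pow : ∃ C : ℝ, 0 < C ∧ ∃ X : ℝ, ∀ x : ℝ, X ≤ x →
    ∀ D : ℕ, 1 ≤ D → (D:ℝ) ≤ Real.log x ^ 6 →
      ∑ χ ∈ ntChars D, ‖rieszPsi x χ‖ ≤ C * x * (1 + D / √(Real.log x)) := by
  obtain ⟨C, hC, h⟩ := exists_log_mul_sum_rieszPsi_le
  have hlog : Tendsto Real.log atTop atTop := Real.tendsto_log_atTop
  have e1 : ∀ᶠ x : ℝ in atTop, 2 ≤ Real.log x := hlog.eventually_ge_atTop 2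
  have e2 : ∀ᶠ x : ℝ in atTop, 16 * Real.log x ^ 480 ≤ x := by
    have := (Real.isLittleO_pow_log_id_atTop (n := 480)).bound (c := 1 / 16) (by norm_num)
    filter_upwards [this, e1, eventually_ge_atTop 0] with x h1 h2 h3
    rw [Real.norm_of_nonneg (by positivity), id, Real.norm_of_nonneg h3] at h1
    linarith
  have e3 : ∀ᶠ y : ℝ in atTop, (2 + 120 * Real.log y) ^ 6 ≤ y := by
    have := (Real.isLittleO_pow_log_id_atTop (n := 6)).bound (c := 1 / 122 ^ 6) (by norm_num)
    filter_upwards [this, e1, hlog.eventually_ge_atTop 1, eventually_ge_atTop 0] with x h1 h2 h4 h3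
    rw [Real.norm_of_nonneg (by positivity), id, Real.norm_of_nonneg h3] at h1
    calc (2 + 120 * Real.log x) ^ 6 ≤ (122 * Real.log x) ^ 6 := by gcongr; linarith
      _ = 122 ^ 6 * Real.log x ^ 6 := by ring
      _ ≤ 122 ^ 6 * (1 / 122 ^ 6 * x) := by gcongr
      _ = x := by ring
  obtain ⟨X, hX⟩ := eventually_atTop.1 (e1.and (e2.and ((hlog.eventually e3).and
    (eventually_ge_atTop 1))))
  refine ⟨C, hC, X, fun x hx D hD hDL => ?_⟩
  obtain ⟨h1, h2, h3, hx1⟩ := hX x hx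
  set L := Real.log x with hL
  have hL0 : 0 < L := by linarith
  set z := ⌈L ^ 120⌉₊ with hz
  have z1 : L ^ 120 ≤ z := Nat.le_ceil _
  have hp : (1:ℝ) ≤ L ^ 120 := one_le_pow₀ (by linarith)
  have z2 : (z:ℝ) ≤ 2 * L ^ 120 := by
    have := Nat.ceil_lt_add_one (by positivity : 0 ≤ L ^ 120)
    linarith
  have z3 : D ^ 20 ≤ z := by
    have : (D:ℝ) ^ 20 ≤ z := by
      calc (D:ℝ) ^ 20 ≤ (L ^ 6) ^ 20 := by gcongr
        _ = L ^ 120 := by rw [← pow_mul]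
        _ ≤ z := z1
    exact_mod_cast this
  have z4 : (D:ℝ) ^ 3 * (1 + L) ^ 4 ≤ z := by
    calc (D:ℝ) ^ 3 * (1 + L) ^ 4 ≤ (L ^ 6) ^ 3 * (L ^ 2) ^ 4 := by
          gcongr
          nlinarith
      _ = L ^ 26 := by ring
      _ ≤ L ^ 120 := pow_le_pow_right₀ (by linarith) (by norm_num)
      _ ≤ z := z1
  have z5 : (z:ℝ) ^ 4 ≤ x := by
    calc (z:ℝ) ^ 4 ≤ (2 * L ^ 120) ^ 4 := by gcongr
      _ = 16 * L ^ 480 := by rw [mul_pow, ← pow_mul]; norm_num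
      _ ≤ x := h2
  have hm := h D z x hD z3 z4 z5
  clear z3 z4 z5
  have hz0 : (1:ℝ) ≤ z := hp.trans z1
  have z6 : 1 + Real.log z ≤ 2 + 120 * Real.log L := by
    have := Real.log_le_log (by linarith) z2
    rw [Real.log_mul (by norm_num) (by positivity), Real.log_pow] at this
    have h5 := Real.log_two_lt_d9
    push_cast at this
    linarith
  have z7 : (1 + Real.log z) ^ 3 ≤ √L := by
    refine Real.le_sqrt_of_sq_le ?_
    have := Real.log_nonneg hz0
    calc ((1 + Real.log z) ^ 3) ^ 2 = (1 + Real.log z) ^ 6 := by ring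
      _ ≤ (2 + 120 * Real.log L) ^ 6 := by gcongr
      _ ≤ L := h3
  have hsL : √L * √L = L := Real.mul_self_sqrt hL0.le
  have hs0 : 0 < √L := Real.sqrt_pos.2 hL0
  refine le_of_mul_le_mul_left (hm.trans ?_) hL0
  calc C * x * (L + D * (1 + Real.log z) ^ 3) ≤ C * x * (L + D * √L) := by gcongr
    _ = L * (C * x * (1 + D / √L)) := by
      have : D * √L = L * (D / √L) := by
        rw [mul_div_assoc', eq_div_iff hs0.ne', mul_assoc, hsL, mul_comm]
      rw [this]; ring

theorem exists_sum_rieszPsi_le_rpow {θ δ : ℝ} (hθ : 0 ≤ θ) (hδ : 0 < δ) (h : 2 * θ + 8 * δ = 1) :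
    ∃ C : ℝ, 0 < C ∧ ∃ X : ℝ, ∀ x : ℝ, X ≤ x → ∀ D : ℕ, 1 ≤ D → (D:ℝ) ≤ 2 * x ^ θ →
      ∑ χ ∈ ntChars D, ‖rieszPsi x χ‖ ≤ C * x * (D:ℝ) ^ (1 - δ / 2) := by
  obtain ⟨C₁, hC₁, X₁, h₁⟩ := exists_sum_rieszPsi_le_of_le_log_pow
  obtain ⟨C₂, hC₂, h₂⟩ := exists_sum_rieszPsi_le
  have hlog : Tendsto Real.log atTop atTop := Real.tendsto_log_atTop
  have e1 : ∀ᶠ x : ℝ in atTop, 1 ≤ Real.log x := hlog.eventually_ge_atTop 1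
  have e2 : ∀ᶠ x : ℝ in atTop, (1 + Real.log x) ^ 3 ≤ x ^ (δ / 4) := by
    have := (isLittleO_log_rpow_atTop (r := δ / 12) (by positivity)).bound
      (c := 1 / 2) (by norm_num)
    filter_upwards [this, e1, eventually_ge_atTop 0] with x h1 h2 h3
    rw [Real.norm_of_nonneg (by positivity), Real.norm_of_nonneg (by positivity)] at h1
    calc (1 + Real.log x) ^ 3 ≤ (x ^ (δ / 12)) ^ 3 := by
          have : 0 ≤ Real.log x := by linarith
          gcongr; linarith
      _ = x ^ (δ / 4) := by
        rw [← Real.rpow_natCast, ← Real.rpow_mul h3]; congr 1; push_cast; ring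
  obtain ⟨X, hX⟩ := eventually_atTop.1 (e1.and (e2.and
    (eventually_ge_atTop 1)))
  refine ⟨2 * C₁ + 56 * C₂, by positivity, max X X₁, fun x hx D hD hDx => ?_⟩
  obtain ⟨a1, a2, hx1⟩ := hX x ((le_max_left _ _).trans hx)
  have hx0 : 0 < x := by linarith
  have hDr : (1:ℝ) ≤ D := by exact_mod_cast hD
  have hD0 : (0:ℝ) < D := by linarith
  set L := Real.log x with hL
  have hL0 : 0 < L := by linarith
  have hpos : 0 < (D:ℝ) ^ (1 - δ / 2) := Real.rpow_pos_of_pos hD0 _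
  have hδ1 : δ ≤ 1 / 8 := by linarith
  have hsplit : ∀ r : ℝ, (D:ℝ) ^ r = (D:ℝ) ^ (1 - δ / 2) * (D:ℝ) ^ (r - (1 - δ / 2)) := fun r => by
    rw [← Real.rpow_add hD0]; congr 1; ring
  have hone : (1:ℝ) ≤ (D:ℝ) ^ (1 - δ / 2) := Real.one_le_rpow hDr (by linarith)
  rcases le_total (D:ℝ) (L ^ 6) with hc | hc
  · refine (h₁ x ((le_max_right _ _).trans hx) D hD hc).trans ?_
    have hs0 : 0 < √L := Real.sqrt_pos.2 hL0
    have h3 : (D:ℝ) / √L ≤ (D:ℝ) ^ (1 - δ / 2) := by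
      rw [div_le_iff₀ hs0]
      have h4 := hsplit 1
      rw [Real.rpow_one] at h4
      conv_lhs => rw [h4]
      refine mul_le_mul_of_nonneg_left ?_ hpos.le
      calc (D:ℝ) ^ (1 - (1 - δ / 2)) ≤ (L ^ 6) ^ (1 - (1 - δ / 2)) :=
            Real.rpow_le_rpow hD0.le hc (by linarith)
        _ = L ^ (6 * (1 - (1 - δ / 2))) := by
            rw [← Real.rpow_natCast, ← Real.rpow_mul hL0.le]; norm_num
        _ ≤ L ^ (1 / 2 : ℝ) := Real.rpow_le_rpow_of_exponent_le a1 (by linarith)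
        _ = √L := (Real.sqrt_eq_rpow L).symm
    calc C₁ * x * (1 + D / √L) ≤ C₁ * x * ((D:ℝ) ^ (1 - δ / 2) + (D:ℝ) ^ (1 - δ / 2)) := by
          gcongr
      _ = 2 * C₁ * x * (D:ℝ) ^ (1 - δ / 2) := by ring
      _ ≤ _ := by gcongr; linarith
  · set V := ⌈x ^ δ⌉₊ with hV
    have v0 : 1 ≤ x ^ δ := Real.one_le_rpow hx1 hδ.le
    have v1 : x ^ δ ≤ V := Nat.le_ceil _
    have v2 : (V:ℝ) ≤ 2 * x ^ δ := by
      have := Nat.ceil_lt_add_one (by positivity : 0 ≤ x ^ δ)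
      linarith
    have hV1 : 1 ≤ V := by
      have : (1:ℝ) ≤ V := v0.trans v1
      exact_mod_cast this
    have hx4 : 0 < x ^ (δ / 4) := by positivity
    have hmain := h₂ D V x hD hV1 hx1
    rw [← hL] at hmain
    have hDpow : ∀ r : ℝ, 0 ≤ r → r ≤ 3 → (D:ℝ) ^ r ≤ 8 * x ^ (θ * r) := by
      intro r hr hr3
      calc (D:ℝ) ^ r ≤ (2 * x ^ θ) ^ r := Real.rpow_le_rpow hD0.le hDx hr
        _ = 2 ^ r * x ^ (θ * r) := by
          rw [Real.mul_rpow (by norm_num) (by positivity), ← Real.rpow_mul hx0.le]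
        _ ≤ 8 * x ^ (θ * r) := by
          gcongr
          calc (2:ℝ) ^ r ≤ 2 ^ (3:ℝ) := Real.rpow_le_rpow_of_exponent_le (by norm_num) hr3
            _ = 8 := by norm_num
    have hle : ∀ r : ℝ, r ≤ 1 → x ^ r ≤ x := fun r hr => by
      simpa using Real.rpow_le_rpow_of_exponent_le hx1 hr
    have t1 : x ^ (δ / 4) * (D ^ 3 * V ^ 2 : ℝ) ≤ 32 * (x * (D:ℝ) ^ (1 - δ / 2)) := by
      have e : (D:ℝ) ^ 3 = (D:ℝ) ^ (1 - δ / 2) * (D:ℝ) ^ (2 + δ / 2) := by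
        rw [← Real.rpow_add hD0, ← Real.rpow_natCast]; congr 1; push_cast; ring
      calc x ^ (δ / 4) * (D ^ 3 * V ^ 2 : ℝ)
          ≤ x ^ (δ / 4) * ((D:ℝ) ^ (1 - δ / 2) * (8 * x ^ (θ * (2 + δ / 2))) *
            (2 * x ^ δ) ^ 2) := by
            rw [e]; gcongr
            exact hDpow _ (by linarith) (by linarith)
        _ = 32 * ((D:ℝ) ^ (1 - δ / 2) * (x ^ (δ / 4) * x ^ (θ * (2 + δ / 2)) * (x ^ δ * x ^ δ))) := by
            ring
        _ = 32 * ((D:ℝ) ^ (1 - δ / 2) * x ^ (δ / 4 + θ * (2 + δ / 2) + (δ + δ))) := by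
            rw [← Real.rpow_add hx0, ← Real.rpow_add hx0, ← Real.rpow_add hx0]
        _ ≤ 32 * ((D:ℝ) ^ (1 - δ / 2) * x) := by
            gcongr
            refine hle _ ?_
            nlinarith
        _ = _ := by ring
    have t2 : (1 + L) ^ 3 * x ≤ 8 * (x * (D:ℝ) ^ (1 - δ / 2)) := by
      have : (1 + L) ^ 3 ≤ 8 * (D:ℝ) ^ (1 - δ / 2) := by
        calc (1 + L) ^ 3 ≤ (2 * L) ^ 3 := by gcongr; linarith
          _ = 8 * (L ^ 6) ^ (1 / 2 : ℝ) := by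
            rw [← Real.rpow_natCast L 6, ← Real.rpow_mul hL0.le, mul_pow, ← Real.rpow_natCast L 3]
            norm_num
          _ ≤ 8 * (D:ℝ) ^ (1 / 2 : ℝ) := by gcongr
          _ ≤ 8 * (D:ℝ) ^ (1 - δ / 2) := by
            gcongr
            · linarith
      nlinarith
    have t3 : x ^ (δ / 4) * (D * x / √V) ≤ 8 * (x * (D:ℝ) ^ (1 - δ / 2)) := by
      have h4 := hsplit 1
      rw [Real.rpow_one] at h4
      have h5 := hDpow (1 - (1 - δ / 2)) (by linarith) (by linarith)
      have h6 : x ^ (δ / 2) ≤ √V := by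
        refine Real.le_sqrt_of_sq_le (le_trans (le_of_eq ?_) v1)
        rw [← Real.rpow_natCast, ← Real.rpow_mul hx0.le]; congr 1; push_cast; ring
      have h7 : 0 < x ^ (δ / 2) := by positivity
      rw [mul_div_assoc', div_le_iff₀ (h7.trans_le h6)]
      calc x ^ (δ / 4) * (D * x) ≤ x ^ (δ / 4) *
            (((D:ℝ) ^ (1 - δ / 2) * (8 * x ^ (θ * (1 - (1 - δ / 2))))) * x) := by
            conv_lhs => rw [h4]
            gcongr
        _ = 8 * (x * (D:ℝ) ^ (1 - δ / 2)) * x ^ (δ / 4 + θ * (1 - (1 - δ / 2))) := by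
            rw [Real.rpow_add hx0]; ring
        _ ≤ 8 * (x * (D:ℝ) ^ (1 - δ / 2)) * x ^ (δ / 2) := by
            gcongr
            · nlinarith
        _ ≤ _ := by gcongr
    have t4 : x ^ (δ / 4) * (√x * D ^ 2) ≤ 8 * (x * (D:ℝ) ^ (1 - δ / 2)) := by
      have e : (D:ℝ) ^ 2 = (D:ℝ) ^ (1 - δ / 2) * (D:ℝ) ^ (1 + δ / 2) := by
        rw [← Real.rpow_add hD0, ← Real.rpow_natCast]; congr 1; push_cast; ring
      have h5 := hDpow (1 + δ / 2) (by linarith) (by linarith)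
      calc x ^ (δ / 4) * (√x * D ^ 2) ≤ x ^ (δ / 4) * (x ^ (1 / 2 : ℝ) *
            ((D:ℝ) ^ (1 - δ / 2) * (8 * x ^ (θ * (1 + δ / 2))))) := by
            rw [e, Real.sqrt_eq_rpow]; gcongr
        _ = 8 * ((D:ℝ) ^ (1 - δ / 2) * x ^ (δ / 4 + 1 / 2 + θ * (1 + δ / 2))) := by
            rw [Real.rpow_add hx0, Real.rpow_add hx0]; ring
        _ ≤ 8 * ((D:ℝ) ^ (1 - δ / 2) * x) := by
            gcongr
            refine hle _ ?_
            nlinarith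
        _ = _ := by ring
    have q1 : (0:ℝ) ≤ D ^ 3 * V ^ 2 := by positivity
    have q3 : (0:ℝ) ≤ D * x / √V := by positivity
    have q4 : (0:ℝ) ≤ √x * D ^ 2 := by positivity
    calc _ ≤ _ := hmain
      _ = C₂ * ((1 + L) ^ 3 * (D ^ 3 * V ^ 2) + (1 + L) ^ 3 * x + (1 + L) ^ 3 * (D * x / √V) +
          (1 + L) ^ 3 * (√x * D ^ 2)) := by ring
      _ ≤ C₂ * (32 * (x * (D:ℝ) ^ (1 - δ / 2)) + 8 * (x * (D:ℝ) ^ (1 - δ / 2)) +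
          8 * (x * (D:ℝ) ^ (1 - δ / 2)) + 8 * (x * (D:ℝ) ^ (1 - δ / 2))) := by
        have s1 := mul_le_mul_of_nonneg_right a2 q1
        have s3 := mul_le_mul_of_nonneg_right a2 q3
        have s4 := mul_le_mul_of_nonneg_right a2 q4
        refine mul_le_mul_of_nonneg_left ?_ hC₂.le
        linarith
      _ = 56 * C₂ * (x * (D:ℝ) ^ (1 - δ / 2)) := by ring
      _ ≤ (2 * C₁ + 56 * C₂) * (x * (D:ℝ) ^ (1 - δ / 2)) := by gcongr; linarith
      _ = _ := by ring

end TwinSieve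

namespace TwinSieve
open Finset
open Filter Topology

theorem sum_ntChars_rpow_mul_le {κ : ℝ} (hκ : κ ≤ 1) {a : CharIdx → ℝ} (ha : ∀ χ, 0 ≤ a χ)
    {I J : ℕ} (h : I ≤ J) :
    ∑ χ ∈ ntChars (2 ^ J), ((χ.1 + 1 : ℕ) : ℝ) ^ (κ - 1) * a χ ≤ ∑ χ ∈ ntChars (2 ^ I), a χ +
      ∑ j ∈ Ico I J, ((2:ℝ) ^ j) ^ (κ - 1) * ∑ χ ∈ ntChars (2 ^ (j + 1)), a χ := by
  induction J, h using Nat.le_induction with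
  | base =>
    rw [Finset.Ico_self, Finset.sum_empty, add_zero]
    refine Finset.sum_le_sum fun χ _ => mul_le_of_le_one_left (ha χ) ?_
    refine Real.rpow_le_one_of_one_le_of_nonpos ?_ (by linarith)
    push_cast
    linarith [Nat.cast_nonneg (α := ℝ) χ.1]
  | succ J hJ ih =>
    rw [Finset.sum_Ico_succ_top hJ, ← add_assoc,
      ← Finset.sum_filter_add_sum_filter_not (ntChars (2 ^ (J + 1))) fun χ => χ.1 + 1 ≤ 2 ^ J]
    refine add_le_add (le_trans (le_of_eq (Finset.sum_congr ?_ fun _ _ => rfl)) ih) ?_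
    · ext χ
      rw [mem_filter, mem_ntChars, mem_ntChars, pow_succ]
      constructor
      · rintro ⟨⟨⟨h1, h2⟩, h3⟩, h4⟩; exact ⟨⟨h4, h2⟩, h3⟩
      · rintro ⟨⟨h4, h2⟩, h3⟩; exact ⟨⟨⟨by omega, h2⟩, h3⟩, h4⟩
    · rw [Finset.mul_sum]
      refine (Finset.sum_le_sum fun χ hχ => ?_).trans
        (Finset.sum_le_sum_of_subset_of_nonneg (Finset.filter_subset _ _) fun χ _ _ => by
          have := ha χ; positivity)
      refine mul_le_mul_of_nonneg_right ?_ (ha χ)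
      refine Real.rpow_le_rpow_of_nonpos (by positivity) ?_ (by linarith)
      have := (mem_filter.1 hχ).2
      exact_mod_cast (not_le.1 this).le

theorem tendsto_sum_ntChars_rieszPsi (D : ℕ) :
    Tendsto (fun x : ℝ => (∑ χ ∈ ntChars D, ‖rieszPsi x χ‖) / x) atTop (𝓝 0) := by
  simp_rw [Finset.sum_div]
  rw [← Finset.sum_const_zero (s := ntChars D)]
  exact tendsto_finsetSum _ fun χ hχ =>
    tendsto_rieszSum_vonMangoldt_char (ne_one_of_mem_ntChars hχ)

theorem exists_sum_rpow_mul_rieszPsi_le {θ : ℝ} (hθ : 0 ≤ θ) (hθ2 : θ < 1 / 2) :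
    ∃ κ : ℝ, 0 < κ ∧ κ ≤ (1 - 2 * θ) / 4 ∧ ∀ η : ℝ, 0 < η →
      ∃ X : ℝ, ∀ x : ℝ, X ≤ x → ∀ D : ℕ, (D:ℝ) ≤ x ^ θ →
      ∑ χ ∈ ntChars D, ((χ.1 + 1 : ℕ) : ℝ) ^ (κ - 1) * ‖rieszPsi x χ‖ ≤ η * x := by
  set δ := (1 - 2 * θ) / 8 with hδ
  have hδ0 : 0 < δ := by rw [hδ]; linarith
  obtain ⟨C, hC, X₁, h₁⟩ := exists_sum_rieszPsi_le_rpow hθ hδ0 (by rw [hδ]; ring)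
  have hδ1 : δ ≤ 1 := by rw [hδ]; linarith
  refine ⟨δ / 4, by positivity, by rw [hδ]; linarith, fun η hη => ?_⟩
  set ρ : ℝ := (2:ℝ) ^ (-(δ / 4)) with hρ
  have hρ0 : 0 < ρ := by positivity
  have hρ1 : ρ < 1 := Real.rpow_lt_one_of_one_lt_of_neg (by norm_num) (by linarith)
  obtain ⟨I, hI⟩ : ∃ I : ℕ, 2 * C * (ρ ^ I / (1 - ρ)) ≤ η / 2 := by
    have := ((tendsto_pow_atTop_nhds_zero_of_lt_one hρ0.le hρ1).div_const (1 - ρ)).const_mul (2 * C)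
    rw [zero_div, mul_zero] at this
    exact (this.eventually_le_const (by positivity : 0 < η / 2)).exists
  have hA := (tendsto_sum_ntChars_rieszPsi (2 ^ I)).eventually_le_const (by positivity : 0 < η / 2)
  obtain ⟨X₂, hX₂⟩ := eventually_atTop.1 (hA.and (eventually_ge_atTop (1:ℝ)))
  refine ⟨max X₁ X₂, fun x hx D hD => ?_⟩
  obtain ⟨h₂, hx1⟩ := hX₂ x ((le_max_right _ _).trans hx)
  have hx0 : 0 < x := by linarith
  rw [div_le_iff₀ hx0] at h₂
  set J := max I (Nat.clog 2 D) with hJ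
  have hDJ : D ≤ 2 ^ J := (Nat.le_pow_clog (by norm_num) D).trans
    (Nat.pow_le_pow_right (by norm_num) (le_max_right _ _))
  have hsub : ntChars D ⊆ ntChars (2 ^ J) := by
    intro χ hχ
    rw [mem_ntChars] at hχ ⊢
    exact ⟨⟨hχ.1.1.trans hDJ, hχ.1.2⟩, hχ.2⟩
  refine (Finset.sum_le_sum_of_subset_of_nonneg hsub fun χ _ _ => by positivity).trans ?_
  refine (sum_ntChars_rpow_mul_le (by linarith) (fun χ => norm_nonneg (rieszPsi x χ))
    (le_max_left I _)).trans ?_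
  have h₃ : ∀ j ∈ Ico I J, ((2:ℝ) ^ j) ^ (δ / 4 - 1) *
      ∑ χ ∈ ntChars (2 ^ (j + 1)), ‖rieszPsi x χ‖ ≤ 2 * C * x * ρ ^ j := by
    intro j hj
    have hj2 := (mem_Ico.1 hj).2
    have hj1 := (mem_Ico.1 hj).1
    have hjc : j < Nat.clog 2 D := by
      rcases lt_max_iff.1 hj2 with h | h
      · omega
      · exact h
    have h4 : 2 ^ j < D := (Nat.lt_clog_iff_pow_lt (by norm_num)).1 hjc
    have h5 : (((2:ℕ) ^ (j + 1) : ℕ) : ℝ) ≤ 2 * x ^ θ := by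
      have : ((2:ℝ) ^ j) ≤ D := by exact_mod_cast h4.le
      push_cast
      rw [pow_succ]; linarith
    have h6 := h₁ x ((le_max_left _ _).trans hx) (2 ^ (j + 1)) Nat.one_le_two_pow h5
    have h2j : (0:ℝ) < 2 ^ j := by positivity
    calc _ ≤ ((2:ℝ) ^ j) ^ (δ / 4 - 1) * (C * x * (((2:ℕ) ^ (j + 1) : ℕ) : ℝ) ^ (1 - δ / 2)) := by
          gcongr
      _ ≤ ((2:ℝ) ^ j) ^ (δ / 4 - 1) * (C * x * (2 * ((2:ℝ) ^ j) ^ (1 - δ / 2))) := by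
          gcongr
          push_cast
          rw [pow_succ, mul_comm, Real.mul_rpow (by norm_num) h2j.le]
          gcongr
          calc (2:ℝ) ^ (1 - δ / 2) ≤ 2 ^ (1:ℝ) :=
                Real.rpow_le_rpow_of_exponent_le (by norm_num) (by linarith)
            _ = 2 := Real.rpow_one 2
      _ = 2 * C * x * ((2:ℝ) ^ j) ^ (-(δ / 4)) := by
          have : ((2:ℝ) ^ j) ^ (-(δ / 4)) =
            ((2:ℝ) ^ j) ^ (δ / 4 - 1) * ((2:ℝ) ^ j) ^ (1 - δ / 2) := by
            rw [← Real.rpow_add h2j]; congr 1; ring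
          rw [this]; ring
      _ = 2 * C * x * ρ ^ j := by
          rw [hρ, ← Real.rpow_natCast 2 j, ← Real.rpow_natCast _ j, ← Real.rpow_mul (by norm_num),
            ← Real.rpow_mul (by norm_num), mul_comm (j:ℝ)]
  have h₄ : ∑ j ∈ Ico I J, ρ ^ j ≤ ρ ^ I / (1 - ρ) :=
    geom_sum_Ico_le_of_lt_one hρ0.le hρ1
  calc _ ≤ η / 2 * x + ∑ j ∈ Ico I J, 2 * C * x * ρ ^ j := add_le_add h₂ (Finset.sum_le_sum h₃)
    _ = η / 2 * x + 2 * C * (∑ j ∈ Ico I J, ρ ^ j) * x := by rw [← Finset.mul_sum]; ring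
    _ ≤ η / 2 * x + 2 * C * (ρ ^ I / (1 - ρ)) * x := by gcongr
    _ ≤ η / 2 * x + η / 2 * x := by gcongr
    _ = η * x := by ring

end TwinSieve

namespace TwinSieve
open Finset

theorem sum_char_eq_sum_primChars {d D : ℕ} [NeZero d] (hdD : d ≤ D) {a b : ℤ}
    (ha : IsCoprime a d) (hb : IsCoprime b d) :
    ∑ χ : DirichletCharacter ℂ d, χ a * (starRingEnd ℂ) (χ b) =
      ∑ ψ ∈ primChars D with ψ.1 + 1 ∣ d, ψ.2 a * (starRingEnd ℂ) (ψ.2 b) := by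
  symm
  refine Finset.sum_bij
    (fun ψ hψ => DirichletCharacter.changeLevel (mem_filter.1 hψ).2 ψ.2)
    (fun _ _ => mem_univ _) ?_ ?_ ?_
  · rintro ⟨q, ψ⟩ hψ ⟨r, χ⟩ hχ h
    have h1 := (mem_primChars.1 (mem_filter.1 hψ).1).2
    have h2 := (mem_primChars.1 (mem_filter.1 hχ).1).2
    have h3 := congrArg DirichletCharacter.conductor h
    rw [DirichletCharacter.conductor_changeLevel, DirichletCharacter.conductor_changeLevel,
      (DirichletCharacter.isPrimitive_def _).1 h1, (DirichletCharacter.isPrimitive_def _).1 h2] at h3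
    obtain rfl : q = r := Nat.succ_injective h3
    exact congrArg (Sigma.mk q) (DirichletCharacter.changeLevel_injective _ h)
  · intro χ _
    have key : ∀ (c : ℕ) (ψ : DirichletCharacter ℂ c) (hc : c ∣ d), ψ.IsPrimitive →
        DirichletCharacter.changeLevel hc ψ = χ →
        ∃ (ρ : CharIdx) (hρ : ρ ∈ (primChars D).filter fun ρ : CharIdx => ρ.1 + 1 ∣ d),
          DirichletCharacter.changeLevel (mem_filter.1 hρ).2 ρ.2 = χ := by
      intro c ψ hc hp hχ
      obtain ⟨m, rfl⟩ : ∃ m, c = m + 1 := Nat.exists_eq_succ_of_ne_zero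
        (ne_zero_of_dvd_ne_zero (NeZero.ne d) hc)
      exact ⟨⟨m, ψ⟩, mem_filter.2 ⟨mem_primChars.2
        ⟨(Nat.le_of_dvd (NeZero.pos d) hc).trans hdD, hp⟩, hc⟩, hχ⟩
    exact key _ _ χ.conductor_dvd_level χ.primitiveCharacter_isPrimitive
      χ.changeLevel_primitiveCharacter
  · intro ψ hψ
    rw [DirichletCharacter.changeLevel_eq_cast_of_dvd' _ _ ha,
      DirichletCharacter.changeLevel_eq_cast_of_dvd' _ _ hb]

theorem indicator_dvd_add_two_eq {d D n : ℕ} (hd : Odd d) (hdD : d ≤ D) (hn : n.Coprime d) :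
    (if d ∣ n + 2 then 1 else 0 : ℂ) =
      ∑ ψ ∈ primChars D with ψ.1 + 1 ∣ d, ψ.2 n * (starRingEnd ℂ) (ψ.2 (-2)) / d.totient := by
  have : NeZero d := ⟨hd.pos.ne'⟩
  have hφ : (d.totient : ℂ) ≠ 0 := by exact_mod_cast (Nat.totient_pos.2 hd.pos).ne'
  have h2 : IsCoprime (-2 : ℤ) d := by
    rw [IsCoprime.neg_left_iff]
    exact_mod_cast Nat.isCoprime_iff_coprime.2 (Nat.coprime_two_left.2 hd)
  have hn' : IsCoprime (n : ℤ) d := Nat.isCoprime_iff_coprime.2 hn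
  have h := sum_char_eq_sum_primChars hdD hn' h2
  rw [sum_char_mul_conj] at h
  have hu : IsUnit ((-2 : ℤ) : ZMod d) := (ZMod.coe_int_isUnit_iff_isCoprime _ _).2 h2.symm
  have he : (((n : ℤ) : ZMod d) = ((-2 : ℤ) : ZMod d)) ↔ d ∣ n + 2 := by
    rw [← ZMod.natCast_eq_zero_iff]
    push_cast
    rw [eq_neg_iff_add_eq_zero]
  simp only [hu, he, true_and] at h
  rw [← Finset.sum_div, eq_div_iff hφ, ite_mul, one_mul, zero_mul, h]
  simp

theorem sum_mul_sq_eq_sum_primChars {A P : Finset ℕ} {V : ℕ} (hA : ∀ d ∈ A, Odd d ∧ d ≤ V)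
    (hP : ∀ n ∈ P, ∀ d ∈ A, n.Coprime d) (l w : ℕ → ℝ) :
    ((∑ n ∈ P, w n * (∑ d ∈ A with d ∣ n + 2, l d) ^ 2 : ℝ) : ℂ) =
      ∑ ψ ∈ primChars (V ^ 2), (starRingEnd ℂ) (ψ.2 (-2)) *
        ((∑ d ∈ A, ∑ e ∈ A, if ψ.1 + 1 ∣ d.lcm e then l d * l e / (d.lcm e).totient else 0 : ℝ) : ℂ) *
        ∑ n ∈ P, (w n : ℂ) * ψ.2 n := by
  have h1 : ∀ n ∈ P, (((∑ d ∈ A with d ∣ n + 2, l d) ^ 2 : ℝ) : ℂ) =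
      ∑ d ∈ A, ∑ e ∈ A, ∑ ψ ∈ primChars (V ^ 2), (starRingEnd ℂ) (ψ.2 (-2)) *
        ((if ψ.1 + 1 ∣ d.lcm e then l d * l e / (d.lcm e).totient else 0 : ℝ) : ℂ) * ψ.2 n := by
    intro n hn
    rw [sq, Finset.sum_filter, Finset.sum_mul_sum]
    push_cast
    refine Finset.sum_congr rfl fun d hd => Finset.sum_congr rfl fun e he => ?_
    have hodd : Odd (d.lcm e) := Odd.of_dvd_nat ((hA d hd).1.mul (hA e he).1) (Nat.lcm_dvd_mul d e)
    have hle : d.lcm e ≤ V ^ 2 := by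
      refine (Nat.le_of_dvd (Nat.mul_pos (hA d hd).1.pos (hA e he).1.pos) (Nat.lcm_dvd_mul d e)).trans ?_
      rw [sq]; exact Nat.mul_le_mul (hA d hd).2 (hA e he).2
    have hcop : n.Coprime (d.lcm e) :=
      Nat.Coprime.coprime_dvd_right (Nat.lcm_dvd_mul d e) ((hP n hn d hd).mul_right (hP n hn e he))
    have h2 := indicator_dvd_add_two_eq hodd hle hcop
    have h3 : ((if d ∣ n + 2 then l d else 0 : ℝ) : ℂ) * ((if e ∣ n + 2 then l e else 0 : ℝ) : ℂ) =
        l d * l e * (if d.lcm e ∣ n + 2 then 1 else 0 : ℂ) := by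
      by_cases hd' : d ∣ n + 2 <;> by_cases he' : e ∣ n + 2 <;> simp [hd', he', Nat.lcm_dvd_iff]
    rw [h3, h2, Finset.mul_sum, Finset.sum_filter]
    refine Finset.sum_congr rfl fun ψ _ => ?_
    split_ifs
    · push_cast; ring
    · simp
  have h2 : ∀ n ∈ P, (((∑ d ∈ A with d ∣ n + 2, l d) ^ 2 : ℝ) : ℂ) =
      ∑ ψ ∈ primChars (V ^ 2), (starRingEnd ℂ) (ψ.2 (-2)) *
        ((∑ d ∈ A, ∑ e ∈ A, if ψ.1 + 1 ∣ d.lcm e then l d * l e / (d.lcm e).totient else 0 : ℝ) : ℂ) *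
        ψ.2 n := by
    intro n hn
    rw [h1 n hn]
    symm
    simp_rw [Complex.ofReal_sum, Finset.mul_sum, Finset.sum_mul]
    rw [Finset.sum_comm]
    exact Finset.sum_congr rfl fun d _ => Finset.sum_comm
  rw [Complex.ofReal_sum]
  calc _ = ∑ n ∈ P, (w n : ℂ) * ∑ ψ ∈ primChars (V ^ 2), (starRingEnd ℂ) (ψ.2 (-2)) *
        ((∑ d ∈ A, ∑ e ∈ A, if ψ.1 + 1 ∣ d.lcm e then l d * l e / (d.lcm e).totient else 0 : ℝ) : ℂ) *
        ψ.2 n := Finset.sum_congr rfl fun n hn => by rw [Complex.ofReal_mul, h2 n hn]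
    _ = _ := by
      clear h1 h2
      simp_rw [Finset.mul_sum (s := P)]
      rw [← Finset.sum_comm]
      simp_rw [Finset.mul_sum (s := primChars (V ^ 2))]
      refine Finset.sum_congr rfl fun n _ => Finset.sum_congr rfl fun ψ _ => ?_
      ring

end TwinSieve

namespace TwinSieve
open Finset

theorem prod_primeFactors_mul_of_coprime {M : Type*} [CommMonoid M] (g : ℕ → M) {m n : ℕ}
    (h : m.Coprime n) :
    ∏ p ∈ (m * n).primeFactors, g p = (∏ p ∈ m.primeFactors, g p) * ∏ p ∈ n.primeFactors, g p := by
  rw [h.primeFactors_mul, Finset.prod_union h.disjoint_primeFactors]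

theorem sum_divisors_prod_primeFactors (g : ℕ → ℝ) {n : ℕ} (hn : Squarefree n) :
    ∑ d ∈ n.divisors, ∏ p ∈ d.primeFactors, g p = ∏ p ∈ n.primeFactors, (1 + g p) := by
  have h := (ArithmeticFunction.IsMultiplicative.prodPrimeFactors g).prodPrimeFactors_one_add_of_squarefree hn
  symm
  refine (Finset.prod_congr rfl fun p hp => ?_).trans (h.trans (Finset.sum_congr rfl fun d hd => ?_))
  · have hp := Nat.prime_of_mem_primeFactors hp
    rw [ArithmeticFunction.prodPrimeFactors_apply hp.ne_zero, hp.primeFactors, prod_singleton]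
  · exact ArithmeticFunction.prodPrimeFactors_apply (Nat.pos_of_mem_divisors hd).ne'

theorem totient_of_squarefree {n : ℕ} (hn : Squarefree n) :
    (n.totient : ℝ) = ∏ p ∈ n.primeFactors, ((p:ℝ) - 1) := by
  have h := Nat.totient_mul_prod_primeFactors n
  rw [Nat.prod_primeFactors_of_squarefree hn, mul_comm] at h
  rw [Nat.eq_of_mul_eq_mul_left hn.ne_zero.bot_lt h]
  push_cast
  refine Finset.prod_congr rfl fun p hp => ?_
  rw [Nat.cast_sub (Nat.prime_of_mem_primeFactors hp).one_le, Nat.cast_one]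

theorem card_divisors_of_squarefree {n : ℕ} (hn : Squarefree n) :
    (n.divisors.card : ℝ) = ∏ _p ∈ n.primeFactors, 2 := by
  have h := sum_divisors_prod_primeFactors (fun _ => 1) hn
  simp only [Finset.prod_const_one, Finset.sum_const, nsmul_eq_mul, mul_one] at h
  rw [h]; norm_num

/-- The multiplicative function `f` with `f p = p - 2`, attached to the residue class `-2`
among primes. -/
noncomputable def twinF (n : ℕ) : ℝ := ∏ p ∈ n.primeFactors, ((p:ℝ) - 2)

/-- Odd squarefree numbers up to `V`. -/
def oddSqfree (V : ℕ) : Finset ℕ := (sqfreeUpTo V).filter Odd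

theorem mem_oddSqfree {V d : ℕ} : d ∈ oddSqfree V ↔ ((0 < d ∧ d ≤ V) ∧ Squarefree d) ∧ Odd d := by
  simp [oddSqfree, mem_sqfreeUpTo]

theorem three_le_of_mem_primeFactors {n p : ℕ} (hn : Odd n) (hp : p ∈ n.primeFactors) : 3 ≤ p := by
  have h1 := Nat.prime_of_mem_primeFactors hp
  have h2 : Odd p := Odd.of_dvd_nat hn (Nat.dvd_of_mem_primeFactors hp)
  have h3 := h1.two_le
  obtain ⟨k, hk⟩ := h2
  omega

theorem one_le_twinF {n : ℕ} (hn : Odd n) : 1 ≤ twinF n := by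
  rw [twinF, ← Finset.prod_const_one (s := n.primeFactors)]
  refine Finset.prod_le_prod (fun _ _ => zero_le_one) fun p hp => ?_
  have : (3:ℝ) ≤ p := by exact_mod_cast three_le_of_mem_primeFactors hn hp
  linarith

theorem sieveData_twinF {V : ℕ} (hV : 1 ≤ V) : SieveData (oddSqfree V) twinF where
  one_mem := mem_oddSqfree.2 ⟨⟨⟨one_pos, hV⟩, squarefree_one⟩, odd_one⟩
  squarefree d hd := (mem_oddSqfree.1 hd).1.2
  mem_of_dvd d hd e he := by
    rw [mem_oddSqfree] at hd ⊢
    obtain ⟨⟨⟨h1, h2⟩, h3⟩, h4⟩ := hd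
    exact ⟨⟨⟨Nat.pos_of_dvd_of_pos he h1, (Nat.le_of_dvd h1 he).trans h2⟩,
      h3.squarefree_of_dvd he⟩, Odd.of_dvd_nat h4 he⟩
  map_one := by simp [twinF]
  map_mul m n h := prod_primeFactors_mul_of_coprime _ h
  one_le d hd := one_le_twinF (mem_oddSqfree.1 hd).2

theorem sum_divisors_twinF {n : ℕ} (hn : Squarefree n) :
    ∑ k ∈ n.divisors, twinF k = n.totient := by
  rw [totient_of_squarefree hn]
  simp only [twinF]
  rw [sum_divisors_prod_primeFactors _ hn]
  exact Finset.prod_congr rfl fun p _ => by ring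

theorem totient_lcm_mul_totient_gcd (a b : ℕ) :
    (a.lcm b).totient * (a.gcd b).totient = a.totient * b.totient := by
  rcases eq_or_ne (a.gcd b) 0 with h | h
  · rw [Nat.gcd_eq_zero_iff] at h
    simp [h.1, h.2]
  have h1 := Nat.totient_gcd_mul_totient_mul a b
  have h2 := Nat.totient_gcd_mul_totient_mul (a.gcd b) (a.lcm b)
  have h3 : (a.gcd b).gcd (a.lcm b) = a.gcd b :=
    Nat.gcd_eq_left ((Nat.gcd_dvd_left a b).trans (Nat.dvd_lcm_left a b))
  rw [h3, Nat.gcd_mul_lcm, h1] at h2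
  have := Nat.eq_of_mul_eq_mul_right h.bot_lt h2
  rw [this, mul_comm]

theorem exists_card_divisors_pow_div_twinF_le {κ : ℝ} (hκ : 0 < κ) :
    ∃ C : ℝ, 0 < C ∧ ∀ q : ℕ, Squarefree q → Odd q →
      (q.divisors.card : ℝ) ^ 5 / twinF q ≤ C * (q:ℝ) ^ (κ - 1) := by
  obtain ⟨K, hK⟩ : ∃ K : ℕ, ∀ p : ℕ, K ≤ p → 96 ≤ (p:ℝ) ^ κ := by
    have h := ((tendsto_rpow_atTop hκ).comp tendsto_natCast_atTop_atTop).eventually_ge_atTop 96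
    exact Filter.eventually_atTop.1 h
  refine ⟨96 ^ K, by positivity, fun q hq hodd => ?_⟩
  have h1 : (q.divisors.card : ℝ) ^ 5 / twinF q ≤
      ∏ p ∈ q.primeFactors, ((if p < K then 96 else 1) * (p:ℝ) ^ (κ - 1)) := by
    rw [card_divisors_of_squarefree hq, ← Finset.prod_pow, twinF, ← Finset.prod_div_distrib]
    refine Finset.prod_le_prod (fun p hp => ?_) fun p hp => ?_
    all_goals
      have h3 : (3:ℝ) ≤ p := by exact_mod_cast three_le_of_mem_primeFactors hodd hp
    · have : (0:ℝ) < p - 2 := by linarith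
      positivity
    · have hp0 : (0:ℝ) < p := by linarith
      rw [Real.rpow_sub_one hp0.ne', mul_div_assoc', div_le_div_iff₀ (by linarith) hp0]
      have h4 : 96 ≤ (if p < K then 96 else 1) * (p:ℝ) ^ κ := by
        split_ifs with h
        · have := Real.one_le_rpow (by linarith : (1:ℝ) ≤ p) hκ.le
          linarith
        · rw [one_mul]; exact hK p (not_lt.1 h)
      nlinarith
  have h2 : ∏ p ∈ q.primeFactors, (if p < K then 96 else 1 : ℝ) ≤ 96 ^ K := by
    rw [Finset.prod_ite, Finset.prod_const_one, mul_one, Finset.prod_const]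
    refine pow_le_pow_right₀ (by norm_num) ?_
    calc _ ≤ (range K).card := Finset.card_le_card fun p hp => mem_range.2 (mem_filter.1 hp).2
      _ = K := card_range K
  have h3 : ∏ p ∈ q.primeFactors, (p:ℝ) ^ (κ - 1) = (q:ℝ) ^ (κ - 1) := by
    rw [Real.finsetProd_rpow _ _ fun _ _ => Nat.cast_nonneg _]
    congr 1
    rw [← Nat.cast_prod, Nat.prod_primeFactors_of_squarefree hq]
  rw [Finset.prod_mul_distrib, h3] at h1
  exact h1.trans (mul_le_mul_of_nonneg_right h2 (by positivity))

/-- Selberg weights for detecting primes `p` with `p + 2` free of small odd prime factors. -/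
noncomputable def twinWeight (V d : ℕ) : ℝ := d.totient * selU (oddSqfree V) twinF d

theorem abs_sum_twinWeight_le {V q : ℕ} (hV : 1 ≤ V) (hq : Squarefree q) (hodd : Odd q) :
    |∑ d ∈ oddSqfree V, ∑ e ∈ oddSqfree V,
      if q ∣ d.lcm e then twinWeight V d * twinWeight V e / (d.lcm e).totient else 0| ≤
      (q.divisors.card : ℝ) ^ 5 / (twinF q * selG (oddSqfree V) twinF) := by
  refine le_trans (le_of_eq (congrArg _ ?_)) ((sieveData_twinF hV).abs_sum_sum_selU_le hq
    fun e he => one_le_twinF (Odd.of_dvd_nat hodd (Nat.dvd_of_mem_divisors he)))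
  refine Finset.sum_congr rfl fun d hd => Finset.sum_congr rfl fun e he => ?_
  split_ifs
  · rw [mem_oddSqfree] at hd he
    rw [sum_divisors_twinF (hd.1.2.squarefree_of_dvd (Nat.gcd_dvd_left d e)), twinWeight, twinWeight]
    have h : (((d.lcm e).totient : ℝ)) * (d.gcd e).totient = d.totient * e.totient := by
      exact_mod_cast totient_lcm_mul_totient_gcd d e
    have hpos : ((d.lcm e).totient : ℝ) ≠ 0 := by
      have := Nat.totient_pos.2 (Nat.lcm_pos hd.1.1.1 he.1.1.1)
      exact_mod_cast this.ne'
    rw [div_eq_iff hpos]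
    linear_combination (-(selU (oddSqfree V) twinF d * selU (oddSqfree V) twinF e)) * h
  · rfl

theorem sum_twinWeight_eq_zero {V q : ℕ} (hq : ¬ (Squarefree q ∧ Odd q)) :
    ∑ d ∈ oddSqfree V, ∑ e ∈ oddSqfree V,
      (if q ∣ d.lcm e then twinWeight V d * twinWeight V e / (d.lcm e).totient else 0) = 0 := by
  refine Finset.sum_eq_zero fun d hd => Finset.sum_eq_zero fun e he => if_neg fun h => hq ?_
  rw [mem_oddSqfree] at hd he
  refine ⟨Squarefree.squarefree_of_dvd h ?_,
    Odd.of_dvd_nat (hd.2.mul he.2) (h.trans (Nat.lcm_dvd_mul d e))⟩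
  rw [Nat.squarefree_iff_factorization_le_one (Nat.lcm_pos hd.1.1.1 he.1.1.1).ne']
  intro p
  rw [Nat.factorization_lcm hd.1.1.1.ne' he.1.1.1.ne']
  exact max_le (hd.1.2.natFactorization_le_one p) (he.1.2.natFactorization_le_one p)

theorem exists_sum_mul_sq_twinWeight_le {κ : ℝ} (hκ : 0 < κ) : ∃ C : ℝ, 0 < C ∧
    ∀ (V : ℕ) (P : Finset ℕ) (w : ℕ → ℝ), 1 ≤ V →
      (∀ n ∈ P, ∀ d ∈ oddSqfree V, n.Coprime d) → (∀ n ∈ P, 0 ≤ w n) →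
      ∑ n ∈ P, w n * (∑ d ∈ oddSqfree V with d ∣ n + 2, twinWeight V d) ^ 2 ≤
        1 / selG (oddSqfree V) twinF * (∑ n ∈ P, w n +
          C * ∑ χ ∈ ntChars (V ^ 2), ((χ.1 + 1 : ℕ) : ℝ) ^ (κ - 1) *
            ‖∑ n ∈ P, (w n : ℂ) * χ.2 n‖) := by
  obtain ⟨C, hC, hτ⟩ := exists_card_divisors_pow_div_twinF_le hκ
  refine ⟨C, hC, fun V P w hV hP hw => ?_⟩
  have h := sum_mul_sq_eq_sum_primChars (V := V) (fun d hd => ⟨(mem_oddSqfree.1 hd).2,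
    (mem_oddSqfree.1 hd).1.1.2⟩) hP (twinWeight V) w
  set S := ∑ n ∈ P, w n * (∑ d ∈ oddSqfree V with d ∣ n + 2, twinWeight V d) ^ 2 with hS
  have hS0 : 0 ≤ S := Finset.sum_nonneg fun n hn => mul_nonneg (hw n hn) (sq_nonneg _)
  have hG : 1 ≤ selG (oddSqfree V) twinF := (sieveData_twinF hV).selG_ge_one
  set G := selG (oddSqfree V) twinF
  have hG0 : 0 < G := by linarith
  have h1 : S = ‖(S : ℂ)‖ := by rw [Complex.norm_real, Real.norm_of_nonneg hS0]
  rw [h1, h]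
  have hterm : ∀ χ : CharIdx, ‖(starRingEnd ℂ) (χ.2 (-2)) *
      ((∑ d ∈ oddSqfree V, ∑ e ∈ oddSqfree V, if χ.1 + 1 ∣ d.lcm e then
        twinWeight V d * twinWeight V e / (d.lcm e).totient else 0 : ℝ) : ℂ) *
        ∑ n ∈ P, (w n : ℂ) * χ.2 n‖ ≤
      |∑ d ∈ oddSqfree V, ∑ e ∈ oddSqfree V, if χ.1 + 1 ∣ d.lcm e then
        twinWeight V d * twinWeight V e / (d.lcm e).totient else 0| *
        ‖∑ n ∈ P, (w n : ℂ) * χ.2 n‖ := by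
    intro χ
    rw [norm_mul, norm_mul, Complex.norm_real, Real.norm_eq_abs]
    refine mul_le_mul_of_nonneg_right (mul_le_of_le_one_left (abs_nonneg _) ?_) (norm_nonneg _)
    rw [RCLike.norm_conj]
    exact χ.2.norm_le_one _
  refine (norm_sum_le_of_le _ fun χ _ => hterm χ).trans ?_
  rw [← Finset.sum_filter_add_sum_filter_not (primChars (V ^ 2)) fun χ => χ.1 ≠ 0, add_comm, mul_add]
  refine add_le_add ?_ ?_
  · have hsub : (primChars (V ^ 2)).filter (fun χ => ¬ χ.1 ≠ 0) ⊆ {(⟨0, 1⟩ : CharIdx)} := by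
      rintro ⟨q, χ⟩ hχ
      obtain rfl : q = 0 := not_not.1 (mem_filter.1 hχ).2
      rw [mem_singleton]
      exact congrArg (Sigma.mk 0) (DirichletCharacter.level_one χ)
    refine (Finset.sum_le_sum_of_subset_of_nonneg hsub fun _ _ _ => by positivity).trans ?_
    rw [Finset.sum_singleton]
    refine mul_le_mul ?_ ?_ (norm_nonneg _) (by positivity)
    · have := abs_sum_twinWeight_le (q := 1) hV squarefree_one odd_one
      simpa [twinF] using this
    · refine norm_sum_le_of_le _ fun n hn => ?_
      rw [norm_mul, Complex.norm_real, Real.norm_of_nonneg (hw n hn)]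
      exact mul_le_of_le_one_right (hw n hn) (DirichletCharacter.norm_le_one _ _)
  · rw [← ntChars, Finset.mul_sum, Finset.mul_sum]
    refine Finset.sum_le_sum fun χ _ => ?_
    rw [← mul_assoc, ← mul_assoc]
    refine mul_le_mul_of_nonneg_right ?_ (norm_nonneg _)
    by_cases hq : Squarefree (χ.1 + 1) ∧ Odd (χ.1 + 1)
    · refine (abs_sum_twinWeight_le hV hq.1 hq.2).trans ?_
      rw [← div_div, div_eq_mul_one_div, mul_comm, mul_assoc]
      exact mul_le_mul_of_nonneg_left (hτ _ hq.1 hq.2) (by positivity)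
    · rw [sum_twinWeight_eq_zero hq, abs_zero]
      positivity

end TwinSieve

namespace TwinSieve
open Finset

theorem squarefree_prod_of_primes {s : Finset ℕ} (hs : ∀ p ∈ s, p.Prime) :
    Squarefree (∏ p ∈ s, p) := by
  refine Finset.squarefree_prod_of_pairwise_isCoprime (fun p hp q hq hpq => ?_)
    fun p hp => (hs p hp).prime.squarefree
  exact Nat.coprime_iff_isRelPrime.1 ((Nat.coprime_primes (hs p hp) (hs q hq)).2 hpq)

theorem sum_one_div_radical_fiber_le (N k : ℕ) (hk : Squarefree k) :
    ∑ n ∈ Ioc 0 N with ∏ p ∈ n.primeFactors, p = k, (1 / n : ℝ) ≤ 1 / k.totient := by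
  let f : ℕ →* ℝ :=
    { toFun := fun n => 1 / n
      map_one' := by simp
      map_mul' := fun a b => by push_cast; rw [one_div_mul_one_div] }
  have hf : ∀ {p : ℕ}, p.Prime → ‖f p‖ < 1 := by
    intro p hp
    have : (1:ℝ) < p := by exact_mod_cast hp.one_lt
    change ‖(1 / p : ℝ)‖ < 1
    rw [Real.norm_of_nonneg (by positivity), div_lt_one (by positivity)]
    exact this
  obtain ⟨-, hsum⟩ :=
    EulerProduct.summable_and_hasSum_factoredNumbers_prod_filter_prime_geometric hf k.primeFactors
  have hk0 : (0:ℝ) < k := by exact_mod_cast hk.ne_zero.bot_lt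
  set S := (Ioc 0 N).filter fun n => ∏ p ∈ n.primeFactors, p = k with hS
  have hdvd : ∀ n ∈ S, k ∣ n := fun n hn => by
    rw [← (mem_filter.1 hn).2]; exact Nat.prod_primeFactors_dvd n
  have hpos : ∀ n ∈ S, 0 < n := fun n hn => (mem_Ioc.1 (mem_filter.1 hn).1).1
  have hmem : ∀ n ∈ S, n / k ∈ Nat.factoredNumbers k.primeFactors := by
    intro n hn
    rw [Nat.mem_factoredNumbers_iff_primeFactors_subset]
    obtain ⟨m, rfl⟩ := hdvd n hn
    rw [Nat.mul_div_cancel_left _ hk.ne_zero.bot_lt]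
    have h0 := hpos _ hn
    have hm : m ≠ 0 := by rintro rfl; simp at h0
    refine ⟨hm, ?_⟩
    have h1 := (mem_filter.1 hn).2
    rw [← h1, Nat.primeFactors_prod fun p hp => Nat.prime_of_mem_primeFactors hp]
    exact Nat.primeFactors_mono (Dvd.intro_left _ rfl) h0.ne'
  have hle : ∑ n ∈ S, f (n / k) ≤ ∏ p ∈ k.primeFactors with p.Prime, (1 - f p)⁻¹ := by
    have h1 : ∑ n ∈ S.attach, f (n / k) =
        ∑ m ∈ S.attach.image fun n : {x // x ∈ S} =>
          (⟨n / k, hmem n n.2⟩ : Nat.factoredNumbers k.primeFactors), f m := by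
      rw [Finset.sum_image]
      intro a _ b _ hab
      have : (a:ℕ) / k = b / k := congrArg Subtype.val hab
      exact Subtype.ext ((Nat.div_left_inj (hdvd a a.2) (hdvd b b.2)).1 this)
    rw [← Finset.sum_attach, h1]
    exact sum_le_hasSum _ (fun m _ => by change (0:ℝ) ≤ 1 / _; positivity) hsum
  calc ∑ n ∈ S, (1 / n : ℝ) = 1 / k * ∑ n ∈ S, f (n / k) := by
        rw [Finset.mul_sum]
        refine Finset.sum_congr rfl fun n hn => ?_
        change (1 / n : ℝ) = 1 / k * (1 / ((n / k : ℕ) : ℝ))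
        rw [Nat.cast_div (hdvd n hn) hk0.ne']
        have : (n:ℝ) ≠ 0 := by exact_mod_cast (hpos n hn).ne'
        field_simp
    _ ≤ 1 / k * ∏ p ∈ k.primeFactors with p.Prime, (1 - f p)⁻¹ := by gcongr
    _ = 1 / k.totient := by
        have h2 : (k:ℝ) = ∏ p ∈ k.primeFactors, (p:ℝ) := by
          rw [← Nat.cast_prod, Nat.prod_primeFactors_of_squarefree hk]
        rw [Finset.filter_true_of_mem fun p hp => Nat.prime_of_mem_primeFactors hp,
          totient_of_squarefree hk, one_div, one_div, h2, ← Finset.prod_inv_distrib,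
          ← Finset.prod_inv_distrib, ← Finset.prod_mul_distrib]
        refine Finset.prod_congr rfl fun p hp => ?_
        have : (1:ℝ) < p := by exact_mod_cast (Nat.prime_of_mem_primeFactors hp).one_lt
        change (p:ℝ)⁻¹ * (1 - 1 / (p:ℝ))⁻¹ = _
        rw [← mul_inv]
        congr 1
        field_simp

theorem sum_one_div_le_sum_sqfree (N : ℕ) :
    ∑ n ∈ Ioc 0 N, (1 / n : ℝ) ≤ ∑ k ∈ sqfreeUpTo N, (1 / k.totient : ℝ) := by
  rw [← Finset.sum_fiberwise_of_maps_to (s := Ioc 0 N) (t := sqfreeUpTo N)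
    (g := fun n => ∏ p ∈ n.primeFactors, p)]
  · exact Finset.sum_le_sum fun k hk =>
      sum_one_div_radical_fiber_le N k (mem_sqfreeUpTo.1 hk).2
  · intro n hn
    rw [mem_Ioc] at hn
    have hp : ∀ p ∈ n.primeFactors, p.Prime := fun p hp => Nat.prime_of_mem_primeFactors hp
    exact mem_sqfreeUpTo.2 ⟨⟨Finset.prod_pos fun p h => (hp p h).pos,
      (Nat.le_of_dvd hn.1 (Nat.prod_primeFactors_dvd n)).trans hn.2⟩, squarefree_prod_of_primes hp⟩

theorem sum_sqfree_le_mul (N : ℕ) {M : ℕ} (hM : M ≠ 0) :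
    ∑ k ∈ sqfreeUpTo N, (1 / k.totient : ℝ) ≤ (∑ a ∈ M.divisors, (1 / a.totient : ℝ)) *
      ∑ k ∈ sqfreeUpTo N with k.Coprime M, (1 / k.totient : ℝ) := by
  rw [Finset.sum_mul_sum, ← Finset.sum_product']
  have hcop : ∀ k ∈ sqfreeUpTo N, (k.gcd M).Coprime (k / k.gcd M) := by
    intro k hk
    have h := (mem_sqfreeUpTo.1 hk).2
    exact Nat.coprime_of_squarefree_mul (by rwa [Nat.mul_div_cancel' (Nat.gcd_dvd_left k M)])
  calc ∑ k ∈ sqfreeUpTo N, (1 / k.totient : ℝ)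
      = ∑ k ∈ sqfreeUpTo N, 1 / ((k.gcd M).totient : ℝ) * (1 / ((k / k.gcd M).totient : ℝ)) := by
        refine Finset.sum_congr rfl fun k hk => ?_
        rw [one_div_mul_one_div, ← Nat.cast_mul, ← Nat.totient_mul (hcop k hk),
          Nat.mul_div_cancel' (Nat.gcd_dvd_left k M)]
    _ = ∑ x ∈ (sqfreeUpTo N).image fun k => (k.gcd M, k / k.gcd M),
          1 / (x.1.totient : ℝ) * (1 / (x.2.totient : ℝ)) := by
        rw [Finset.sum_image]
        intro a _ b _ hab
        rw [Prod.mk.injEq] at hab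
        rw [← Nat.mul_div_cancel' (Nat.gcd_dvd_left a M), hab.2, hab.1,
          Nat.mul_div_cancel' (Nat.gcd_dvd_left b M)]
    _ ≤ _ := by
        refine Finset.sum_le_sum_of_subset_of_nonneg (fun x hx => ?_) fun _ _ _ => by positivity
        obtain ⟨k, hk, rfl⟩ := mem_image.1 hx
        have hc := hcop k hk
        obtain ⟨⟨h0, h1⟩, h2⟩ := mem_sqfreeUpTo.1 hk
        have hd : k / k.gcd M ∣ k := Nat.div_dvd_of_dvd (Nat.gcd_dvd_left k M)
        refine mem_product.2 ⟨Nat.mem_divisors.2 ⟨Nat.gcd_dvd_right k M, hM⟩,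
          mem_filter.2 ⟨mem_sqfreeUpTo.2 ⟨⟨Nat.pos_of_dvd_of_pos hd h0,
            (Nat.le_of_dvd h0 hd).trans h1⟩, h2.squarefree_of_dvd hd⟩, ?_⟩⟩
        have h3 : (k / k.gcd M).gcd M ∣ k.gcd M := Nat.gcd_dvd_gcd_of_dvd_left M hd
        exact Nat.eq_one_of_dvd_coprimes hc h3 (Nat.gcd_dvd_left _ _)

theorem twinF_le_totient {n : ℕ} (hn : Odd n) (hs : Squarefree n) : twinF n ≤ n.totient := by
  rw [totient_of_squarefree hs]
  refine Finset.prod_le_prod (fun p hp => ?_) fun p hp => by linarith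
  have : (3:ℝ) ≤ p := by exact_mod_cast three_le_of_mem_primeFactors hn hp
  linarith

theorem sum_mul_sum_le_selG {P : ℕ} (hP : Odd P) (hPs : Squarefree P) (V : ℕ) :
    (∑ a ∈ P.divisors, 1 / twinF a) *
      ∑ k ∈ sqfreeUpTo (V / P) with k.Coprime (2 * P), (1 / k.totient : ℝ) ≤
      selG (oddSqfree V) twinF := by
  rw [Finset.sum_mul_sum, ← Finset.sum_product', selG]
  have hPpos : 0 < P := hP.pos
  have key : ∀ x ∈ P.divisors ×ˢ (sqfreeUpTo (V / P)).filter (fun k => k.Coprime (2 * P)),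
      x.1 ∣ P ∧ x.2.Coprime P ∧ x.1.Coprime x.2 ∧ Odd x.2 ∧ Squarefree x.2 ∧
        0 < x.2 ∧ x.2 ≤ V / P := by
    intro x hx
    obtain ⟨h1, h2⟩ := mem_product.1 hx
    obtain ⟨h2, h3⟩ := mem_filter.1 h2
    obtain ⟨⟨h4, h5⟩, h6⟩ := mem_sqfreeUpTo.1 h2
    have h7 := Nat.dvd_of_mem_divisors h1
    have h8 := (Nat.coprime_mul_iff_right.1 h3)
    exact ⟨h7, h8.2, (Nat.Coprime.coprime_dvd_right h7 h8.2).symm,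
      Nat.coprime_two_right.1 h8.1, h6, h4, h5⟩
  calc _ ≤ ∑ x ∈ P.divisors ×ˢ (sqfreeUpTo (V / P)).filter (fun k => k.Coprime (2 * P)),
          1 / twinF (x.1 * x.2) := by
        refine Finset.sum_le_sum fun x hx => ?_
        obtain ⟨h1, h2, h3, h4, h5, h6, h7⟩ := key x hx
        have h8 : Odd x.1 := Odd.of_dvd_nat hP h1
        rw [twinF, twinF, prod_primeFactors_mul_of_coprime _ h3, ← one_div_mul_one_div]
        change 1 / twinF x.1 * _ ≤ 1 / twinF x.1 * (1 / twinF x.2)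
        have h9 := one_le_twinF h8
        have h10 := one_le_twinF h4
        gcongr
        exact twinF_le_totient h4 h5
    _ = ∑ n ∈ (P.divisors ×ˢ (sqfreeUpTo (V / P)).filter (fun k => k.Coprime (2 * P))).image
          fun x => x.1 * x.2, 1 / twinF n := by
        rw [Finset.sum_image]
        intro x hx y hy hxy
        obtain ⟨h1, h2, -⟩ := key x hx
        obtain ⟨k1, k2, -, -, -, k6, -⟩ := key y hy
        have hxy : x.1 * x.2 = y.1 * y.2 := hxy
        have e1 : (x.1 * x.2).gcd P = x.1 := by
          rw [Nat.Coprime.gcd_mul_right_cancel _ h2]; exact Nat.gcd_eq_left h1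
        have e2 : (y.1 * y.2).gcd P = y.1 := by
          rw [Nat.Coprime.gcd_mul_right_cancel _ k2]; exact Nat.gcd_eq_left k1
        have e3 : x.1 = y.1 := by rw [← e1, ← e2, hxy]
        rw [e3] at hxy
        exact Prod.ext e3 (Nat.eq_of_mul_eq_mul_left (Nat.pos_of_dvd_of_pos k1 hPpos) hxy)
    _ ≤ _ := by
        refine Finset.sum_le_sum_of_subset_of_nonneg (fun n hn => ?_) fun n hn _ => ?_
        · obtain ⟨x, hx, rfl⟩ := mem_image.1 hn
          obtain ⟨h1, h2, h3, h4, h5, h6, h7⟩ := key x hx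
          refine mem_oddSqfree.2 ⟨⟨⟨Nat.mul_pos (Nat.pos_of_dvd_of_pos h1 hPpos) h6, ?_⟩,
            (Nat.squarefree_mul h3).2 ⟨hPs.squarefree_of_dvd h1, h5⟩⟩,
            (Odd.of_dvd_nat hP h1).mul h4⟩
          exact (Nat.mul_le_mul (Nat.le_of_dvd hPpos h1) h7).trans (Nat.mul_div_le V P)
        · have := one_le_twinF (mem_oddSqfree.1 hn).2
          positivity

end TwinSieve

namespace TwinSieve
open Finset Filter Topology

theorem sum_divisors_one_div_totient {M : ℕ} (hM : Squarefree M) :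
    ∑ a ∈ M.divisors, (1 / a.totient : ℝ) = ∏ p ∈ M.primeFactors, (1 + 1 / ((p:ℝ) - 1)) := by
  rw [← sum_divisors_prod_primeFactors _ hM]
  refine Finset.sum_congr rfl fun a ha => ?_
  rw [totient_of_squarefree (hM.squarefree_of_dvd (Nat.dvd_of_mem_divisors ha))]
  simp only [one_div, Finset.prod_inv_distrib]

theorem sum_divisors_one_div_twinF {M : ℕ} (hM : Squarefree M) :
    ∑ a ∈ M.divisors, (1 / twinF a : ℝ) = ∏ p ∈ M.primeFactors, (1 + 1 / ((p:ℝ) - 2)) := by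
  rw [← sum_divisors_prod_primeFactors _ hM]
  refine Finset.sum_congr rfl fun a _ => ?_
  simp only [twinF, one_div, Finset.prod_inv_distrib]

theorem log_le_mul_selG {P : ℕ} (hP : Odd P) (hPs : Squarefree P) {V : ℕ} (hV : 1 ≤ V) :
    Real.log V ≤ 2 * (∏ p ∈ P.primeFactors, (1 - 1 / ((p:ℝ) - 1) ^ 2)) *
      selG (oddSqfree V) twinF + Real.log P := by
  set G := selG (oddSqfree V) twinF
  have hP0 : (0:ℝ) < P := by exact_mod_cast hP.pos
  have hV0 : (0:ℝ) < V := by exact_mod_cast hV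
  have h1 : Real.log V ≤ Real.log ((V / P : ℕ) + 1 : ℝ) + Real.log P := by
    rw [← Real.log_mul (by positivity) hP0.ne']
    refine Real.log_le_log hV0 ?_
    have := (Nat.lt_mul_div_succ V hP.pos).le
    rw [mul_comm]
    exact_mod_cast this
  have hc : Nat.Coprime 2 P := (Nat.coprime_two_left).2 hP
  have hM : Squarefree (2 * P) := (Nat.squarefree_mul hc).2 ⟨Nat.prime_two.prime.squarefree, hPs⟩
  have h2 := (log_le_sum_one_div (V / P)).trans ((sum_one_div_le_sum_sqfree (V / P)).trans
    (sum_sqfree_le_mul (V / P) hM.ne_zero))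
  have h3 := sum_mul_sum_le_selG hP hPs V
  set S := ∑ k ∈ sqfreeUpTo (V / P) with k.Coprime (2 * P), (1 / k.totient : ℝ)
  rw [sum_divisors_one_div_totient hM, prod_primeFactors_mul_of_coprime _ hc,
    Nat.prime_two.primeFactors, Finset.prod_singleton] at h2
  rw [sum_divisors_one_div_twinF hPs] at h3
  have hge : ∀ p ∈ P.primeFactors, (3:ℝ) ≤ p := fun p hp => by
    exact_mod_cast three_le_of_mem_primeFactors hP hp
  have h4 : ∏ p ∈ P.primeFactors, (1 + 1 / ((p:ℝ) - 1)) =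
      (∏ p ∈ P.primeFactors, (1 - 1 / ((p:ℝ) - 1) ^ 2)) *
        ∏ p ∈ P.primeFactors, (1 + 1 / ((p:ℝ) - 2)) := by
    rw [← Finset.prod_mul_distrib]
    refine Finset.prod_congr rfl fun p hp => ?_
    have := hge p hp
    have h5 : (p:ℝ) - 1 ≠ 0 := by linarith
    have h6 : (p:ℝ) - 2 ≠ 0 := by linarith
    field_simp
    ring
  have h7 : 0 ≤ ∏ p ∈ P.primeFactors, (1 - 1 / ((p:ℝ) - 1) ^ 2) := by
    refine Finset.prod_nonneg fun p hp => ?_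
    have := hge p hp
    rw [sub_nonneg, div_le_one (by nlinarith)]
    nlinarith
  rw [h4] at h2
  calc Real.log V ≤ _ := h1
    _ ≤ (1 + 1 / (((2:ℕ):ℝ) - 1)) * ((∏ p ∈ P.primeFactors, (1 - 1 / ((p:ℝ) - 1) ^ 2)) *
        ∏ p ∈ P.primeFactors, (1 + 1 / ((p:ℝ) - 2))) * S + Real.log P := by gcongr
    _ = 2 * (∏ p ∈ P.primeFactors, (1 - 1 / ((p:ℝ) - 1) ^ 2)) *
        ((∏ p ∈ P.primeFactors, (1 + 1 / ((p:ℝ) - 2))) * S) + Real.log P := by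
          push_cast; ring
    _ ≤ _ := by gcongr

theorem summable_odd_primes : Summable fun p : {p : ℕ // p.Prime ∧ 2 < p} =>
    1 / (((p : ℕ) : ℝ) - 1) ^ 2 := by
  have h : Summable fun n : ℕ => 1 / ((n:ℝ) - 1) ^ 2 := by
    rw [← summable_nat_add_iff 1]
    refine (Real.summable_one_div_nat_pow.2 (by norm_num : 1 < 2)).congr fun n => ?_
    push_cast
    rw [add_sub_cancel_right]
  exact h.comp_injective Subtype.val_injective

theorem summable_norm_odd_primes : Summable fun p : {p : ℕ // p.Prime ∧ 2 < p} =>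
    ‖-(1 / (((p : ℕ) : ℝ) - 1) ^ 2)‖ := by
  refine summable_odd_primes.congr fun p => ?_
  rw [norm_neg, Real.norm_of_nonneg (by positivity)]

theorem one_sub_pos_of_odd_prime (p : {p : ℕ // p.Prime ∧ 2 < p}) :
    0 < 1 - 1 / (((p : ℕ) : ℝ) - 1) ^ 2 := by
  have : (3:ℝ) ≤ (p : ℕ) := by exact_mod_cast p.2.2
  rw [sub_pos, div_lt_one (by nlinarith)]
  nlinarith

theorem tendsto_prod_odd_primes :
    Tendsto (fun s : Finset {p : ℕ // p.Prime ∧ 2 < p} =>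
      2 * ∏ p ∈ s, (1 - 1 / (((p : ℕ) : ℝ) - 1) ^ 2)) atTop (𝓝 twinPrimeConst) := by
  have h := (multipliable_one_add_of_summable summable_norm_odd_primes).hasProd
  simp only [← sub_eq_add_neg] at h
  exact Tendsto.const_mul 2 (by simpa [HasProd] using h)

theorem twinPrimeConst_pos : 0 < twinPrimeConst := by
  have h := tprod_one_add_ne_zero_of_summable
    (fun p => by rw [← sub_eq_add_neg]; exact (one_sub_pos_of_odd_prime p).ne')
    summable_norm_odd_primes
  simp only [← sub_eq_add_neg] at h
  refine lt_of_le_of_ne (ge_of_tendsto' tendsto_prod_odd_primes fun s => ?_)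
    (mul_ne_zero two_ne_zero h).symm
  exact mul_nonneg zero_le_two (Finset.prod_nonneg fun p _ => (one_sub_pos_of_odd_prime p).le)

theorem exists_log_le_mul_selG {ε : ℝ} (hε : 0 < ε) : ∃ K : ℝ, ∀ V : ℕ, 1 ≤ V →
    Real.log V ≤ (twinPrimeConst + ε) * selG (oddSqfree V) twinF + K := by
  obtain ⟨s, hs⟩ := (tendsto_prod_odd_primes.eventually_le_const
    (by linarith : twinPrimeConst < twinPrimeConst + ε)).exists
  have hs' : 2 * ∏ p ∈ s.map (Function.Embedding.subtype _), (1 - 1 / ((p:ℝ) - 1) ^ 2) ≤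
      twinPrimeConst + ε := by
    rw [Finset.prod_map]; exact hs
  set t := s.map (Function.Embedding.subtype _)
  have ht : ∀ p ∈ t, p.Prime ∧ 2 < p := fun p hp => by
    obtain ⟨q, -, rfl⟩ := mem_map.1 hp
    exact q.2
  have hodd : Odd (∏ p ∈ t, p) :=
    Finset.prod_induction _ Odd (fun _ _ => Odd.mul) odd_one fun p hp =>
      (ht p hp).1.odd_of_ne_two (ht p hp).2.ne'
  refine ⟨Real.log (∏ p ∈ t, p : ℕ), fun V hV => ?_⟩
  have h := log_le_mul_selG hodd (squarefree_prod_of_primes fun p hp => (ht p hp).1) hV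
  rw [Nat.primeFactors_prod fun p hp => (ht p hp).1] at h
  have := (sieveData_twinF hV).selG_ge_one
  exact h.trans (by gcongr)

end TwinSieve

namespace TwinSieve
open Finset Filter Topology
open Real (posLog)
open scoped ArithmeticFunction.vonMangoldt

/-- A continuous weight on `[1, y]`, equal to `1` on `[1, x]`. -/
noncomputable def rieszWeight (x y : ℝ) (n : ℕ) : ℝ :=
  (posLog (y / n) - posLog (x / n)) / Real.log (y / x)

theorem rieszWeight_nonneg {x y : ℝ} (hx : 0 < x) (hxy : x < y) (n : ℕ) :
    0 ≤ rieszWeight x y n := by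
  refine div_nonneg (sub_nonneg.2 (Real.posLog_le_posLog (by positivity) (by gcongr)))
    (Real.log_nonneg ?_)
  rw [one_le_div hx]; exact hxy.le

theorem rieszWeight_le_one {x y : ℝ} (hx : 0 < x) (hxy : x < y) (n : ℕ) :
    rieszWeight x y n ≤ 1 := by
  have h1 : 1 < y / x := (one_lt_div hx).2 hxy
  rw [rieszWeight, div_le_one (Real.log_pos h1)]
  have h2 : y / n = y / x * (x / n) := by field_simp
  have h3 : posLog (y / x) = Real.log (y / x) :=
    Real.posLog_eq_log (by rw [abs_of_pos (by linarith)]; exact h1.le)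
  have h4 := Real.posLog_mul (x := y / x) (y := x / n)
  rw [← h2, h3] at h4
  linarith

theorem rieszWeight_eq_one {x y : ℝ} (hxy : x < y) {n : ℕ} (hn : 0 < n)
    (hnx : (n:ℝ) ≤ x) : rieszWeight x y n = 1 := by
  have hn0 : (0:ℝ) < n := by exact_mod_cast hn
  have hx : 0 < x := by linarith
  have hy : 0 < y := by linarith
  have h1 : 1 < y / x := (one_lt_div hx).2 hxy
  rw [rieszWeight, Real.posLog_eq_log, Real.posLog_eq_log, ← Real.log_div (by positivity)
    (by positivity), div_div_div_cancel_right₀ hn0.ne', div_self (Real.log_pos h1).ne']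
  · rw [abs_of_pos (by positivity), one_le_div hn0]; exact hnx
  · rw [abs_of_pos (by positivity), one_le_div hn0]; linarith

theorem rieszSum_sub_rieszSum (c : ℕ → ℂ) {x y : ℝ} (hx : 0 < x) (hxy : x < y) :
    rieszSum c y - rieszSum c x =
      Real.log (y / x) * ∑ n ∈ Ioc 0 ⌊y⌋₊, (rieszWeight x y n : ℂ) * c n := by
  have hL : Real.log (y / x) ≠ 0 := (Real.log_pos ((one_lt_div hx).2 hxy)).ne'
  rw [rieszSum_eq_sum c hx.le (Nat.floor_mono hxy.le), rieszSum, ← Finset.sum_sub_distrib,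
    Finset.mul_sum]
  refine Finset.sum_congr rfl fun n _ => ?_
  have : (Real.log (y / x) : ℂ) ≠ 0 := by exact_mod_cast hL
  rw [rieszWeight]
  push_cast
  field_simp

/-- Primes in `(√x, y]`. -/
noncomputable def primesRange (x y : ℝ) : Finset ℕ := (Ioc ⌊√x⌋₊ ⌊y⌋₊).filter Nat.Prime

theorem sum_vonMangoldt_sdiff_primesRange_le {x y : ℝ} (hx : 1 ≤ x) (hxy : x < y) :
    ∑ n ∈ Ioc 0 ⌊y⌋₊ \ primesRange x y, Λ n ≤ 6 * √x + 2 * √y * Real.log y := by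
  have hy : 1 ≤ y := by linarith
  have hN : 1 ≤ ⌊y⌋₊ := (Nat.one_le_floor_iff y).2 hy
  have hfl : (⌊y⌋₊ : ℝ) ≤ y := Nat.floor_le (by linarith)
  have hfl1 : (1:ℝ) ≤ ⌊y⌋₊ := by exact_mod_cast hN
  calc _ ≤ ∑ n ∈ Ioc 0 ⌊√x⌋₊ ∪ (Ioc 0 ⌊y⌋₊).filter (fun n => ¬ n.Prime), Λ n := by
        refine Finset.sum_le_sum_of_subset_of_nonneg (fun n hn => ?_)
          fun _ _ _ => ArithmeticFunction.vonMangoldt_nonneg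
        obtain ⟨h1, h2⟩ := mem_sdiff.1 hn
        rw [primesRange, mem_filter, mem_Ioc] at h2
        rw [mem_union, mem_filter, mem_Ioc]
        rw [mem_Ioc] at h1 ⊢
        by_cases hp : n.Prime
        · left
          exact ⟨h1.1, not_lt.1 fun h => h2 ⟨⟨h, h1.2⟩, hp⟩⟩
        · right; exact ⟨h1, hp⟩
    _ ≤ ∑ n ∈ Ioc 0 ⌊√x⌋₊, Λ n + ∑ n ∈ Ioc 0 ⌊y⌋₊ with ¬ n.Prime, Λ n := by
        rw [← Finset.sum_union_inter]
        exact le_add_of_nonneg_right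
          (Finset.sum_nonneg fun _ _ => ArithmeticFunction.vonMangoldt_nonneg)
    _ ≤ 6 * ⌊√x⌋₊ + 2 * √⌊y⌋₊ * Real.log ⌊y⌋₊ :=
        add_le_add (sum_vonMangoldt_le _) (sum_vonMangoldt_not_prime_le hN)
    _ ≤ 6 * √x + 2 * √y * Real.log y := by
        have := Nat.floor_le (Real.sqrt_nonneg x)
        have := Real.log_nonneg hfl1
        gcongr

theorem primesRange_subset (x y : ℝ) : primesRange x y ⊆ Ioc 0 ⌊y⌋₊ := fun n hn => by
  have := mem_Ioc.1 (mem_filter.1 hn).1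
  exact mem_Ioc.2 ⟨by omega, this.2⟩

theorem vonMangoldt_of_mem_primesRange {x y : ℝ} {n : ℕ} (hn : n ∈ primesRange x y) :
    Λ n = Real.log n :=
  ArithmeticFunction.vonMangoldt_apply_prime (mem_filter.1 hn).2

theorem norm_sum_primesRange_le {x y : ℝ} (hx : 1 ≤ x) (hxy : x < y) (χ : CharIdx) :
    ‖∑ n ∈ primesRange x y, ((Real.log n * rieszWeight x y n : ℝ) : ℂ) * χ.2 n‖ ≤
      (‖rieszPsi y χ‖ + ‖rieszPsi x χ‖) / Real.log (y / x) +
        (6 * √x + 2 * √y * Real.log y) := by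
  have hx0 : 0 < x := by linarith
  have hL : 0 < Real.log (y / x) := Real.log_pos ((one_lt_div hx0).2 hxy)
  have h1 := rieszSum_sub_rieszSum (fun n => (Λ n : ℂ) * χ.2 n) hx0 hxy
  have h2 := Finset.sum_sdiff (f := fun n => (rieszWeight x y n : ℂ) * ((Λ n : ℂ) * χ.2 n))
    (primesRange_subset x y)
  have h3 : ∑ n ∈ primesRange x y, ((Real.log n * rieszWeight x y n : ℝ) : ℂ) * χ.2 n =
      ∑ n ∈ primesRange x y, (rieszWeight x y n : ℂ) * ((Λ n : ℂ) * χ.2 n) := by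
    refine Finset.sum_congr rfl fun n hn => ?_
    rw [vonMangoldt_of_mem_primesRange hn]
    push_cast; ring
  rw [h3, eq_sub_of_add_eq' h2]
  refine (norm_sub_le _ _).trans (add_le_add ?_ ?_)
  · rw [le_div_iff₀ hL]
    have h4 : ‖rieszPsi y χ - rieszPsi x χ‖ = Real.log (y / x) *
        ‖∑ n ∈ Ioc 0 ⌊y⌋₊, (rieszWeight x y n : ℂ) * ((Λ n : ℂ) * χ.2 n)‖ := by
      rw [rieszPsi, rieszPsi, h1, norm_mul, Complex.norm_of_nonneg hL.le]
    rw [mul_comm, ← h4]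
    exact norm_sub_le _ _
  · refine (norm_sum_le _ _).trans (le_trans (Finset.sum_le_sum fun n _ => ?_)
      (sum_vonMangoldt_sdiff_primesRange_le hx hxy))
    have hw := rieszWeight_nonneg hx0 hxy n
    have hΛ : 0 ≤ Λ n := ArithmeticFunction.vonMangoldt_nonneg
    rw [norm_mul, norm_mul, Complex.norm_of_nonneg hw, Complex.norm_of_nonneg hΛ]
    calc _ ≤ 1 * (Λ n * 1) := by
          gcongr
          · exact rieszWeight_le_one hx0 hxy n
          · exact DirichletCharacter.norm_le_one _ _
      _ = Λ n := by ring

theorem sum_primesRange_le {x y : ℝ} (hx : 0 < x) (hxy : x < y) :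
    ∑ n ∈ primesRange x y, Real.log n * rieszWeight x y n ≤
      ‖rieszSum (fun n => (Λ n : ℂ)) y - rieszSum (fun n => (Λ n : ℂ)) x‖ / Real.log (y / x) := by
  have hL : 0 < Real.log (y / x) := Real.log_pos ((one_lt_div hx).2 hxy)
  have h0 : ∀ n, 0 ≤ rieszWeight x y n * Λ n := fun n =>
    mul_nonneg (rieszWeight_nonneg hx hxy n) ArithmeticFunction.vonMangoldt_nonneg
  rw [rieszSum_sub_rieszSum _ hx hxy, le_div_iff₀ hL, norm_mul, Complex.norm_of_nonneg hL.le,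
    mul_comm]
  refine mul_le_mul_of_nonneg_left ?_ hL.le
  have : ∑ n ∈ Ioc 0 ⌊y⌋₊, (rieszWeight x y n : ℂ) * (Λ n : ℂ) =
      ((∑ n ∈ Ioc 0 ⌊y⌋₊, rieszWeight x y n * Λ n : ℝ) : ℂ) := by push_cast; rfl
  rw [this, Complex.norm_of_nonneg (Finset.sum_nonneg fun n _ => h0 n)]
  refine le_trans (le_of_eq (Finset.sum_congr rfl fun n hn => ?_))
    (Finset.sum_le_sum_of_subset_of_nonneg (primesRange_subset x y) fun n _ _ => h0 n)
  rw [vonMangoldt_of_mem_primesRange hn, mul_comm]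

theorem sum_ntChars_rpow_le {κ : ℝ} (hκ : 0 ≤ κ) (D : ℕ) :
    ∑ χ ∈ ntChars D, ((χ.1 + 1 : ℕ) : ℝ) ^ (κ - 1) ≤ (D:ℝ) ^ (1 + κ) := by
  rcases Nat.eq_zero_or_pos D with rfl | hD
  · have : ntChars 0 = ∅ := Finset.eq_empty_of_forall_notMem fun χ hχ => by
      have := (mem_ntChars.1 hχ).1.1
      omega
    rw [this, Finset.sum_empty]; positivity
  have hD0 : (0:ℝ) < D := by exact_mod_cast hD
  calc _ ≤ ∑ χ ∈ primChars D, ((χ.1 + 1 : ℕ) : ℝ) ^ (κ - 1) :=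
        Finset.sum_le_sum_of_subset_of_nonneg (ntChars_subset D) fun _ _ _ => by positivity
    _ ≤ ∑ q ∈ range D, (D:ℝ) ^ κ := by
        unfold primChars
        rw [Finset.sum_sigma]
        refine Finset.sum_le_sum fun q hq => ?_
        have hq1 : q + 1 ≤ D := mem_range.1 hq
        simp only [Finset.sum_const, nsmul_eq_mul]
        have hc : (univ : Finset (DirichletCharacter ℂ (q + 1))).card ≤ q + 1 := by
          rw [Finset.card_univ, ← Nat.card_eq_fintype_card,
            DirichletCharacter.card_eq_totient_of_hasEnoughRootsOfUnity]
          exact Nat.totient_le _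
        have hq0 : (0:ℝ) < ((q + 1 : ℕ) : ℝ) := by positivity
        calc _ ≤ ((q + 1 : ℕ) : ℝ) * ((q + 1 : ℕ) : ℝ) ^ (κ - 1) :=
              mul_le_mul_of_nonneg_right (Nat.cast_le.2 ((Finset.card_le_univ _).trans hc))
                (by positivity)
          _ = ((q + 1 : ℕ) : ℝ) ^ κ := by
              rw [Real.rpow_sub_one hq0.ne']; field_simp
          _ ≤ (D:ℝ) ^ κ := by
              gcongr
    _ = (D:ℝ) ^ (1 + κ) := by
        rw [Finset.sum_const, card_range, nsmul_eq_mul, Real.rpow_add hD0, Real.rpow_one]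

end TwinSieve

namespace TwinSieve
open Finset Filter Topology
open Real (posLog)
open scoped ArithmeticFunction.vonMangoldt

theorem eventually_sum_primesRange_le {η : ℝ} (hη : 0 < η) (hη1 : η ≤ 1) :
    ∀ᶠ x : ℝ in atTop, ∑ n ∈ primesRange x ((1 + η) * x),
      Real.log n * rieszWeight x ((1 + η) * x) n ≤ (1 + η) ^ 2 * x := by
  have h1 := tendsto_rieszSum_vonMangoldt.eventually_le_const (by positivity : 0 < η ^ 2 / 3)
  have h2 := (tendsto_id.const_mul_atTop (by linarith : (0:ℝ) < 1 + η)).eventually h1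
  filter_upwards [h1, h2, eventually_gt_atTop 0] with x hx hy hx0
  simp only [id] at hy
  have hy0 : 0 < (1 + η) * x := by positivity
  rw [div_le_iff₀ hx0] at hx
  rw [div_le_iff₀ hy0] at hy
  have hxy : x < (1 + η) * x := by nlinarith
  refine (sum_primesRange_le hx0 hxy).trans ?_
  rw [mul_div_assoc, div_self hx0.ne', mul_one]
  have hL : η / (1 + η) ≤ Real.log (1 + η) := by
    have h3 := Real.one_sub_inv_le_log_of_pos (by linarith : 0 < 1 + η)
    have h4 : η / (1 + η) = 1 - (1 + η)⁻¹ := by field_simp; ring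
    rwa [h4]
  have hL0 : 0 < η / (1 + η) := by positivity
  set T := rieszSum (fun n => (Λ n : ℂ))
  have h5 : ‖T ((1 + η) * x) - T x‖ ≤ η * (1 + η) * x := by
    have h6 : T ((1 + η) * x) - T x = (T ((1 + η) * x) - (((1 + η) * x : ℝ) : ℂ)) -
        (T x - (x : ℂ)) + ((η * x : ℝ) : ℂ) := by push_cast; ring
    have h7 : ‖((η * x : ℝ) : ℂ)‖ = η * x := Complex.norm_of_nonneg (by positivity)
    rw [h6]
    refine (norm_add_le _ _).trans ?_
    rw [h7]
    have h8 := norm_sub_le (T ((1 + η) * x) - (((1 + η) * x : ℝ) : ℂ)) (T x - (x : ℂ))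
    have h9 : η ^ 2 * η * x ≤ η ^ 2 * 1 * x := by gcongr
    nlinarith
  calc _ ≤ η * (1 + η) * x / (η / (1 + η)) := by gcongr
    _ = (1 + η) ^ 2 * x := by field_simp

theorem eventually_error_le {η σ : ℝ} (hη : 0 < η) (hη1 : η ≤ 1) (hσ : 0 < σ) :
    ∀ᶠ x : ℝ in atTop,
      6 * √x + 2 * √((1 + η) * x) * Real.log ((1 + η) * x) ≤ x ^ (1 / 2 + σ) := by
  have h1 := (isLittleO_log_rpow_atTop hσ).bound (by norm_num : (0:ℝ) < 1 / 14)
  filter_upwards [h1, eventually_ge_atTop (Real.exp 1), eventually_ge_atTop 2] with x hx hxe hx2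
  have hx0 : 0 < x := by linarith
  have hlog : 1 ≤ Real.log x := by rwa [Real.le_log_iff_exp_le hx0]
  rw [Real.norm_of_nonneg (by linarith), Real.norm_of_nonneg (by positivity)] at hx
  have h2 : √((1 + η) * x) ≤ 2 * √x := by
    calc √((1 + η) * x) ≤ √(2 ^ 2 * x) := Real.sqrt_le_sqrt (by nlinarith)
      _ = 2 * √x := by rw [Real.sqrt_mul (by norm_num), Real.sqrt_sq (by norm_num)]
  have h3 : Real.log ((1 + η) * x) ≤ 2 * Real.log x := by
    calc Real.log ((1 + η) * x) ≤ Real.log (x ^ 2) :=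
          Real.log_le_log (by positivity) (by nlinarith)
      _ = 2 * Real.log x := by rw [Real.log_pow]; norm_num
  have h4 : 0 ≤ Real.log ((1 + η) * x) := Real.log_nonneg (by nlinarith)
  calc 6 * √x + 2 * √((1 + η) * x) * Real.log ((1 + η) * x)
      ≤ 6 * √x * Real.log x + 2 * (2 * √x) * (2 * Real.log x) := by
        refine add_le_add (le_mul_of_one_le_right (by positivity) hlog) ?_
        gcongr
    _ = √x * (14 * Real.log x) := by ring
    _ ≤ √x * x ^ σ := by gcongr; linarith
    _ = x ^ (1 / 2 + σ) := by rw [Real.rpow_add hx0, Real.sqrt_eq_rpow]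

theorem coprime_of_mem_primesRange {x y : ℝ} {V n d : ℕ} (hV : (V:ℝ) ≤ √x)
    (hn : n ∈ primesRange x y) (hd : d ∈ oddSqfree V) : n.Coprime d := by
  obtain ⟨h1, h2⟩ := mem_filter.1 hn
  obtain ⟨⟨⟨h3, h4⟩, -⟩, -⟩ := mem_oddSqfree.1 hd
  refine (Nat.Prime.coprime_iff_not_dvd h2).2 fun h => ?_
  have h5 := Nat.le_of_dvd h3 h
  have h6 := Nat.le_floor hV
  have := (mem_Ioc.1 h1).1
  omega

/-- Logarithmically weighted count of the twin primes in `(√x, x]`. -/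
theorem sum_log_twin_le {x y : ℝ} {V : ℕ} (hx : 0 < x) (hxy : x < y) (hV1 : 1 ≤ V)
    (hV : (V:ℝ) ≤ √x) :
    ∑ n ∈ Ioc ⌊√x⌋₊ ⌊x⌋₊ with n.Prime ∧ (n + 2).Prime, Real.log n ≤
      ∑ n ∈ primesRange x y, Real.log n * rieszWeight x y n *
        (∑ d ∈ oddSqfree V with d ∣ n + 2, twinWeight V d) ^ 2 := by
  have hsub : (Ioc ⌊√x⌋₊ ⌊x⌋₊).filter (fun n => n.Prime ∧ (n + 2).Prime) ⊆
      primesRange x y := by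
    intro n hn
    obtain ⟨h1, h2, -⟩ := mem_filter.1 hn
    rw [mem_Ioc] at h1
    exact mem_filter.2 ⟨mem_Ioc.2 ⟨h1.1, h1.2.trans (Nat.floor_mono hxy.le)⟩, h2⟩
  refine le_trans (le_of_eq (Finset.sum_congr rfl fun n hn => ?_))
    (Finset.sum_le_sum_of_subset_of_nonneg hsub fun n _ _ => ?_)
  · obtain ⟨h1, h2, h3⟩ := mem_filter.1 hn
    rw [mem_Ioc] at h1
    have h4 : (oddSqfree V).filter (fun d => d ∣ n + 2) = {1} := by
      ext d
      rw [mem_filter, mem_singleton]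
      constructor
      · rintro ⟨h5, h6⟩
        rcases (Nat.dvd_prime h3).1 h6 with h | h
        · exact h
        · have h7 := (mem_oddSqfree.1 h5).1.1.2
          have h8 := Nat.le_floor hV
          omega
      · rintro rfl
        exact ⟨(sieveData_twinF hV1).one_mem, one_dvd _⟩
    have h5 : (n:ℝ) ≤ x := (Nat.le_floor_iff hx.le).1 h1.2
    rw [h4, Finset.sum_singleton, twinWeight, (sieveData_twinF hV1).selU_one,
      rieszWeight_eq_one hxy h2.pos h5]
    simp
  · exact mul_nonneg (mul_nonneg (Real.log_natCast_nonneg n) (rieszWeight_nonneg hx hxy n))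
      (sq_nonneg _)

theorem exists_sum_log_twin_le {θ η : ℝ} (hθ : 0 < θ) (hθ2 : θ < 1 / 2) (hη : 0 < η)
    (hη1 : η ≤ 1) : ∀ᶠ x : ℝ in atTop,
      ∑ n ∈ Ioc ⌊√x⌋₊ ⌊x⌋₊ with n.Prime ∧ (n + 2).Prime, Real.log n ≤
        1 / selG (oddSqfree ⌊x ^ (θ / 2)⌋₊) twinF * ((1 + 4 * η) * x) := by
  obtain ⟨κ, hκ0, hκ, hG⟩ := exists_sum_rpow_mul_rieszPsi_le hθ.le hθ2
  obtain ⟨C, hC, hsieve⟩ := exists_sum_mul_sq_twinWeight_le hκ0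
  set L := Real.log (1 + η) with hL
  have hL0 : 0 < L := Real.log_pos (by linarith)
  set η' := η / (C * (3 / L + 1)) with hη'
  have hη'0 : 0 < η' := by positivity
  obtain ⟨X, hX⟩ := hG η' hη'0
  set σ := (1 - 2 * θ) / 8 with hσ
  have hσ0 : 0 < σ := by rw [hσ]; linarith
  have hpow : ∀ᶠ x : ℝ in atTop, 1 / η' ≤ x ^ (2 * σ) :=
    (tendsto_rpow_atTop (by positivity)).eventually_ge_atTop _
  filter_upwards [eventually_sum_primesRange_le hη hη1, eventually_error_le hη hη1 hσ0, hpow,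
    eventually_ge_atTop X, eventually_ge_atTop 1] with x h1 h2 h3 hxX hx1
  have hx0 : 0 < x := by linarith
  set y := (1 + η) * x with hy
  have hxy : x < y := by rw [hy]; nlinarith
  set V := ⌊x ^ (θ / 2)⌋₊ with hV
  have hV1 : 1 ≤ V := (Nat.one_le_floor_iff _).2 (Real.one_le_rpow hx1 (by linarith))
  have hVle : (V:ℝ) ≤ x ^ (θ / 2) := Nat.floor_le (by positivity)
  have hVx : (V:ℝ) ≤ √x := by
    rw [Real.sqrt_eq_rpow]
    exact hVle.trans (Real.rpow_le_rpow_of_exponent_le hx1 (by linarith))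
  have hVsq : ((V ^ 2 : ℕ) : ℝ) ≤ x ^ θ := by
    push_cast
    calc (V:ℝ) ^ 2 ≤ (x ^ (θ / 2)) ^ 2 := by gcongr
      _ = x ^ θ := by
          rw [← Real.rpow_natCast, ← Real.rpow_mul hx0.le]; congr 1; push_cast; ring
  have hVsq' : ((V ^ 2 : ℕ) : ℝ) ≤ y ^ θ :=
    hVsq.trans (Real.rpow_le_rpow hx0.le hxy.le hθ.le)
  have hyx : y / x = 1 + η := by rw [hy]; field_simp
  have hg := (sieveData_twinF hV1).selG_ge_one
  refine (sum_log_twin_le hx0 hxy hV1 hVx).trans ((hsieve V (primesRange x y)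
    (fun n => Real.log n * rieszWeight x y n) hV1
    (fun n hn d hd => coprime_of_mem_primesRange hVx hn hd)
    (fun n _ => mul_nonneg (Real.log_natCast_nonneg n) (rieszWeight_nonneg hx0 hxy n))).trans ?_)
  refine mul_le_mul_of_nonneg_left ?_ (by positivity)
  have hA := hX x hxX (V ^ 2) hVsq
  have hB := hX y (hxX.trans hxy.le) (V ^ 2) hVsq'
  have hy2 : y ≤ 2 * x := by rw [hy]; nlinarith
  have hE : (6 * √x + 2 * √y * Real.log y) *
      ∑ χ ∈ ntChars (V ^ 2), ((χ.1 + 1 : ℕ) : ℝ) ^ (κ - 1) ≤ η' * x := by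
    have h4 : ∑ χ ∈ ntChars (V ^ 2), ((χ.1 + 1 : ℕ) : ℝ) ^ (κ - 1) ≤ x ^ (θ + σ) := by
      refine (sum_ntChars_rpow_le hκ0.le _).trans ?_
      calc ((V ^ 2 : ℕ) : ℝ) ^ (1 + κ) ≤ (x ^ θ) ^ (1 + κ) := by gcongr
        _ = x ^ (θ * (1 + κ)) := by rw [Real.rpow_mul hx0.le]
        _ ≤ x ^ (θ + σ) := by
            refine Real.rpow_le_rpow_of_exponent_le hx1 ?_
            have : θ * κ ≤ 1 / 2 * ((1 - 2 * θ) / 4) := by gcongr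
            rw [hσ]; linarith
    calc _ ≤ x ^ (1 / 2 + σ) * x ^ (θ + σ) := by
          refine mul_le_mul h2 h4 (Finset.sum_nonneg fun _ _ => by positivity) (by positivity)
      _ = x ^ (1 - 2 * σ) := by
          rw [← Real.rpow_add hx0]; congr 1; rw [hσ]; ring
      _ = x / x ^ (2 * σ) := by rw [Real.rpow_sub hx0, Real.rpow_one]
      _ ≤ x / (1 / η') := by gcongr
      _ = η' * x := by field_simp
  have hsum : ∑ χ ∈ ntChars (V ^ 2), ((χ.1 + 1 : ℕ) : ℝ) ^ (κ - 1) *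
      ‖∑ n ∈ primesRange x y, ((Real.log n * rieszWeight x y n : ℝ) : ℂ) * χ.2 n‖ ≤
      (3 / L + 1) * η' * x := by
    calc _ ≤ ∑ χ ∈ ntChars (V ^ 2), ((χ.1 + 1 : ℕ) : ℝ) ^ (κ - 1) *
          ((‖rieszPsi y χ‖ + ‖rieszPsi x χ‖) / L + (6 * √x + 2 * √y * Real.log y)) := by
          refine Finset.sum_le_sum fun χ _ => ?_
          have := norm_sum_primesRange_le hx1 hxy χ
          rw [hyx] at this
          exact mul_le_mul_of_nonneg_left this (by positivity)
      _ = (∑ χ ∈ ntChars (V ^ 2), ((χ.1 + 1 : ℕ) : ℝ) ^ (κ - 1) * ‖rieszPsi y χ‖ +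
          ∑ χ ∈ ntChars (V ^ 2), ((χ.1 + 1 : ℕ) : ℝ) ^ (κ - 1) * ‖rieszPsi x χ‖) / L +
          (6 * √x + 2 * √y * Real.log y) *
            ∑ χ ∈ ntChars (V ^ 2), ((χ.1 + 1 : ℕ) : ℝ) ^ (κ - 1) := by
          rw [← Finset.sum_add_distrib, Finset.sum_div, Finset.mul_sum, ← Finset.sum_add_distrib]
          exact Finset.sum_congr rfl fun χ _ => by ring
      _ ≤ (η' * (2 * x) + η' * x) / L + η' * x := by
          gcongr
          exact hB.trans (by gcongr)
      _ = (3 / L + 1) * η' * x := by ring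
  calc _ ≤ (1 + η) ^ 2 * x + C * ((3 / L + 1) * η' * x) := by
        refine add_le_add h1 (mul_le_mul_of_nonneg_left hsum hC.le)
    _ = ((1 + η) ^ 2 + η) * x := by
        rw [hη']; field_simp
    _ ≤ (1 + 4 * η) * x := mul_le_mul_of_nonneg_right (by nlinarith) hx0.le

end TwinSieve

namespace TwinSieve
open Finset Filter Topology

theorem Pi2_le {x η : ℝ} (hη : 0 < η) (hη1 : η ≤ 1 / 2) (hx : 1 < x) :
    (Pi2 x : ℝ) ≤ x ^ (1 - η) +
      (∑ n ∈ Ioc ⌊√x⌋₊ ⌊x⌋₊ with n.Prime ∧ (n + 2).Prime, Real.log n) /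
        ((1 - η) * Real.log x) := by
  have hx0 : 0 < x := by linarith
  have hlog : 0 < Real.log x := Real.log_pos hx
  have hd : 0 < (1 - η) * Real.log x := mul_pos (by linarith) hlog
  set N := ⌊x ^ (1 - η)⌋₊ with hN
  set T := (Ioc N ⌊x⌋₊).filter fun n => n.Prime ∧ (n + 2).Prime with hT
  have hsub : (Finset.range (⌊x⌋₊ + 1)).filter (fun p => p.Prime ∧ (p + 2).Prime) ⊆
      Ioc 0 N ∪ T := by
    intro p hp
    rw [mem_filter, mem_range] at hp
    rw [mem_union, mem_Ioc, hT, mem_filter, mem_Ioc]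
    have := hp.2.1.pos
    rcases le_or_gt p N with h | h
    · exact Or.inl ⟨this, h⟩
    · exact Or.inr ⟨⟨h, by omega⟩, hp.2⟩
  have h1 : (Pi2 x : ℝ) ≤ N + (T.card : ℝ) := by
    have := (Finset.card_le_card hsub).trans (Finset.card_union_le _ _)
    rw [Nat.card_Ioc, Nat.sub_zero] at this
    exact_mod_cast this
  have h2 : (N : ℝ) ≤ x ^ (1 - η) := Nat.floor_le (by positivity)
  have h3 : (T.card : ℝ) * ((1 - η) * Real.log x) ≤
      ∑ n ∈ Ioc ⌊√x⌋₊ ⌊x⌋₊ with n.Prime ∧ (n + 2).Prime, Real.log n := by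
    rw [← nsmul_eq_mul]
    refine (Finset.card_nsmul_le_sum T (fun n => Real.log n) _ fun n hn => ?_).trans
      (Finset.sum_le_sum_of_subset_of_nonneg (Finset.filter_subset_filter _ ?_)
        fun n _ _ => Real.log_natCast_nonneg n)
    · have h4 := (mem_Ioc.1 (mem_filter.1 hn).1).1
      have h5 : x ^ (1 - η) ≤ n := ((Nat.floor_lt (by positivity)).1 h4).le
      rw [← Real.log_rpow hx0]
      exact Real.log_le_log (by positivity) h5
    · refine Finset.Ioc_subset_Ioc_left (Nat.floor_mono ?_)
      rw [Real.sqrt_eq_rpow]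
      exact Real.rpow_le_rpow_of_exponent_le hx.le (by linarith)
  rw [← le_div_iff₀ hd] at h3
  linarith

theorem eventually_one_div_selG_le {θ η : ℝ} (hθ : 0 < θ) (hη : 0 < η) :
    ∃ K : ℝ, ∀ᶠ x : ℝ in atTop, 1 / selG (oddSqfree ⌊x ^ (θ / 2)⌋₊) twinF ≤
      twinPrimeConst * (1 + η) / (θ / 2 * Real.log x - K) := by
  have hC := twinPrimeConst_pos
  obtain ⟨K, hK⟩ := exists_log_le_mul_selG (mul_pos hC hη)
  refine ⟨Real.log 2 + K, ?_⟩
  have h1 := (Real.tendsto_log_atTop.const_mul_atTop (by positivity : 0 < θ / 2)).eventually_gt_atTop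
    (Real.log 2 + K)
  filter_upwards [h1, eventually_ge_atTop 1] with x hx hx1
  have hx0 : 0 < x := by linarith
  have hp : 1 ≤ x ^ (θ / 2) := Real.one_le_rpow hx1 (by linarith)
  have hV1 : 1 ≤ ⌊x ^ (θ / 2)⌋₊ := (Nat.one_le_floor_iff _).2 hp
  have hg := (sieveData_twinF hV1).selG_ge_one
  have h2 := hK _ hV1
  have h3 : θ / 2 * Real.log x - Real.log 2 ≤ Real.log ⌊x ^ (θ / 2)⌋₊ := by
    rw [← Real.log_rpow hx0, ← Real.log_div (by positivity) two_ne_zero]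
    refine Real.log_le_log (by positivity) ?_
    have h4 := Nat.lt_floor_add_one (x ^ (θ / 2))
    have h5 : (1:ℝ) ≤ ⌊x ^ (θ / 2)⌋₊ := by exact_mod_cast hV1
    linarith
  rw [div_le_div_iff₀ (by linarith) (by linarith), one_mul]
  linarith

theorem eventually_Pi2_le {ε : ℝ} (hε : 0 < ε) : ∀ᶠ x : ℝ in atTop,
    (Pi2 x : ℝ) ≤ (4 + ε) * twinPrimeConst * x / (Real.log x) ^ 2 := by
  have hC := twinPrimeConst_pos
  obtain ⟨η, hη, hη1, hηε⟩ : ∃ η : ℝ, 0 < η ∧ η ≤ 1 / 2 ∧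
      (1 + 4 * η) * (1 + η) / (1 - η) * (4 / (1 - η)) < 4 + ε := by
    have h1 : ContinuousAt (fun η : ℝ => (1 + 4 * η) * (1 + η) / (1 - η) * (4 / (1 - η))) 0 := by
      have : (1:ℝ) - 0 ≠ 0 := by norm_num
      fun_prop (disch := assumption)
    have h2 := (h1.tendsto.mono_left (nhdsWithin_le_nhds (s := Set.Ioi 0))).eventually_lt_const
      (show (1 + 4 * (0:ℝ)) * (1 + 0) / (1 - 0) * (4 / (1 - 0)) < 4 + ε by norm_num; exact hε)
    obtain ⟨η, h3, h4⟩ := (h2.and (Ioc_mem_nhdsGT (by norm_num : (0:ℝ) < 1 / 2))).exists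
    exact ⟨η, h4.1, h4.2, h3⟩
  set θ := (1 - η) / 2 with hθ
  have hθ0 : 0 < θ := by rw [hθ]; linarith
  obtain ⟨K, hK⟩ := eventually_one_div_selG_le hθ0 hη
  set A := (1 + 4 * η) * (1 + η) / (1 - η) with hA
  have hlim : Tendsto (fun x : ℝ => Real.log x ^ (2:ℝ) / x ^ η +
      A * twinPrimeConst * (θ / 2 - K / Real.log x)⁻¹) atTop
      (𝓝 (0 + A * twinPrimeConst * (θ / 2 - 0)⁻¹)) := by
    refine (isLittleO_log_rpow_rpow_atTop 2 hη).tendsto_div_nhds_zero.add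
      (Tendsto.const_mul _ (Tendsto.inv₀ ?_ (by linarith)))
    exact (Real.tendsto_log_atTop.const_div_atTop K).const_sub _
  have hlt : 0 + A * twinPrimeConst * (θ / 2 - 0)⁻¹ < (4 + ε) * twinPrimeConst := by
    have : A * twinPrimeConst * (θ / 2 - 0)⁻¹ = A * (4 / (1 - η)) * twinPrimeConst := by
      rw [hθ, sub_zero]; field_simp; norm_num
    rw [zero_add, this]
    exact mul_lt_mul_of_pos_right hηε hC
  have hlog := (Real.tendsto_log_atTop.const_mul_atTop
    (by positivity : 0 < θ / 2)).eventually_gt_atTop K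
  filter_upwards [hK, hlim.eventually_le_const hlt, hlog, eventually_gt_atTop 1,
    exists_sum_log_twin_le hθ0 (by rw [hθ]; linarith) hη (by linarith)] with x h1 h2 h3 hx1 h4
  have hx0 : 0 < x := by linarith
  have hl : 0 < Real.log x := Real.log_pos hx1
  have hη' : 0 < 1 - η := by linarith
  have hm : 0 < θ / 2 * Real.log x - K := by linarith
  rw [le_div_iff₀ (by positivity)]
  calc (Pi2 x : ℝ) * Real.log x ^ 2
      ≤ (x ^ (1 - η) + twinPrimeConst * (1 + η) / (θ / 2 * Real.log x - K) *
          ((1 + 4 * η) * x) / ((1 - η) * Real.log x)) * Real.log x ^ 2 := by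
        refine mul_le_mul_of_nonneg_right ((Pi2_le hη hη1 hx1).trans ?_) (by positivity)
        gcongr
        exact h4.trans (by gcongr)
    _ = (Real.log x ^ (2:ℝ) / x ^ η + A * twinPrimeConst * (θ / 2 - K / Real.log x)⁻¹) * x := by
        have e1 : θ / 2 - K / Real.log x = (θ / 2 * Real.log x - K) / Real.log x := by
          field_simp
        have e2 : Real.log x ^ (2:ℝ) = Real.log x ^ 2 := by
          exact_mod_cast Real.rpow_natCast (Real.log x) 2
        rw [e1, e2, hA, Real.rpow_sub hx0, Real.rpow_one, inv_div]
        field_simp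
    _ ≤ (4 + ε) * twinPrimeConst * x := by gcongr

end TwinSieve

/-- For every `ε > 0` there is an (effectively computable) `X(ε) > 0` such that for all
`x ≥ X(ε)` one has `Π₂(x) ≤ (4 + ε) C₂ x / (log x)²`. -/
theorem twin_primes_effective_upper_bound :
    ∀ ε : ℝ, 0 < ε → ∃ X : ℝ, 0 < X ∧ ∀ x : ℝ, X ≤ x →
      (Pi2 x : ℝ) ≤ (4 + ε) * twinPrimeConst * x / (Real.log x) ^ 2 := by
  intro ε hε
  obtain ⟨X, hX⟩ := Filter.eventually_atTop.1 (TwinSieve.eventually_Pi2_le hε)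
  exact ⟨max X 1, by positivity, fun x hx => hX x ((le_max_left _ _).trans hx)⟩
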